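/- Entropy growth bound for the logarithmic Schrödinger equation: in the same setting, Ent_μ(|φ(·,t)|^2) ≤ Ent_μ(|f|^2) + (1/|λ|)(e^{2|λ|t} − 1)·μ|∇f|^2 for all t ≥ 0 and λ ≠ 0. -/

import Mathlib

open MeasureTheory Real

noncomputable section

/-- `j`-th partial derivative of a complex-valued function on `ℝⁿ`. -/
def pdC (n : ℕ) (f : EuclideanSpace ℝ (Fin n) → ℂ) (j : Fin n)
    (x : EuclideanSpace ℝ (Fin n)) : ℂ :=
  fderiv ℝ f x (EuclideanSpace.single j 1)

/-- `j`-th partial derivative of a real-valued function on `ℝⁿ`. -/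
def pdR (n : ℕ) (f : EuclideanSpace ℝ (Fin n) → ℝ) (j : Fin n)
    (x : EuclideanSpace ℝ (Fin n)) : ℝ :=
  fderiv ℝ f x (EuclideanSpace.single j 1)

/-- The drift operator `L f = Δf − ∇U·∇f` acting on complex-valued functions. -/
def LopC (n : ℕ) (U : EuclideanSpace ℝ (Fin n) → ℝ) (f : EuclideanSpace ℝ (Fin n) → ℂ)
    (x : EuclideanSpace ℝ (Fin n)) : ℂ :=
  (∑ j : Fin n, pdC n (fun y => pdC n f j y) j x) -
    ∑ j : Fin n, (pdR n U j x : ℂ) * pdC n f j x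

/-- Squared length of the gradient of a complex-valued function: `∑ⱼ |∂ⱼ f|²`. -/
def gradSqC (n : ℕ) (f : EuclideanSpace ℝ (Fin n) → ℂ) (x : EuclideanSpace ℝ (Fin n)) : ℝ :=
  ∑ j : Fin n, ‖pdC n f j x‖ ^ 2

open Filter Topology
open scoped ContDiff ComplexConjugate

/-- The logarithmic nonlinearity is one-sided Lipschitz in its imaginary pairing. -/
lemma abs_im_log_nonlinearity_sub_le (z w : ℂ) :
    |((z * (Real.log (‖z‖ ^ 2) : ℂ) - w * (Real.log (‖w‖ ^ 2) : ℂ)) *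
      (starRingEnd ℂ) (z - w)).im| ≤ 2 * ‖z - w‖ ^ 2 := by
  have key : ((z * (Real.log (‖z‖ ^ 2) : ℂ) - w * (Real.log (‖w‖ ^ 2) : ℂ)) *
      (starRingEnd ℂ) (z - w)).im
      = -((Real.log (‖z‖ ^ 2) - Real.log (‖w‖ ^ 2)) * (z * (starRingEnd ℂ) w).im) := by
    simp only [map_sub, Complex.mul_im, Complex.sub_re, Complex.sub_im, Complex.mul_re,
      Complex.conj_re, Complex.conj_im, Complex.ofReal_re, Complex.ofReal_im]
    ring
  rw [key, abs_neg, abs_mul]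
  by_cases hz : z = 0
  · simp [hz]
  by_cases hw : w = 0
  · simp [hw]
  have hz' : 0 < ‖z‖ := norm_pos_iff.2 hz
  have hw' : 0 < ‖w‖ := norm_pos_iff.2 hw
  have h1 : |(z * (starRingEnd ℂ) w).im| ≤ ‖z - w‖ * ‖w‖ := by
    have : (z * (starRingEnd ℂ) w).im = ((z - w) * (starRingEnd ℂ) w).im := by
      simp only [Complex.mul_im, Complex.sub_re, Complex.sub_im, Complex.conj_re, Complex.conj_im]
      ring
    rw [this]
    refine (Complex.abs_im_le_norm _).trans ?_
    rw [norm_mul, RCLike.norm_conj]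
  have h2 : |(z * (starRingEnd ℂ) w).im| ≤ ‖z - w‖ * ‖z‖ := by
    have : (z * (starRingEnd ℂ) w).im = ((z - w) * (starRingEnd ℂ) z).im := by
      simp only [Complex.mul_im, Complex.sub_re, Complex.sub_im, Complex.conj_re, Complex.conj_im]
      ring
    rw [this]
    refine (Complex.abs_im_le_norm _).trans ?_
    rw [norm_mul, RCLike.norm_conj]
  have aux : ∀ a b : ℝ, 0 < a → 0 < b → a ≤ b →
      |Real.log (b ^ 2) - Real.log (a ^ 2)| * a ≤ 2 * (b - a) := by
    intro a b ha hb hab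
    have e : Real.log (b ^ 2) - Real.log (a ^ 2) = 2 * Real.log (b / a) := by
      rw [Real.log_pow, Real.log_pow, Real.log_div hb.ne' ha.ne']; push_cast; ring
    have h0 : 0 ≤ Real.log (b / a) := Real.log_nonneg (by rw [le_div_iff₀ ha]; linarith)
    have h3 : Real.log (b / a) ≤ b / a - 1 := Real.log_le_sub_one_of_pos (by positivity)
    rw [e, abs_of_nonneg (by linarith)]
    calc 2 * Real.log (b / a) * a ≤ 2 * (b / a - 1) * a := by gcongr
      _ = 2 * (b - a) := by field_simp
  have hd : |‖z‖ - ‖w‖| ≤ ‖z - w‖ := abs_norm_sub_norm_le z w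
  have hd' := abs_le.1 hd
  rcases le_total ‖z‖ ‖w‖ with h | h
  · have := aux ‖z‖ ‖w‖ hz' hw' h
    rw [abs_sub_comm] at this
    calc _ ≤ |Real.log (‖z‖ ^ 2) - Real.log (‖w‖ ^ 2)| * (‖z - w‖ * ‖z‖) := by gcongr
      _ = (|Real.log (‖z‖ ^ 2) - Real.log (‖w‖ ^ 2)| * ‖z‖) * ‖z - w‖ := by ring
      _ ≤ (2 * ‖z - w‖) * ‖z - w‖ :=
          mul_le_mul_of_nonneg_right (by linarith) (norm_nonneg _)
      _ = _ := by ring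
  · have := aux ‖w‖ ‖z‖ hw' hz' h
    calc _ ≤ |Real.log (‖z‖ ^ 2) - Real.log (‖w‖ ^ 2)| * (‖z - w‖ * ‖w‖) := by gcongr
      _ = (|Real.log (‖z‖ ^ 2) - Real.log (‖w‖ ^ 2)| * ‖w‖) * ‖z - w‖ := by ring
      _ ≤ (2 * ‖z - w‖) * ‖z - w‖ :=
          mul_le_mul_of_nonneg_right (by linarith) (norm_nonneg _)
      _ = _ := by ring

lemma re_mul_conj_eq (z w : ℂ) :
    (z * (starRingEnd ℂ) w).re = (‖z‖ ^ 2 + ‖w‖ ^ 2 - ‖z - w‖ ^ 2) / 2 := by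
  simp only [← Complex.normSq_eq_norm_sq, Complex.normSq_apply, Complex.mul_re, Complex.sub_re,
    Complex.sub_im, Complex.conj_re, Complex.conj_im]
  ring

/-- Symmetric second-order Taylor bound for the logarithm along a pair of complex numbers. -/
lemma abs_re_mul_log_sub_le (z w : ℂ) :
    |(z * (starRingEnd ℂ) w).re * (Real.log (‖z‖ ^ 2) - Real.log (‖w‖ ^ 2))
      - (‖z‖ ^ 2 - ‖w‖ ^ 2)| ≤ 9 * ‖z - w‖ ^ 2 := by
  by_cases hz : z = 0
  · subst hz; simp; nlinarith [sq_nonneg ‖w‖]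
  by_cases hw : w = 0
  · subst hw; simp; nlinarith [sq_nonneg ‖z‖]
  have hz' : 0 < ‖z‖ := norm_pos_iff.2 hz
  have hw' : 0 < ‖w‖ := norm_pos_iff.2 hw
  have hd : |‖z‖ - ‖w‖| ≤ ‖z - w‖ := abs_norm_sub_norm_le z w
  have hs : ‖z - w‖ ≤ ‖z‖ + ‖w‖ := norm_sub_le z w
  rw [re_mul_conj_eq]
  have aux : ∀ a b d : ℝ, 0 < b → b ≤ a → a - b ≤ d → d ≤ a + b →
      |(a ^ 2 + b ^ 2 - d ^ 2) / 2 * (Real.log (a ^ 2) - Real.log (b ^ 2)) - (a ^ 2 - b ^ 2)|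
        ≤ 9 * d ^ 2 := by
    intro a b d hb hab hd hs
    have ha : 0 < a := hb.trans_le hab
    set L := Real.log (a / b) with hL
    have e : Real.log (a ^ 2) - Real.log (b ^ 2) = 2 * L := by
      rw [hL, Real.log_pow, Real.log_pow, Real.log_div ha.ne' hb.ne']; push_cast; ring
    have h0 : 0 ≤ L := Real.log_nonneg (by rw [le_div_iff₀ hb]; linarith)
    have h1 : b * L ≤ a - b := by
      have h3 : L ≤ a / b - 1 := Real.log_le_sub_one_of_pos (by positivity)
      calc b * L ≤ b * (a / b - 1) := by gcongr
        _ = a - b := by field_simp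
    have h2 : a - b ≤ a * L := by
      have h3 : 1 - (a / b)⁻¹ ≤ L := Real.one_sub_inv_le_log_of_pos (by positivity)
      calc a - b = a * (1 - (a / b)⁻¹) := by field_simp
        _ ≤ a * L := by gcongr
    have hd2 : (a - b) ^ 2 ≤ d ^ 2 := by
      apply pow_le_pow_left₀ (by linarith) hd
    have hk1 : (d ^ 2 - (a - b) ^ 2) ≤ 4 * a * b := by nlinarith
    have hk : (d ^ 2 - (a - b) ^ 2) * L ≤ 8 * d ^ 2 := by
      rcases le_total a (2 * b) with h | h
      · have : L ≤ 1 := by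
          by_contra hc
          push Not at hc
          nlinarith
        nlinarith [sq_nonneg (a - b), sq_nonneg d]
      · calc (d ^ 2 - (a - b) ^ 2) * L ≤ 4 * a * b * L := by gcongr
          _ = 4 * a * (b * L) := by ring
          _ ≤ 4 * a * (a - b) := by gcongr
          _ ≤ 8 * (a - b) ^ 2 := by nlinarith
          _ ≤ _ := by linarith
    have hk0 : 0 ≤ (d ^ 2 - (a - b) ^ 2) * L := mul_nonneg (by linarith) h0
    have hm1 : 2 * a * b * L ≤ 2 * a * (a - b) := by
      have := mul_le_mul_of_nonneg_left h1 (by positivity : 0 ≤ 2 * a); linarith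
    have hm2 : 2 * b * (a - b) ≤ 2 * a * b * L := by
      have := mul_le_mul_of_nonneg_left h2 (by positivity : 0 ≤ 2 * b); linarith
    rw [e]
    have e2 : (a ^ 2 + b ^ 2 - d ^ 2) / 2 * (2 * L) - (a ^ 2 - b ^ 2)
        = 2 * a * b * L - (a ^ 2 - b ^ 2) - (d ^ 2 - (a - b) ^ 2) * L := by ring
    rw [e2, abs_le]
    constructor <;> nlinarith
  rcases le_total ‖w‖ ‖z‖ with h | h
  · exact aux _ _ _ hw' h ((le_abs_self _).trans hd) hs
  · have := aux _ _ ‖z - w‖ hz' h (by rw [abs_sub_comm] at hd; exact (le_abs_self _).trans hd)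
      (by linarith)
    rw [← abs_neg]
    convert this using 2
    ring

lemma mul_abs_log_sq_le_two {x : ℝ} (hx : 0 ≤ x) (hx1 : x ≤ 1) :
    x * |Real.log (x ^ 2)| ≤ 2 := by
  rcases hx.eq_or_lt with rfl | hx0
  · simp
  have h := Real.abs_log_mul_self_lt x hx0 hx1
  rw [abs_mul, abs_of_pos hx0] at h
  rw [Real.log_pow, abs_mul, Nat.cast_ofNat, abs_of_pos (by norm_num : (0:ℝ) < 2)]
  nlinarith

/-- The nonlinearity `z ↦ z log |z|²`. -/
def logNL (z : ℂ) : ℂ := z * (Real.log (‖z‖ ^ 2) : ℂ)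

lemma norm_logNL (z : ℂ) : ‖logNL z‖ = ‖z‖ * |Real.log (‖z‖ ^ 2)| := by
  rw [logNL, norm_mul, Complex.norm_real, Real.norm_eq_abs]

lemma mul_abs_log_sq_le {x : ℝ} (hx : 0 ≤ x) : x * |Real.log (x ^ 2)| ≤ 2 + 2 * x ^ 2 := by
  rcases le_total x 1 with h | h
  · have := mul_abs_log_sq_le_two hx h
    nlinarith [sq_nonneg x]
  · have h1 : 0 ≤ Real.log x := Real.log_nonneg h
    have h2 : Real.log x ≤ x - 1 := Real.log_le_sub_one_of_pos (by linarith)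
    rw [Real.log_pow, Nat.cast_ofNat, abs_of_nonneg (by linarith)]
    nlinarith

lemma norm_logNL_le (z : ℂ) : ‖logNL z‖ ≤ 2 + 2 * ‖z‖ ^ 2 := by
  rw [norm_logNL]; exact mul_abs_log_sq_le (norm_nonneg z)

lemma continuous_logNL : Continuous logNL := by
  rw [continuous_iff_continuousAt]
  intro z
  by_cases hz : z = 0
  · subst hz
    have h0 : logNL 0 = 0 := by simp [logNL]
    rw [ContinuousAt, h0, tendsto_zero_iff_norm_tendsto_zero]
    have h1 : Continuous fun z : ℂ => 2 * |‖z‖ * Real.log ‖z‖| :=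
      continuous_const.mul (Real.continuous_mul_log.comp continuous_norm).abs
    have h2 := h1.tendsto 0
    simp only [norm_zero, zero_mul, abs_zero, mul_zero] at h2
    refine h2.congr fun w => ?_
    rw [norm_logNL, Real.log_pow, abs_mul, abs_mul, abs_of_nonneg (norm_nonneg w),
      Nat.cast_ofNat, abs_of_pos (by norm_num : (0:ℝ) < 2)]
    ring
  · have hz' : ‖z‖ ^ 2 ≠ 0 := by simpa using hz
    have h1 : ContinuousAt (fun w : ℂ => Real.log (‖w‖ ^ 2)) z :=
      (continuous_norm.pow 2).continuousAt.log hz'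
    exact continuousAt_id.mul (Complex.continuous_ofReal.continuousAt.comp h1)

/-- A Young-type inequality for the product of `‖u‖` with the logarithmic nonlinearity at `v`. -/
lemma norm_mul_logNL_le {K : ℝ} (hK : 1 ≤ K) (u v : ℂ) :
    ‖u‖ * ‖logNL v‖ ≤ (1 / K) * (‖v‖ ^ 2 * |Real.log (‖v‖ ^ 2)|) + (2 * ‖u‖ +
      K * ‖u‖ ^ 2 * (2 * Real.log K + |Real.log (‖u‖ ^ 2)|)) := by
  have hK0 : 0 < K := by linarith
  have hlogK : 0 ≤ Real.log K := Real.log_nonneg hK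
  rw [norm_logNL]
  set a := ‖u‖ with ha
  set x := ‖v‖ with hx
  have ha0 : 0 ≤ a := norm_nonneg u
  have hx0 : 0 ≤ x := norm_nonneg v
  have hn1 : 0 ≤ (1 / K) * (x ^ 2 * |Real.log (x ^ 2)|) := by positivity
  have hn2 : 0 ≤ K * a ^ 2 * (2 * Real.log K + |Real.log (a ^ 2)|) := by positivity
  rcases le_total (K * a) x with h | h
  · have : a ≤ 1 / K * x := by
      rw [one_div, ← div_eq_inv_mul, le_div_iff₀ hK0]; linarith
    have : a * (x * |Real.log (x ^ 2)|) ≤ (1 / K * x) * (x * |Real.log (x ^ 2)|) := by gcongr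
    nlinarith
  · rcases le_total x 1 with h1 | h1
    · have := mul_abs_log_sq_le_two hx0 h1
      nlinarith
    · have hapos : 0 < a := by
        rcases ha0.eq_or_lt with h2 | h2
        · rw [← h2] at h; linarith
        · exact h2
      have hl : |Real.log (x ^ 2)| ≤ 2 * Real.log K + |Real.log (a ^ 2)| := by
        rw [abs_of_nonneg (Real.log_nonneg (one_le_pow₀ h1))]
        have : Real.log (x ^ 2) ≤ Real.log ((K * a) ^ 2) :=
          Real.log_le_log (by positivity) (by gcongr)
        rw [mul_pow, Real.log_mul (by positivity) (by positivity), Real.log_pow K] at this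
        push_cast at this
        linarith [le_abs_self (Real.log (a ^ 2))]
      calc a * (x * |Real.log (x ^ 2)|)
          ≤ a * ((K * a) * (2 * Real.log K + |Real.log (a ^ 2)|)) := by gcongr
        _ = K * a ^ 2 * (2 * Real.log K + |Real.log (a ^ 2)|) := by ring
        _ ≤ _ := by linarith

section MeasureLemmas

variable {X : Type*} [MeasurableSpace X] {μ : Measure X}

/-- A Vitali-type criterion: pointwise convergence to zero plus domination by a constant up to
functions of arbitrarily small integral. -/
lemma tendsto_integral_zero_of_le_const_add [IsFiniteMeasure μ] {ι : Type*} {l : Filter ι}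
    [l.IsCountablyGenerated] {h : ι → X → ℝ}
    (hm : ∀ᶠ i in l, AEStronglyMeasurable (h i) μ) (h0 : ∀ᶠ i in l, ∀ x, 0 ≤ h i x)
    (hl : ∀ x, Tendsto (fun i => h i x) l (𝓝 0))
    (hb : ∀ ε > 0, ∃ (R : ℝ) (G : ι → X → ℝ), ∀ᶠ i in l, Integrable (G i) μ ∧
      ∫ x, G i x ∂μ ≤ ε ∧ ∀ x, 0 ≤ G i x ∧ h i x ≤ R + G i x) :
    Tendsto (fun i => ∫ x, h i x ∂μ) l (𝓝 0) := by
  rw [Metric.tendsto_nhds]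
  intro ε hε
  obtain ⟨R, G, hG⟩ := hb (ε / 2) (by positivity)
  have hmin : Tendsto (fun i => ∫ x, min (h i x) |R| ∂μ) l (𝓝 (∫ _, (0 : ℝ) ∂μ)) := by
    refine tendsto_integral_filter_of_dominated_convergence (fun _ => |R|) ?_ ?_
      (integrable_const _) ?_
    · filter_upwards [hm] with i hi
      exact hi.inf aestronglyMeasurable_const
    · filter_upwards [h0] with i hi
      refine Eventually.of_forall fun x => ?_
      rw [Real.norm_eq_abs, abs_of_nonneg (le_min (hi x) (abs_nonneg R))]
      exact min_le_right _ _
    · refine Eventually.of_forall fun x => ?_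
      have := (hl x).min (tendsto_const_nhds (x := |R|))
      rwa [min_eq_left (abs_nonneg R)] at this
  rw [integral_zero] at hmin
  rw [Metric.tendsto_nhds] at hmin
  filter_upwards [hm, h0, hG, hmin (ε / 2) (by positivity)] with i hm h0 hG hmin
  obtain ⟨hGi, hGe, hGb⟩ := hG
  rw [Real.dist_eq, sub_zero] at hmin ⊢
  rw [abs_of_nonneg (integral_nonneg h0)]
  have hmi : Integrable (fun x => min (h i x) |R|) μ := by
    refine Integrable.mono' (integrable_const |R|) (hm.inf aestronglyMeasurable_const) ?_
    refine Eventually.of_forall fun x => ?_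
    rw [Real.norm_eq_abs, abs_of_nonneg (le_min (h0 x) (abs_nonneg R))]
    exact min_le_right _ _
  have hle : ∫ x, h i x ∂μ ≤ ∫ x, (min (h i x) |R| + G i x) ∂μ := by
    refine integral_mono_of_nonneg (Eventually.of_forall h0) (hmi.add hGi)
      (Eventually.of_forall fun x => ?_)
    have h1 := hGb x
    have h2 := le_abs_self R
    rcases le_total (h i x) |R| with h3 | h3
    · simp only [min_eq_left h3]; linarith
    · simp only [min_eq_right h3]; linarith
  rw [integral_add hmi hGi] at hle
  have := le_abs_self (∫ x, min (h i x) |R| ∂μ)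
  linarith

lemma le_add_mul_abs_log_div {R v : ℝ} (hR : 1 < R) (hv : 0 ≤ v) :
    v ≤ R + v * |Real.log v| / Real.log R := by
  have hl : 0 < Real.log R := Real.log_pos hR
  rcases le_total v R with h | h
  · have : 0 ≤ v * |Real.log v| / Real.log R := by positivity
    linarith
  · have h1 : Real.log R ≤ Real.log v := Real.log_le_log (by linarith) h
    have h2 : v ≤ v * |Real.log v| / Real.log R := by
      rw [le_div_iff₀ hl]
      exact mul_le_mul_of_nonneg_left (h1.trans (le_abs_self _)) hv
    linarith

lemma norm_sub_sq_le_two (z w : ℂ) : ‖z - w‖ ^ 2 ≤ 2 * ‖z‖ ^ 2 + 2 * ‖w‖ ^ 2 := by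
  have h := norm_sub_le z w
  have h0 := norm_nonneg (z - w)
  nlinarith [sq_nonneg (‖z‖ - ‖w‖)]

/-- Bounded entropy upgrades pointwise convergence to convergence in `L²`. -/
lemma tendsto_integral_norm_sub_sq_zero [IsFiniteMeasure μ] {ι : Type*} {l : Filter ι}
    [l.IsCountablyGenerated] {u : ι → X → ℂ} {w : X → ℂ} {M : ℝ}
    (hm : ∀ i, AEStronglyMeasurable (u i) μ) (hw : AEStronglyMeasurable w μ)
    (hl : ∀ x, Tendsto (fun i => u i x) l (𝓝 (w x)))
    (hu : ∀ᶠ i in l, Integrable (fun x => ‖u i x‖ ^ 2 * |Real.log (‖u i x‖ ^ 2)|) μ ∧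
      ∫ x, ‖u i x‖ ^ 2 * |Real.log (‖u i x‖ ^ 2)| ∂μ ≤ M)
    (hwi : Integrable (fun x => ‖w x‖ ^ 2 * |Real.log (‖w x‖ ^ 2)|) μ)
    (hwM : ∫ x, ‖w x‖ ^ 2 * |Real.log (‖w x‖ ^ 2)| ∂μ ≤ M) :
    Tendsto (fun i => ∫ x, ‖u i x - w x‖ ^ 2 ∂μ) l (𝓝 0) := by
  have hM : 0 ≤ M := le_trans (integral_nonneg fun x => by positivity) hwM
  refine tendsto_integral_zero_of_le_const_add
    (Eventually.of_forall fun i => ((hm i).sub hw).norm.pow 2)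
    (Eventually.of_forall fun i x => by positivity) (fun x => ?_) fun ε hε => ?_
  · have := ((hl x).sub (tendsto_const_nhds (x := w x))).norm.pow 2
    simpa using this
  · obtain ⟨R, hR1, hR⟩ : ∃ R : ℝ, 1 < R ∧ 4 * M / Real.log R ≤ ε := by
      refine ⟨Real.exp (4 * M / ε + 1), ?_, ?_⟩
      · rw [Real.one_lt_exp_iff]; positivity
      · rw [Real.log_exp, div_le_iff₀ (by positivity)]
        have : ε * (4 * M / ε + 1) = 4 * M + ε := by field_simp
        linarith
    have hlR : 0 < Real.log R := Real.log_pos hR1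
    refine ⟨4 * R, fun i x => 2 / Real.log R * (‖u i x‖ ^ 2 * |Real.log (‖u i x‖ ^ 2)|) +
      2 / Real.log R * (‖w x‖ ^ 2 * |Real.log (‖w x‖ ^ 2)|), ?_⟩
    filter_upwards [hu] with i hi
    refine ⟨(hi.1.const_mul _).add (hwi.const_mul _), ?_, fun x => ⟨by positivity, ?_⟩⟩
    · rw [integral_add (hi.1.const_mul _) (hwi.const_mul _), integral_const_mul,
        integral_const_mul]
      calc _ ≤ 2 / Real.log R * M + 2 / Real.log R * M := by gcongr; exact hi.2
        _ = 4 * M / Real.log R := by ring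
        _ ≤ ε := hR
    · have h1 := norm_sub_sq_le_two (u i x) (w x)
      have h2 := le_add_mul_abs_log_div hR1 (sq_nonneg ‖u i x‖)
      have h3 := le_add_mul_abs_log_div hR1 (sq_nonneg ‖w x‖)
      have e : ∀ y : ℝ, 2 / Real.log R * y = 2 * (y / Real.log R) := fun y => by ring
      rw [e, e]
      linarith

/-- Differentiation under the integral sign when difference quotients are controlled in `L²`. -/
lemma hasDerivAt_integral_of_sq_control [IsFiniteMeasure μ] {Φ : ℝ → X → ℂ} {Φ' : X → ℂ}
    {d : ℝ → X → ℝ} {t C₀ C₁ C₂ : ℝ} (hC₀ : 0 ≤ C₀)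
    (hintg : ∀ s, Integrable (Φ s) μ) (hder : ∀ x, HasDerivAt (fun s => Φ s x) (Φ' x) t)
    (hm' : AEStronglyMeasurable Φ' μ) (hΦ' : ∀ x, ‖Φ' x‖ ≤ C₂)
    (hΦ : ∀ s x, ‖Φ s x - Φ t x‖ ≤ C₀ * (d s x + d s x ^ 2))
    (hdi : ∀ s, Integrable (fun x => d s x ^ 2) μ)
    (hd : ∀ᶠ s in 𝓝 t, ∫ x, d s x ^ 2 ∂μ ≤ C₁ * (s - t) ^ 2) :
    HasDerivAt (fun s => ∫ x, Φ s x ∂μ) (∫ x, Φ' x ∂μ) t := by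
  have hi' : Integrable Φ' μ :=
    Integrable.mono' (integrable_const C₂) hm' (Eventually.of_forall hΦ')
  have hsl : ∀ s x, slope (fun s => Φ s x) t s = ((s - t)⁻¹ : ℝ) • (Φ s x - Φ t x) := by
    intro s x; rfl
  have hsi : ∀ s, Integrable (fun x => slope (fun s => Φ s x) t s) μ := fun s => by
    simp only [hsl]
    exact ((hintg s).sub (hintg t)).smul ((s - t)⁻¹ : ℝ)
  have key : Tendsto (fun s => ∫ x, ‖slope (fun s => Φ s x) t s - Φ' x‖ ∂μ) (𝓝[≠] t) (𝓝 0) := by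
    refine tendsto_integral_zero_of_le_const_add
      (Eventually.of_forall fun s => ((hsi s).sub hi').aestronglyMeasurable.norm)
      (Eventually.of_forall fun s x => norm_nonneg _) (fun x => ?_) fun ε hε => ?_
    · have := (hasDerivAt_iff_tendsto_slope.1 (hder x)).sub (tendsto_const_nhds (x := Φ' x))
      simpa using this.norm
    · set C := |C₁| with hC
      have hCnn : 0 ≤ C := abs_nonneg _
      obtain ⟨R, hR0, hR⟩ : ∃ R : ℝ, 0 < R ∧ C₀ ^ 2 * C / R ≤ ε / 2 := by
        refine ⟨2 * C₀ ^ 2 * C / ε + 1, by positivity, ?_⟩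
        rw [div_le_iff₀ (by positivity)]
        have : ε / 2 * (2 * C₀ ^ 2 * C / ε + 1) = C₀ ^ 2 * C + ε / 2 := by field_simp
        linarith
      refine ⟨C₂ + R, fun s x => (C₀ ^ 2 / R / (s - t) ^ 2 + C₀ / |s - t|) * d s x ^ 2, ?_⟩
      have hsmall : ∀ᶠ s in 𝓝[≠] t, C₀ * C * |s - t| ≤ ε / 2 := by
        have : Tendsto (fun s => C₀ * C * |s - t|) (𝓝 t) (𝓝 0) := by
          have : Continuous fun s => C₀ * C * |s - t| := by fun_prop
          simpa using this.tendsto t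
        exact ((this.mono_left nhdsWithin_le_nhds).eventually
          (gt_mem_nhds (by positivity : (0:ℝ) < ε / 2))).mono fun s hs => le_of_lt hs
      filter_upwards [hsmall, hd.filter_mono nhdsWithin_le_nhds, self_mem_nhdsWithin]
        with s hs hds hne
      have hne' : 0 < |s - t| := abs_pos.2 (sub_ne_zero.2 hne)
      have hsq : (s - t) ^ 2 = |s - t| ^ 2 := (sq_abs _).symm
      have hc : 0 ≤ C₀ ^ 2 / R / (s - t) ^ 2 + C₀ / |s - t| := by positivity
      refine ⟨(hdi s).const_mul _, ?_, fun x => ⟨mul_nonneg hc (sq_nonneg _), ?_⟩⟩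
      · rw [integral_const_mul]
        have h1 : ∫ x, d s x ^ 2 ∂μ ≤ C * |s - t| ^ 2 := by
          refine hds.trans ?_
          rw [hsq]; gcongr; exact le_abs_self _
        calc _ ≤ (C₀ ^ 2 / R / (s - t) ^ 2 + C₀ / |s - t|) * (C * |s - t| ^ 2) := by gcongr
          _ = C₀ ^ 2 * C / R + C₀ * C * |s - t| := by rw [hsq]; field_simp
          _ ≤ ε := by linarith
      · have h1 : ‖slope (fun s => Φ s x) t s‖ ≤ C₀ * (d s x + d s x ^ 2) / |s - t| := by
          rw [hsl, norm_smul, Real.norm_eq_abs, abs_inv, ← div_eq_inv_mul]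
          gcongr; exact hΦ s x
        have h2 : C₀ * d s x / |s - t| ≤ R + C₀ ^ 2 / R / (s - t) ^ 2 * d s x ^ 2 := by
          set y := C₀ * d s x / |s - t| with hy
          have e : C₀ ^ 2 / R / (s - t) ^ 2 * d s x ^ 2 = y ^ 2 / R := by
            rw [hy, hsq]; field_simp
          rw [e]
          have : y * R ≤ (R + y ^ 2 / R) * R := by
            rw [add_mul, div_mul_cancel₀ _ hR0.ne']
            nlinarith [sq_nonneg (y - R), sq_nonneg y, sq_nonneg R]
          exact le_of_mul_le_mul_right this hR0
        have h3 : C₀ * (d s x + d s x ^ 2) / |s - t|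
            = C₀ * d s x / |s - t| + C₀ / |s - t| * d s x ^ 2 := by ring
        have h4 := norm_sub_le (slope (fun s => Φ s x) t s) (Φ' x)
        have h5 := hΦ' x
        rw [add_mul]
        linarith
  rw [hasDerivAt_iff_tendsto_slope, tendsto_iff_norm_sub_tendsto_zero]
  refine squeeze_zero (fun _ => norm_nonneg _) (fun s => ?_) key
  have e : slope (fun s => ∫ x, Φ s x ∂μ) t s - ∫ x, Φ' x ∂μ
      = ∫ x, (slope (fun s => Φ s x) t s - Φ' x) ∂μ := by
    rw [integral_sub (hsi s) hi']
    congr 1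
    simp only [slope, vsub_eq_sub]
    rw [integral_smul, integral_sub (hintg s) (hintg t)]
  rw [e]
  exact norm_integral_le_integral_norm _

lemma integral_mul_le_sqrt_mul_sqrt {f g : X → ℝ} (hf : ∀ x, 0 ≤ f x) (hg : ∀ x, 0 ≤ g x)
    (hfm : AEStronglyMeasurable f μ) (hgm : AEStronglyMeasurable g μ)
    (hfi : Integrable (fun x => f x ^ 2) μ) (hgi : Integrable (fun x => g x ^ 2) μ) :
    ∫ x, f x * g x ∂μ ≤ √(∫ x, f x ^ 2 ∂μ) * √(∫ x, g x ^ 2 ∂μ) := by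
  have h := integral_mul_le_Lp_mul_Lq_of_nonneg (μ := μ) Real.HolderConjugate.two_two
    (Eventually.of_forall hf) (Eventually.of_forall hg)
    (by rw [show ENNReal.ofReal 2 = 2 by simp]; exact (memLp_two_iff_integrable_sq hfm).2 hfi)
    (by rw [show ENNReal.ofReal 2 = 2 by simp]; exact (memLp_two_iff_integrable_sq hgm).2 hgi)
  simpa [Real.sqrt_eq_rpow] using h

lemma integrable_mul_of_sq {f g : X → ℂ} (hfm : AEStronglyMeasurable f μ)
    (hgm : AEStronglyMeasurable g μ) (hfi : Integrable (fun x => ‖f x‖ ^ 2) μ)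
    (hgi : Integrable (fun x => ‖g x‖ ^ 2) μ) : Integrable (fun x => f x * g x) μ := by
  refine Integrable.mono' (hfi.add hgi) (hfm.mul hgm) (Eventually.of_forall fun x => ?_)
  rw [norm_mul, Pi.add_apply]
  nlinarith [sq_nonneg (‖f x‖ - ‖g x‖), sq_nonneg ‖f x‖, sq_nonneg ‖g x‖]

lemma integrable_norm_sub_sq {f g : X → ℂ} (hfm : AEStronglyMeasurable f μ)
    (hgm : AEStronglyMeasurable g μ) (hfi : Integrable (fun x => ‖f x‖ ^ 2) μ)
    (hgi : Integrable (fun x => ‖g x‖ ^ 2) μ) : Integrable (fun x => ‖f x - g x‖ ^ 2) μ := by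
  refine Integrable.mono' ((hfi.const_mul 2).add (hgi.const_mul 2)) ((hfm.sub hgm).norm.pow 2)
    (Eventually.of_forall fun x => ?_)
  rw [Real.norm_eq_abs, abs_of_nonneg (by positivity)]
  exact norm_sub_sq_le_two _ _

/-- Leibniz rule for the integral of a product of two `L²`-Lipschitz families. -/
lemma hasDerivAt_integral_mul_of_sq_control [IsFiniteMeasure μ] {A B : ℝ → X → ℂ}
    {A' B' : X → ℂ} {t C C₁ : ℝ}
    (hAm : ∀ s, AEStronglyMeasurable (A s) μ) (hBm : ∀ s, AEStronglyMeasurable (B s) μ)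
    (hAi : ∀ s, Integrable (fun x => ‖A s x‖ ^ 2) μ)
    (hBi : ∀ s, Integrable (fun x => ‖B s x‖ ^ 2) μ)
    (hA : ∀ x, HasDerivAt (fun s => A s x) (A' x) t)
    (hB : ∀ x, HasDerivAt (fun s => B s x) (B' x) t)
    (hA'm : AEStronglyMeasurable A' μ) (hB'm : AEStronglyMeasurable B' μ)
    (hAb : ∀ x, ‖A t x‖ ≤ C) (hBb : ∀ x, ‖B t x‖ ≤ C) (hA'b : ∀ x, ‖A' x‖ ≤ C)
    (hB'b : ∀ x, ‖B' x‖ ≤ C)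
    (hAl : ∀ᶠ s in 𝓝 t, ∫ x, ‖A s x - A t x‖ ^ 2 ∂μ ≤ C₁ * (s - t) ^ 2)
    (hBl : ∀ᶠ s in 𝓝 t, ∫ x, ‖B s x - B t x‖ ^ 2 ∂μ ≤ C₁ * (s - t) ^ 2) :
    HasDerivAt (fun s => ∫ x, A s x * B s x ∂μ) (∫ x, (A' x * B t x + A t x * B' x) ∂μ) t := by
  by_cases hX : IsEmpty X
  · have : ∀ f : X → ℂ, ∫ x, f x ∂μ = 0 := fun f => by
      rw [Measure.eq_zero_of_isEmpty μ, integral_zero_measure]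
    simp only [this]
    exact hasDerivAt_const t 0
  rw [not_isEmpty_iff] at hX
  obtain ⟨x₀⟩ := hX
  have hC : 0 ≤ C := (norm_nonneg _).trans (hAb x₀)
  have hAd := fun s => integrable_norm_sub_sq (hAm s) (hAm t) (hAi s) (hAi t)
  have hBd := fun s => integrable_norm_sub_sq (hBm s) (hBm t) (hBi s) (hBi t)
  have hsq : ∀ s x, (‖A s x - A t x‖ + ‖B s x - B t x‖) ^ 2
      ≤ 2 * ‖A s x - A t x‖ ^ 2 + 2 * ‖B s x - B t x‖ ^ 2 := fun s x => by
    nlinarith [sq_nonneg (‖A s x - A t x‖ - ‖B s x - B t x‖)]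
  have hdi : ∀ s, Integrable (fun x => (‖A s x - A t x‖ + ‖B s x - B t x‖) ^ 2) μ := fun s => by
    refine Integrable.mono' (((hAd s).const_mul 2).add ((hBd s).const_mul 2))
      ((((hAm s).sub (hAm t)).norm.add ((hBm s).sub (hBm t)).norm).pow 2)
      (Eventually.of_forall fun x => ?_)
    rw [Real.norm_eq_abs, abs_of_nonneg (by positivity)]
    exact hsq s x
  refine hasDerivAt_integral_of_sq_control (C₀ := C + 1) (C₁ := 4 * C₁) (C₂ := 2 * C ^ 2)
    (d := fun s x => ‖A s x - A t x‖ + ‖B s x - B t x‖) (by positivity)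
    (fun s => integrable_mul_of_sq (hAm s) (hBm s) (hAi s) (hBi s))
    (fun x => (hA x).mul (hB x)) ((hA'm.mul (hBm t)).add ((hAm t).mul hB'm)) (fun x => ?_)
    (fun s x => ?_) hdi ?_
  · calc ‖A' x * B t x + A t x * B' x‖ ≤ ‖A' x‖ * ‖B t x‖ + ‖A t x‖ * ‖B' x‖ := by
          rw [← norm_mul, ← norm_mul]; exact norm_add_le _ _
      _ ≤ C * C + C * C := by
          gcongr
          exacts [hA'b x, hBb x, hAb x, hB'b x]
      _ = 2 * C ^ 2 := by ring
  · have e : A s x * B s x - A t x * B t x = (A s x - A t x) * (B s x - B t x)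
        + (A s x - A t x) * B t x + A t x * (B s x - B t x) := by ring
    have h1 : ‖A s x * B s x - A t x * B t x‖ ≤ ‖A s x - A t x‖ * ‖B s x - B t x‖
        + ‖A s x - A t x‖ * ‖B t x‖ + ‖A t x‖ * ‖B s x - B t x‖ := by
      rw [e, ← norm_mul, ← norm_mul, ← norm_mul]; exact norm_add₃_le
    have h2 := mul_le_mul_of_nonneg_left (hBb x) (norm_nonneg (A s x - A t x))
    have h3 := mul_le_mul_of_nonneg_right (hAb x) (norm_nonneg (B s x - B t x))
    have ha := norm_nonneg (A s x - A t x)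
    have hb := norm_nonneg (B s x - B t x)
    have hab : ‖A s x - A t x‖ * ‖B s x - B t x‖
        ≤ (‖A s x - A t x‖ + ‖B s x - B t x‖) ^ 2 := by nlinarith
    nlinarith [mul_nonneg hC (sq_nonneg (‖A s x - A t x‖ + ‖B s x - B t x‖))]
  · filter_upwards [hAl, hBl] with s h1 h2
    calc _ ≤ ∫ x, (2 * ‖A s x - A t x‖ ^ 2 + 2 * ‖B s x - B t x‖ ^ 2) ∂μ :=
          integral_mono (hdi s) (((hAd s).const_mul 2).add ((hBd s).const_mul 2)) (hsq s)
      _ = 2 * ∫ x, ‖A s x - A t x‖ ^ 2 ∂μ + 2 * ∫ x, ‖B s x - B t x‖ ^ 2 ∂μ := by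
          rw [integral_add ((hAd s).const_mul 2) ((hBd s).const_mul 2), integral_const_mul,
            integral_const_mul]
      _ ≤ 4 * C₁ * (s - t) ^ 2 := by linarith

end MeasureLemmas

lemma le_sq_mul_sq_of_abs_deriv_le_of_lt {y y' : ℝ → ℝ} {s₀ s₁ B : ℝ} (hs : s₀ < s₁) (hB : 0 ≤ B)
    (hc : ContinuousOn y (Set.Icc s₀ s₁)) (h0 : y s₀ = 0)
    (hd : ∀ s ∈ Set.Ioo s₀ s₁, HasDerivAt y (y' s) s ∧ |y' s| ≤ B * √(y s)) :
    y s₁ ≤ B ^ 2 * (s₁ - s₀) ^ 2 := by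
  obtain ⟨c, hcI, hmax⟩ := isCompact_Icc.exists_isMaxOn (Set.nonempty_Icc.2 hs.le) hc
  have h1 : y s₁ ≤ y c := hmax (Set.right_mem_Icc.2 hs.le)
  have h0c : 0 ≤ y c := h0 ▸ hmax (Set.left_mem_Icc.2 hs.le)
  have hsc : √(y c) ≤ B * (s₁ - s₀) := by
    rcases hcI.1.eq_or_lt with h | h
    · rw [← h, h0, Real.sqrt_zero]; exact mul_nonneg hB (by linarith)
    obtain ⟨ξ, hξ, he⟩ := exists_hasDerivAt_eq_slope y y' h
      (hc.mono (Set.Icc_subset_Icc_right hcI.2))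
      (fun x hx => (hd x ⟨hx.1, hx.2.trans_le hcI.2⟩).1)
    have hξ' : ξ ∈ Set.Ioo s₀ s₁ := ⟨hξ.1, hξ.2.trans_le hcI.2⟩
    have hb := (hd ξ hξ').2
    have hle : √(y ξ) ≤ √(y c) := Real.sqrt_le_sqrt (hmax ⟨hξ'.1.le, hξ'.2.le⟩)
    rw [h0, sub_zero, eq_div_iff (by linarith)] at he
    have h2 : √(y c) * √(y c) ≤ (B * (s₁ - s₀)) * √(y c) := by
      rw [Real.mul_self_sqrt h0c]
      calc y c = y' ξ * (c - s₀) := he.symm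
        _ ≤ (B * √(y c)) * (s₁ - s₀) := by
            apply mul_le_mul _ (by linarith [hcI.2]) (by linarith) (by positivity)
            exact (le_abs_self _).trans (hb.trans (by gcongr))
        _ = _ := by ring
    rcases (Real.sqrt_nonneg (y c)).eq_or_lt with h3 | h3
    · rw [← h3]; exact mul_nonneg hB (by linarith)
    · exact le_of_mul_le_mul_right h2 h3
  calc y s₁ ≤ √(y c) ^ 2 := by rw [Real.sq_sqrt h0c]; exact h1
    _ ≤ (B * (s₁ - s₀)) ^ 2 := by gcongr
    _ = _ := by ring

/-- If `|y'| ≤ B √y` and `y` vanishes at `s₀`, then `y` grows at most quadratically. -/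
lemma le_sq_mul_sq_of_abs_deriv_le {y y' : ℝ → ℝ} {s₀ s₁ B : ℝ} (hB : 0 ≤ B)
    (hc : ContinuousOn y (Set.uIcc s₀ s₁)) (h0 : y s₀ = 0)
    (hd : ∀ s ∈ Set.uIoo s₀ s₁, HasDerivAt y (y' s) s ∧ |y' s| ≤ B * √(y s)) :
    y s₁ ≤ B ^ 2 * (s₁ - s₀) ^ 2 := by
  rcases lt_trichotomy s₀ s₁ with h | h | h
  · rw [Set.uIcc_of_le h.le] at hc
    rw [Set.uIoo_of_le h.le] at hd
    exact le_sq_mul_sq_of_abs_deriv_le_of_lt h hB hc h0 hd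
  · rw [← h, h0]; simp
  · rw [Set.uIcc_of_ge h.le] at hc
    rw [Set.uIoo_of_ge h.le] at hd
    have := le_sq_mul_sq_of_abs_deriv_le_of_lt (y := fun s => y (-s)) (y' := fun s => -y' (-s))
      (s₀ := -s₀) (s₁ := -s₁) (B := B) (by linarith) hB ?_ (by simpa using h0) ?_
    · simp only [neg_neg] at this
      convert this using 2; ring
    · refine hc.comp continuous_neg.continuousOn fun s hs => ?_
      constructor <;> linarith [hs.1, hs.2]
    · intro s hs
      obtain ⟨h1, h2⟩ := hd (-s) ⟨by linarith [hs.2], by linarith [hs.1]⟩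
      refine ⟨?_, by rwa [abs_neg]⟩
      have := HasDerivAt.comp s h1 (hasDerivAt_neg s)
      rw [mul_neg_one] at this
      exact this

lemma norm_sub_le_of_hasDerivAt_Ioo {f f' : ℝ → ℂ} {a b C : ℝ} (hab : a ≤ b)
    (hc : ContinuousOn f (Set.Icc a b))
    (hd : ∀ s ∈ Set.Ioo a b, HasDerivAt f (f' s) s ∧ ‖f' s‖ ≤ C) :
    ‖f b - f a‖ ≤ C * (b - a) := by
  rcases hab.eq_or_lt with rfl | hab
  · simp
  set z := (starRingEnd ℂ) (f b - f a) with hz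
  obtain ⟨ξ, hξ, he⟩ := exists_hasDerivAt_eq_slope (fun s => (z * f s).re)
    (fun s => (z * f' s).re) hab
    (Complex.continuous_re.comp_continuousOn (continuousOn_const.mul hc))
    (fun x hx => by
      have h1 := ((hd x hx).1.const_mul z)
      exact (Complex.reCLM.hasFDerivAt.comp_hasDerivAt x h1))
  rw [eq_div_iff (by linarith)] at he
  have e1 : (z * f b).re - (z * f a).re = ‖f b - f a‖ ^ 2 := by
    rw [← Complex.sub_re, ← mul_sub, hz, mul_comm, Complex.mul_conj, Complex.ofReal_re,
      Complex.normSq_eq_norm_sq]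
  have hzn : ‖z‖ = ‖f b - f a‖ := by rw [hz, RCLike.norm_conj]
  have h2 : ‖f b - f a‖ * ‖f b - f a‖ ≤ (C * (b - a)) * ‖f b - f a‖ := by
    calc _ = (z * f' ξ).re * (b - a) := by rw [he, e1]; ring
      _ ≤ (‖f b - f a‖ * C) * (b - a) := by
          apply mul_le_mul_of_nonneg_right _ (by linarith)
          refine (Complex.re_le_norm _).trans ?_
          rw [norm_mul, hzn]
          gcongr; exact (hd ξ hξ).2
      _ = _ := by ring
  rcases (norm_nonneg (f b - f a)).eq_or_lt with h3 | h3
  · rw [← h3]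
    exact mul_nonneg ((norm_nonneg _).trans (hd ξ hξ).2) (by linarith)
  · exact le_of_mul_le_mul_right h2 h3

lemma add_lintegral_Ioc_le {ρ : ℝ → ENNReal} {s c v : ℝ} (hsc : s ≤ c) (hcv : c ≤ v)
    {r x : ENNReal} (hr : ∀ τ ∈ Set.Ioo c v, r ≤ ρ τ) (hx : x ≤ r * ENNReal.ofReal (v - c)) :
    (∫⁻ τ in Set.Ioc s c, ρ τ) + x ≤ ∫⁻ τ in Set.Ioc s v, ρ τ := by
  have hd : Disjoint (Set.Ioc s c) (Set.Ioo c v) :=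
    Set.disjoint_left.2 fun τ h1 h2 => absurd h1.2 (not_le.2 h2.1)
  calc (∫⁻ τ in Set.Ioc s c, ρ τ) + x
      ≤ (∫⁻ τ in Set.Ioc s c, ρ τ) + ∫⁻ τ in Set.Ioo c v, ρ τ := by
        gcongr
        refine hx.trans ?_
        rw [← Real.volume_Ioo, ← setLIntegral_const]
        exact setLIntegral_mono' measurableSet_Ioo hr
    _ = ∫⁻ τ in Set.Ioc s c ∪ Set.Ioo c v, ρ τ := (lintegral_union measurableSet_Ioo hd).symm
    _ ≤ _ := by
        refine lintegral_mono_set ?_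
        rintro τ (h | h)
        · exact ⟨h.1, h.2.trans hcv⟩
        · exact ⟨hsc.trans_lt h.1, h.2.le⟩

/-- Mean value inequality for a function whose derivative is controlled only on a compact set `K`
and whose increments are controlled across the gaps of `K`. -/
lemma ofReal_norm_sub_le_lintegral {g g' : ℝ → ℂ} {K : Set ℝ} (hK : IsCompact K) {s t k : ℝ}
    (hsK : s ∈ K) (htK : t ∈ K) (hKst : K ⊆ Set.Icc s t)
    (hg : ∀ τ ∈ K, HasDerivAt g (g' τ) τ) (hk : ∀ τ ∈ K, ‖g' τ‖ ≤ k) {ρ : ℝ → ENNReal}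
    (hρk : ∀ τ, ENNReal.ofReal k ≤ ρ τ)
    (hρ : ∀ c ∈ K, ∀ b ∈ K, c < b → (∀ τ ∈ Set.Ioo c b, τ ∉ K) → ∀ τ ∈ Set.Ioo c b,
      ENNReal.ofReal (‖g b - g c‖ / (b - c)) ≤ ρ τ) :
    ENNReal.ofReal ‖g t - g s‖ ≤ ∫⁻ τ in Set.Ioc s t, ρ τ := by
  have hk0 : 0 ≤ k := (norm_nonneg _).trans (hk s hsK)
  have main : ∀ ε > 0, ENNReal.ofReal ‖g t - g s‖ ≤
      (∫⁻ τ in Set.Ioc s t, ρ τ) + ENNReal.ofReal (ε * (t - s)) := by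
    intro ε hε
    set S : Set ℝ := {u | u ∈ K ∧ ENNReal.ofReal ‖g u - g s‖ ≤
      (∫⁻ τ in Set.Ioc s u, ρ τ) + ENNReal.ofReal (ε * (u - s))} with hS
    have hsS : s ∈ S := ⟨hsK, by simp⟩
    have hSb : BddAbove S := ⟨t, fun u hu => (hKst hu.1).2⟩
    set c := sSup S with hcdef
    have hccl : c ∈ closure S := csSup_mem_closure ⟨s, hsS⟩ hSb
    have hcK : c ∈ K := hK.isClosed.closure_subset_iff.2 (fun u hu => hu.1) hccl
    have hcI := hKst hcK
    have hcS : c ∈ S := by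
      refine ⟨hcK, ?_⟩
      have ht : Tendsto (fun u => ENNReal.ofReal ‖g u - g s‖) (𝓝 c)
          (𝓝 (ENNReal.ofReal ‖g c - g s‖)) :=
        (ENNReal.continuous_ofReal.tendsto _).comp
          (((hg c hcK).continuousAt.sub continuousAt_const).norm)
      refine le_of_tendsto_of_frequently ht ((mem_closure_iff_frequently.1 hccl).mono
        fun u hu => hu.2.trans ?_)
      have huc : u ≤ c := le_csSup hSb hu
      gcongr
    have hstep : ∀ v ∈ K, c < v → ∀ r : ENNReal, (∀ τ ∈ Set.Ioo c v, r ≤ ρ τ) →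
        ENNReal.ofReal ‖g v - g c‖ ≤ r * ENNReal.ofReal (v - c) + ENNReal.ofReal (ε * (v - c)) →
        False := by
      intro v hv hcv r hr hle
      refine absurd (le_csSup hSb (show v ∈ S from ⟨hv, ?_⟩)) (not_le.2 hcv)
      calc ENNReal.ofReal ‖g v - g s‖
          ≤ ENNReal.ofReal (‖g c - g s‖ + ‖g v - g c‖) := by
            apply ENNReal.ofReal_le_ofReal
            rw [add_comm]; exact norm_sub_le_norm_sub_add_norm_sub _ _ _
        _ = ENNReal.ofReal ‖g c - g s‖ + ENNReal.ofReal ‖g v - g c‖ :=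
            ENNReal.ofReal_add (norm_nonneg _) (norm_nonneg _)
        _ ≤ ((∫⁻ τ in Set.Ioc s c, ρ τ) + ENNReal.ofReal (ε * (c - s))) +
            (r * ENNReal.ofReal (v - c) + ENNReal.ofReal (ε * (v - c))) := add_le_add hcS.2 hle
        _ = ((∫⁻ τ in Set.Ioc s c, ρ τ) + r * ENNReal.ofReal (v - c)) +
            (ENNReal.ofReal (ε * (c - s)) + ENNReal.ofReal (ε * (v - c))) := by ring
        _ ≤ _ := by
            refine add_le_add (add_lintegral_Ioc_le hcI.1 hcv.le hr le_rfl) ?_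
            rw [← ENNReal.ofReal_add (mul_nonneg hε.le (by linarith [hcI.1]))
              (mul_nonneg hε.le (by linarith))]
            apply ENNReal.ofReal_le_ofReal
            linarith
    rcases hcI.2.eq_or_lt with h | hct
    · rw [h] at hcS; exact hcS.2
    exfalso
    have hderiv : ∀ᶠ v in 𝓝 c, ‖g v - g c‖ ≤ (k + ε) * ‖v - c‖ := by
      have h1 := (hasDerivAt_iff_isLittleO.1 (hg c hcK)).def hε
      filter_upwards [h1] with v hv
      have e : g v - g c = (g v - g c - (v - c) • g' c) + (v - c) • g' c := by ring
      rw [e]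
      refine (norm_add_le _ _).trans ?_
      rw [norm_smul]
      have := mul_le_mul_of_nonneg_left (hk c hcK) (norm_nonneg (v - c))
      linarith
    obtain ⟨δ, hδ, hball⟩ := Metric.eventually_nhds_iff.1 hderiv
    by_cases hex : ∃ v ∈ K, v ∈ Set.Ioo c (c + δ)
    · obtain ⟨v, hvK, hv⟩ := hex
      refine hstep v hvK hv.1 (ENNReal.ofReal k) (fun τ _ => hρk τ) ?_
      have hvc : 0 ≤ v - c := by linarith [hv.1]
      have := hball (y := v) (by rw [Real.dist_eq, abs_of_nonneg hvc]; linarith [hv.2])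
      rw [Real.norm_eq_abs, abs_of_nonneg hvc] at this
      rw [← ENNReal.ofReal_mul hk0, ← ENNReal.ofReal_add (by positivity) (by positivity)]
      apply ENNReal.ofReal_le_ofReal
      linarith
    · push Not at hex
      have hcomp : IsCompact (K ∩ Set.Ici (c + δ)) := hK.inter_right isClosed_Ici
      have hne : (K ∩ Set.Ici (c + δ)).Nonempty := by
        refine ⟨t, htK, ?_⟩
        by_contra h
        exact hex t htK ⟨hct, not_le.1 h⟩
      have hbm := hcomp.sInf_mem hne
      set b := sInf (K ∩ Set.Ici (c + δ)) with hb
      have hcb : c < b := by have := hbm.2; simp only [Set.mem_Ici] at this; linarith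
      have hgap : ∀ τ ∈ Set.Ioo c b, τ ∉ K := by
        intro τ hτ hτK
        rcases lt_or_ge τ (c + δ) with h | h
        · exact hex τ hτK ⟨hτ.1, h⟩
        · exact absurd (csInf_le hcomp.bddBelow ⟨hτK, h⟩) (not_le.2 hτ.2)
      refine hstep b hbm.1 hcb _ (hρ c hcK b hbm.1 hcb hgap) ?_
      refine le_add_right ?_
      rw [← ENNReal.ofReal_mul (div_nonneg (norm_nonneg _) (by linarith)),
        div_mul_cancel₀ _ (by linarith)]
  refine ENNReal.le_of_forall_pos_le_add fun ε hε _ => ?_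
  have hst : s ≤ t := (hKst hsK).2
  refine (main (ε / (t - s + 1)) (by positivity)).trans ?_
  gcongr
  rw [← ENNReal.ofReal_coe_nnreal]
  apply ENNReal.ofReal_le_ofReal
  rw [div_mul_eq_mul_div, div_le_iff₀ (by linarith)]
  nlinarith [NNReal.coe_pos.2 hε]

/-- Baire category: a countable cover of a locally closed set of reals by relatively closed sets
has a member containing a relative neighbourhood of some point. -/
lemma IsLocallyClosed.exists_portion_subset {S : Set ℝ} (hS : IsLocallyClosed S)
    (hne : S.Nonempty) {A : ℕ → Set ℝ}
    (hA : ∀ k, ∀ t ∈ S, (∃ᶠ s in 𝓝 t, s ∈ S ∧ s ∈ A k) → t ∈ A k) (hcov : ∀ t ∈ S, ∃ k, t ∈ A k) :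
    ∃ k, ∃ p ∈ S, ∃ δ > 0, ∀ t ∈ S, |t - p| < δ → t ∈ A k := by
  have : LocallyCompactSpace S := hS.locallyCompactSpace
  have : Nonempty S := hne.to_subtype
  have hcl : ∀ k, IsClosed ((↑) ⁻¹' (A k) : Set S) := by
    intro k
    rw [← closure_subset_iff_isClosed]
    intro t ht
    rw [mem_closure_iff_frequently] at ht
    refine hA k t t.2 ?_
    exact (continuous_subtype_val.tendsto t).frequently (p := fun s => s ∈ S ∧ s ∈ A k)
      (ht.mono fun x hx => ⟨x.2, hx⟩)
  obtain ⟨k, p, hp⟩ := nonempty_interior_of_iUnion_of_closed hcl (by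
    rw [Set.eq_univ_iff_forall]
    intro t
    obtain ⟨k, hk⟩ := hcov t t.2
    exact Set.mem_iUnion.2 ⟨k, hk⟩)
  rw [mem_interior_iff_mem_nhds, Metric.mem_nhds_iff] at hp
  obtain ⟨δ, hδ, hb⟩ := hp
  refine ⟨k, p, p.2, δ, hδ, fun t ht htp => ?_⟩
  exact hb (show (⟨t, ht⟩ : S) ∈ Metric.ball p δ from by
    rw [Metric.mem_ball, Subtype.dist_eq, Real.dist_eq]; exact htp)

/-- A reflexive transitive relation that holds locally on a compact interval holds globally. -/
lemma rel_of_locally {r : ℝ → ℝ → Prop} {a b : ℝ} (hab : a ≤ b) (hrefl : ∀ t, r t t)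
    (htrans : ∀ s t u, r s t → r t u → r s u)
    (hloc : ∀ t ∈ Set.Icc a b, ∃ δ > 0, ∀ s u, |s - t| < δ → |u - t| < δ →
      s ∈ Set.Icc a b → u ∈ Set.Icc a b → s ≤ u → r s u) : r a b := by
  choose! δ hδ hr using hloc
  obtain ⟨τ, h0, hmono, ⟨m, hm⟩, hsub⟩ := exists_monotone_Icc_subset_open_cover_Icc hab
    (c := fun i : Set.Icc a b => {x : Set.Icc a b | |(x : ℝ) - i| < δ i})
    (fun i => isOpen_lt (by fun_prop) continuous_const)
    (fun x _ => Set.mem_iUnion.2 ⟨x, by simpa using hδ x x.2⟩)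
  have key : ∀ k, r a (τ k) := by
    intro k
    induction k with
    | zero => rw [h0]; exact hrefl a
    | succ k ih =>
      obtain ⟨i, hi⟩ := hsub k
      have hle := hmono (Nat.le_succ k)
      have h1 : |((τ k : Set.Icc a b) : ℝ) - i| < δ i := hi (Set.left_mem_Icc.2 hle)
      have h2 : |((τ (k + 1) : Set.Icc a b) : ℝ) - i| < δ i := hi (Set.right_mem_Icc.2 hle)
      exact htrans _ _ _ ih (hr i i.2 _ _ h1 h2 (τ k).2 (τ (k + 1)).2 hle)
  have := key m
  rwa [hm m le_rfl] at this

section Operators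

variable {n : ℕ} {U : EuclideanSpace ℝ (Fin n) → ℝ} {u v : EuclideanSpace ℝ (Fin n) → ℂ}

lemma ContDiff.pdC_smooth (hu : ContDiff ℝ ∞ u) (j : Fin n) : ContDiff ℝ ∞ (pdC n u j) :=
  (hu.fderiv_right (m := ∞) (by simp)).clm_apply contDiff_const

lemma ContDiff.continuous_pdC (hu : ContDiff ℝ 1 u) (j : Fin n) : Continuous (pdC n u j) :=
  (hu.continuous_fderiv (by simp)).clm_apply continuous_const

lemma ContDiff.continuous_pdR {r : EuclideanSpace ℝ (Fin n) → ℝ} (hr : ContDiff ℝ 1 r)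
    (j : Fin n) : Continuous (pdR n r j) :=
  (hr.continuous_fderiv (by simp)).clm_apply continuous_const

lemma ContDiff.of_smooth {F : Type*} [NormedAddCommGroup F] [NormedSpace ℝ F]
    {w : EuclideanSpace ℝ (Fin n) → F} (hw : ContDiff ℝ ∞ w) : ContDiff ℝ 1 w :=
  hw.of_le (by exact_mod_cast le_top)

lemma continuous_LopC (hU : ContDiff ℝ ∞ U) (hu : ContDiff ℝ ∞ u) :
    Continuous (LopC n U u) := by
  refine Continuous.sub (continuous_finsetSum _ fun j _ => ?_)
    (continuous_finsetSum _ fun j _ => ?_)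
  · exact (hu.pdC_smooth j).of_smooth.continuous_pdC j
  · exact (Complex.continuous_ofReal.comp (hU.of_smooth.continuous_pdR j)).mul
      (hu.of_smooth.continuous_pdC j)

lemma pdC_mul (hu : ContDiff ℝ 1 u) (hv : ContDiff ℝ 1 v) (j : Fin n)
    (x : EuclideanSpace ℝ (Fin n)) :
    pdC n (fun y => u y * v y) j x = pdC n u j x * v x + u x * pdC n v j x := by
  have h1 := (hu.differentiable (by simp) x).hasFDerivAt
  have h2 := (hv.differentiable (by simp) x).hasFDerivAt
  have := (h1.mul h2).fderiv
  simp only [pdC]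
  erw [this]
  simp [mul_comm, add_comm]

lemma pdC_sub (hu : ContDiff ℝ 1 u) (hv : ContDiff ℝ 1 v) (j : Fin n)
    (x : EuclideanSpace ℝ (Fin n)) :
    pdC n (fun y => u y - v y) j x = pdC n u j x - pdC n v j x := by
  have h1 := (hu.differentiable (by simp) x).hasFDerivAt
  have h2 := (hv.differentiable (by simp) x).hasFDerivAt
  have := (h1.sub h2).fderiv
  simp only [pdC]
  erw [this]
  simp

lemma pdC_conj (hu : ContDiff ℝ 1 u) (j : Fin n) (x : EuclideanSpace ℝ (Fin n)) :
    pdC n (fun y => (starRingEnd ℂ) (u y)) j x = (starRingEnd ℂ) (pdC n u j x) := by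
  have h1 := (hu.differentiable (by simp) x).hasFDerivAt
  have h2 := ((Complex.conjCLE : ℂ →L[ℝ] ℂ).hasFDerivAt (x := u x)).comp x h1
  simp only [pdC]
  erw [h2.fderiv]
  simp

lemma pdC_ofReal {r : EuclideanSpace ℝ (Fin n) → ℝ} (hr : ContDiff ℝ 1 r) (j : Fin n)
    (x : EuclideanSpace ℝ (Fin n)) :
    pdC n (fun y => (r y : ℂ)) j x = (pdR n r j x : ℂ) := by
  have h1 := (hr.differentiable (by simp) x).hasFDerivAt
  have h2 := (Complex.ofRealCLM.hasFDerivAt (x := r x)).comp x h1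
  simp only [pdC, pdR]
  erw [h2.fderiv]
  simp

lemma LopC_sub (hu : ContDiff ℝ ∞ u) (hv : ContDiff ℝ ∞ v) (x : EuclideanSpace ℝ (Fin n)) :
    LopC n U (fun y => u y - v y) x = LopC n U u x - LopC n U v x := by
  have h1 : ∀ j, pdC n (fun y => u y - v y) j = fun y => pdC n u j y - pdC n v j y :=
    fun j => funext fun y => pdC_sub hu.of_smooth hv.of_smooth j y
  have h2 : ∀ j, pdC n (fun y => pdC n u j y - pdC n v j y) j x
      = pdC n (fun y => pdC n u j y) j x - pdC n (fun y => pdC n v j y) j x :=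
    fun j => pdC_sub (hu.pdC_smooth j).of_smooth (hv.pdC_smooth j).of_smooth j x
  simp only [LopC, h1, h2, mul_sub, Finset.sum_sub_distrib]
  ring

lemma LopC_conj (hu : ContDiff ℝ ∞ u) (x : EuclideanSpace ℝ (Fin n)) :
    LopC n U (fun y => (starRingEnd ℂ) (u y)) x = (starRingEnd ℂ) (LopC n U u x) := by
  have h1 : ∀ j, pdC n (fun y => (starRingEnd ℂ) (u y)) j =
      fun y => (starRingEnd ℂ) (pdC n u j y) := fun j => funext fun y => pdC_conj hu.of_smooth j y
  have h2 : ∀ j, pdC n (fun y => (starRingEnd ℂ) (pdC n u j y)) j x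
      = (starRingEnd ℂ) (pdC n (fun y => pdC n u j y) j x) :=
    fun j => pdC_conj (hu.pdC_smooth j).of_smooth j x
  simp only [LopC, h1, h2, map_sub, map_sum, map_mul, Complex.conj_ofReal]

lemma HasCompactSupport.pdC (hu : HasCompactSupport u) (j : Fin n) :
    HasCompactSupport (pdC n u j) :=
  hu.fderiv_apply ℝ _

lemma ContDiff.conj {m : WithTop ℕ∞} (hu : ContDiff ℝ m u) :
    ContDiff ℝ m fun x => (starRingEnd ℂ) (u x) :=
  (Complex.conjCLE : ℂ →L[ℝ] ℂ).contDiff.comp hu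

lemma ContDiff.ofReal_comp {m : WithTop ℕ∞} {r : EuclideanSpace ℝ (Fin n) → ℝ}
    (hr : ContDiff ℝ m r) : ContDiff ℝ m fun x => (r x : ℂ) :=
  Complex.ofRealCLM.contDiff.comp hr

end Operators

/-- A probability measure on `ℝⁿ` with full support for which integration by parts holds with
respect to the weight `e^{-U}`. -/
structure IsGibbsMeasure (n : ℕ) (U : EuclideanSpace ℝ (Fin n) → ℝ)
    (μ : Measure (EuclideanSpace ℝ (Fin n))) : Prop where
  smooth : ContDiff ℝ ∞ U
  isProbabilityMeasure : IsProbabilityMeasure μ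
  isOpenPosMeasure : μ.IsOpenPosMeasure
  integral_mul_pdC : ∀ (j : Fin n) (p q : EuclideanSpace ℝ (Fin n) → ℂ), ContDiff ℝ 1 p →
    ContDiff ℝ 1 q → HasCompactSupport p →
    ∫ x, p x * pdC n q j x ∂μ = -∫ x, (pdC n p j x - (pdR n U j x : ℂ) * p x) * q x ∂μ

lemma isGibbsMeasure_of_eq {n : ℕ} {U : EuclideanSpace ℝ (Fin n) → ℝ}
    (hU : ContDiff ℝ ∞ U)
    {μ : Measure (EuclideanSpace ℝ (Fin n))} [IsProbabilityMeasure μ]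
    (hμ : μ = (ENNReal.ofReal (∫ x, Real.exp (-U x)))⁻¹ •
      MeasureTheory.volume.withDensity (fun x => ENNReal.ofReal (Real.exp (-U x)))) :
    IsGibbsMeasure n U μ where
  smooth := hU
  isProbabilityMeasure := inferInstance
  isOpenPosMeasure := by
    constructor
    intro O hO hne h0
    have hm : Measurable fun x => ENNReal.ofReal (Real.exp (-U x)) := by
      have := hU.continuous
      fun_prop
    rw [hμ, Measure.smul_apply, smul_eq_mul, mul_eq_zero] at h0
    rcases h0 with h0 | h0
    · rw [ENNReal.inv_eq_zero] at h0
      exact ENNReal.ofReal_ne_top h0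
    · rw [withDensity_apply_eq_zero hm] at h0
      have : {x | ENNReal.ofReal (Real.exp (-U x)) ≠ 0} ∩ O = O := by
        ext x
        simp [Real.exp_pos]
      rw [this] at h0
      exact (hO.measure_pos volume hne).ne' h0
  integral_mul_pdC := by
    intro j p q hp hq hpc
    have hm : Measurable fun x => ENNReal.ofReal (Real.exp (-U x)) := by
      have := hU.continuous
      fun_prop
    have key : ∀ F : EuclideanSpace ℝ (Fin n) → ℂ, ∫ x, F x ∂μ =
        ((ENNReal.ofReal (∫ x, Real.exp (-U x)))⁻¹).toReal •
          ∫ x, (Real.exp (-U x) : ℂ) * F x := by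
      intro F
      rw [hμ, integral_smul_measure, integral_withDensity_eq_integral_toReal_smul hm
        (Eventually.of_forall fun x => ENNReal.ofReal_lt_top)]
      congr 1
      refine integral_congr_ae (Eventually.of_forall fun x => ?_)
      simp only [ENNReal.toReal_ofReal (Real.exp_pos _).le, Complex.real_smul]
    rw [key, key, ← smul_neg]
    congr 1
    have hwr : ContDiff ℝ 1 fun x => Real.exp (-U x) := hU.of_smooth.neg.exp
    have hw : ContDiff ℝ 1 fun x => (Real.exp (-U x) : ℂ) := hwr.ofReal_comp
    have hwp : ContDiff ℝ 1 fun x => (Real.exp (-U x) : ℂ) * p x := hw.mul hp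
    have hwpc : HasCompactSupport fun x => (Real.exp (-U x) : ℂ) * p x := hpc.mul_left
    have hder : ∀ x, pdC n (fun x => (Real.exp (-U x) : ℂ) * p x) j x =
        (Real.exp (-U x) : ℂ) * (pdC n p j x - (pdR n U j x : ℂ) * p x) := by
      intro x
      rw [pdC_mul hw hp, pdC_ofReal hwr]
      have h1 := (hU.of_smooth.differentiable (by simp) x).hasFDerivAt
      have h2 : pdR n (fun x => Real.exp (-U x)) j x = -(Real.exp (-U x) * pdR n U j x) := by
        simp only [pdR]
        rw [h1.fun_neg.exp.fderiv]
        simp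
      rw [h2]
      push_cast
      ring
    have hdc : Continuous (pdC n (fun x => (Real.exp (-U x) : ℂ) * p x) j) := hwp.continuous_pdC j
    have := integral_mul_fderiv_eq_neg_fderiv_mul_of_integrable (μ := volume)
      (f := fun x => (Real.exp (-U x) : ℂ) * p x) (g := q) (v := EuclideanSpace.single j 1)
      ((hdc.mul hq.continuous).integrable_of_hasCompactSupport (hwpc.pdC j).mul_right)
      ((hwp.continuous.mul (hq.continuous_pdC j)).integrable_of_hasCompactSupport hwpc.mul_right)
      ((hwp.continuous.mul hq.continuous).integrable_of_hasCompactSupport hwpc.mul_right)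
      (fun x _ => hwp.differentiable (by simp) x) (fun x _ => hq.differentiable (by simp) x)
    change ∫ x, (Real.exp (-U x) : ℂ) * p x * pdC n q j x = -∫ x,
      pdC n (fun x => (Real.exp (-U x) : ℂ) * p x) j x * q x at this
    simp only [hder] at this
    simp only [mul_assoc] at this ⊢
    exact this

section Gibbs

variable {n : ℕ} {U : EuclideanSpace ℝ (Fin n) → ℝ} {μ : Measure (EuclideanSpace ℝ (Fin n))}

/-- Green's formula for the drift operator. -/
lemma IsGibbsMeasure.integral_mul_LopC (hμ : IsGibbsMeasure n U μ)
    {p q : EuclideanSpace ℝ (Fin n) → ℂ} (hp : ContDiff ℝ 1 p) (hpc : HasCompactSupport p)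
    (hq : ContDiff ℝ ∞ q) :
    ∫ x, p x * LopC n U q x ∂μ = -∫ x, ∑ j, pdC n p j x * pdC n q j x ∂μ := by
  have := hμ.isProbabilityMeasure
  have hUc : ∀ j, Continuous fun x => (pdR n U j x : ℂ) := fun j =>
    Complex.continuous_ofReal.comp (hμ.smooth.of_smooth.continuous_pdR j)
  have hqc := fun j => hq.of_smooth.continuous_pdC j
  have hqcc := fun j => (hq.pdC_smooth j).of_smooth.continuous_pdC j
  have i1 : ∀ j, Integrable (fun x => p x * pdC n (pdC n q j) j x) μ := fun j =>
    (hp.continuous.mul (hqcc j)).integrable_of_hasCompactSupport hpc.mul_right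
  have i2 : ∀ j, Integrable (fun x => p x * ((pdR n U j x : ℂ) * pdC n q j x)) μ := fun j =>
    (hp.continuous.mul ((hUc j).mul (hqc j))).integrable_of_hasCompactSupport hpc.mul_right
  have i3 : ∀ j, Integrable (fun x => pdC n p j x * pdC n q j x) μ := fun j =>
    ((hp.continuous_pdC j).mul (hqc j)).integrable_of_hasCompactSupport (hpc.pdC j).mul_right
  have e1 : ∀ x, p x * LopC n U q x = ∑ j, (p x * pdC n (pdC n q j) j x -
      p x * ((pdR n U j x : ℂ) * pdC n q j x)) := by
    intro x
    rw [Finset.sum_sub_distrib, ← Finset.mul_sum, ← Finset.mul_sum, ← mul_sub]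
    rfl
  simp only [e1]
  have i12 : ∀ j, Integrable (fun x => p x * pdC n (pdC n q j) j x -
      p x * ((pdR n U j x : ℂ) * pdC n q j x)) μ := fun j => (i1 j).sub (i2 j)
  rw [integral_finsetSum _ (fun j _ => i12 j), integral_finsetSum _ (fun j _ => i3 j),
    ← Finset.sum_neg_distrib]
  refine Finset.sum_congr rfl fun j _ => ?_
  rw [integral_sub (i1 j) (i2 j), hμ.integral_mul_pdC j p _ hp (hq.pdC_smooth j).of_smooth hpc,
    ← integral_neg, ← integral_neg, ← integral_sub]
  · congr 1
    ext x
    ring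
  · refine Integrable.neg ?_
    have := (i3 j).sub (i2 j)
    refine this.congr (Eventually.of_forall fun x => ?_)
    simp only [Pi.sub_apply]
    ring
  · exact i2 j

/-- Symmetry of the drift operator. -/
lemma IsGibbsMeasure.integral_LopC_comm (hμ : IsGibbsMeasure n U μ)
    {p q : EuclideanSpace ℝ (Fin n) → ℂ} (hp : ContDiff ℝ ∞ p) (hpc : HasCompactSupport p)
    (hq : ContDiff ℝ ∞ q) :
    ∫ x, p x * LopC n U q x ∂μ = ∫ x, LopC n U p x * q x ∂μ := by
  have := hμ.isProbabilityMeasure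
  have hUc : ∀ j, Continuous fun x => (pdR n U j x : ℂ) := fun j =>
    Complex.continuous_ofReal.comp (hμ.smooth.of_smooth.continuous_pdR j)
  rw [hμ.integral_mul_LopC hp.of_smooth hpc hq]
  have i3 : ∀ j, Integrable (fun x => pdC n p j x * pdC n q j x) μ := fun j =>
    ((hp.of_smooth.continuous_pdC j).mul (hq.of_smooth.continuous_pdC
      j)).integrable_of_hasCompactSupport (hpc.pdC j).mul_right
  have i4 : ∀ j, Integrable (fun x => (pdC n (pdC n p j) j x - (pdR n U j x : ℂ) * pdC n p j x)
      * q x) μ := fun j => by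
    refine Continuous.integrable_of_hasCompactSupport ?_ ?_
    · exact (((hp.pdC_smooth j).of_smooth.continuous_pdC j).sub
        ((hUc j).mul (hp.of_smooth.continuous_pdC j))).mul hq.continuous
    · exact (((hpc.pdC j).pdC j).sub (hpc.pdC j).mul_left).mul_right
  rw [integral_finsetSum _ (fun j _ => i3 j), ← Finset.sum_neg_distrib]
  have e : ∀ x, LopC n U p x * q x =
      ∑ j, (pdC n (pdC n p j) j x - (pdR n U j x : ℂ) * pdC n p j x) * q x := by
    intro x
    rw [← Finset.sum_mul, Finset.sum_sub_distrib]
    rfl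
  simp only [e]
  rw [integral_finsetSum _ (fun j _ => i4 j)]
  refine Finset.sum_congr rfl fun j _ => ?_
  rw [hμ.integral_mul_pdC j _ q (hp.pdC_smooth j).of_smooth hq.of_smooth (hpc.pdC j), neg_neg]

end Gibbs

/-- A smooth compactly supported function with values in `[0, 1]`. -/
structure IsCutoff (n : ℕ) (η : EuclideanSpace ℝ (Fin n) → ℝ) : Prop where
  smooth : ContDiff ℝ ∞ η
  compact : HasCompactSupport η
  nonneg : ∀ x, 0 ≤ η x
  le_one : ∀ x, η x ≤ 1

lemma exists_cutoff_seq (n : ℕ) : ∃ (η : ℕ → EuclideanSpace ℝ (Fin n) → ℝ) (C : ℝ), 0 ≤ C ∧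
    (∀ k, IsCutoff n (η k)) ∧ (∀ k j x, |pdR n (η k) j x| ≤ C / (k + 1)) ∧
    ∀ R : ℝ, ∀ᶠ k in atTop, ∀ x, ‖x‖ ≤ R → η k x = 1 := by
  let f : ContDiffBump (0 : EuclideanSpace ℝ (Fin n)) := ⟨1, 2, by norm_num, by norm_num⟩
  have hf : ContDiff ℝ ∞ f := f.contDiff
  have hfc : HasCompactSupport f := f.hasCompactSupport
  obtain ⟨C, hC⟩ := (hf.of_smooth.continuous_fderiv (by simp)).bounded_above_of_compact_support
    (hfc.fderiv ℝ)
  have hsc : ∀ k : ℕ, ContDiff ℝ ∞ fun x : EuclideanSpace ℝ (Fin n) => ((k : ℝ) + 1)⁻¹ • x :=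
    fun k => contDiff_const_smul _
  have hpos : ∀ k : ℕ, (0 : ℝ) < (k : ℝ) + 1 := fun k => by positivity
  refine ⟨fun k x => f (((k : ℝ) + 1)⁻¹ • x), C, (norm_nonneg _).trans (hC 0), fun k => ?_,
    fun k j x => ?_, fun R => ?_⟩
  · refine ⟨hf.comp (hsc k), ?_, fun x => f.nonneg, fun x => f.le_one⟩
    exact hfc.comp_homeomorph (Homeomorph.smulOfNeZero _ (inv_ne_zero (hpos k).ne'))
  · rw [pdR, fderiv_comp_smul, smul_apply, smul_eq_mul, abs_mul, abs_of_pos (inv_pos.2 (hpos k)),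
      ← div_eq_inv_mul]
    gcongr
    have := (fderiv ℝ f (((k : ℝ) + 1)⁻¹ • x)).le_opNorm (EuclideanSpace.single j 1)
    rw [Real.norm_eq_abs] at this
    refine this.trans ?_
    simpa using hC _
  · filter_upwards [eventually_ge_atTop ⌈R⌉₊] with k hk x hx
    refine f.one_of_mem_closedBall ?_
    rw [mem_closedBall_zero_iff, norm_smul, norm_inv, Real.norm_eq_abs, abs_of_pos (hpos k),
      ← div_eq_inv_mul, div_le_iff₀ (hpos k)]
    have : R ≤ k := Nat.ceil_le.1 hk
    change ‖x‖ ≤ 1 * _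
    linarith

section Cutoffs

variable {n : ℕ} {U : EuclideanSpace ℝ (Fin n) → ℝ} {μ : Measure (EuclideanSpace ℝ (Fin n))}
  {η : EuclideanSpace ℝ (Fin n) → ℝ}

lemma IsCutoff.continuous_ofReal (hη : IsCutoff n η) : Continuous fun x => (η x : ℂ) :=
  Complex.continuous_ofReal.comp hη.smooth.continuous

lemma IsCutoff.compact_ofReal (hη : IsCutoff n η) : HasCompactSupport fun x => (η x : ℂ) :=
  hη.compact.comp_left Complex.ofReal_zero

lemma IsCutoff.exists_bound (hη : IsCutoff n η) {F : EuclideanSpace ℝ (Fin n) → ℂ}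
    (hF : Continuous F) : ∃ C, ∀ x, ‖(η x : ℂ) * F x‖ ≤ C :=
  (hη.continuous_ofReal.mul hF).bounded_above_of_compact_support hη.compact_ofReal.mul_right

lemma IsCutoff.integrable_mul [IsFiniteMeasure μ] (hη : IsCutoff n η)
    {F : EuclideanSpace ℝ (Fin n) → ℝ} (hF : Continuous F) :
    Integrable (fun x => η x * F x) μ :=
  (hη.smooth.continuous.mul hF).integrable_of_hasCompactSupport hη.compact.mul_right

lemma IsCutoff.integrable_sq_mul [IsFiniteMeasure μ] (hη : IsCutoff n η)
    {F : EuclideanSpace ℝ (Fin n) → ℂ} (hF : Continuous F) :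
    Integrable (fun x => (η x : ℂ) ^ 2 * F x) μ := by
  refine Continuous.integrable_of_hasCompactSupport ((hη.continuous_ofReal.pow 2).mul hF) ?_
  refine HasCompactSupport.mul_right ?_
  simp only [sq]
  exact hη.compact_ofReal.mul_right

lemma IsCutoff.integrable_sq [IsFiniteMeasure μ] (hη : IsCutoff n η)
    {F : EuclideanSpace ℝ (Fin n) → ℂ} (hF : Continuous F) :
    Integrable (fun x => (η x * ‖F x‖) ^ 2) μ := by
  refine Continuous.integrable_of_hasCompactSupport ((hη.smooth.continuous.mul hF.norm).pow 2) ?_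
  simp only [sq]
  exact hη.compact.mul_right.mul_right

/-- The family `P` is Lipschitz at `t` in the `L²` norm with weight `η²`. -/
def LocLip (μ : Measure (EuclideanSpace ℝ (Fin n))) (η : EuclideanSpace ℝ (Fin n) → ℝ)
    (P : ℝ → EuclideanSpace ℝ (Fin n) → ℂ) (t : ℝ) : Prop :=
  ∃ C, ∀ᶠ s in 𝓝 t, ∫ x, (η x * ‖P s x - P t x‖) ^ 2 ∂μ ≤ C * (s - t) ^ 2

lemma LocLip.const (Q : EuclideanSpace ℝ (Fin n) → ℂ) (t : ℝ) : LocLip μ η (fun _ => Q) t :=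
  ⟨0, Eventually.of_forall fun s => by simp⟩

lemma LocLip.sub_const {P : ℝ → EuclideanSpace ℝ (Fin n) → ℂ} {t : ℝ} (hP : LocLip μ η P t)
    (Q : EuclideanSpace ℝ (Fin n) → ℂ) : LocLip μ η (fun s x => P s x - Q x) t := by
  simpa [LocLip] using hP

lemma LocLip.conj {P : ℝ → EuclideanSpace ℝ (Fin n) → ℂ} {t : ℝ} (hP : LocLip μ η P t) :
    LocLip μ η (fun s x => conj (P s x)) t := by
  simpa only [LocLip, ← map_sub, RCLike.norm_conj] using hP

lemma LocLip.shift {P : ℝ → EuclideanSpace ℝ (Fin n) → ℂ} {t h : ℝ}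
    (hP : LocLip μ η P (t + h)) : LocLip μ η (fun s => P (s + h)) t := by
  obtain ⟨C, hC⟩ := hP
  have hcont : Tendsto (fun s : ℝ => s + h) (𝓝 t) (𝓝 (t + h)) :=
    (continuous_id.add continuous_const).tendsto t
  refine ⟨C, (hcont.eventually hC).mono fun s hs => ?_⟩
  simpa using hs

lemma hasDerivAt_integral_cutoff_mul [IsFiniteMeasure μ] (hη : IsCutoff n η)
    {P Q : ℝ → EuclideanSpace ℝ (Fin n) → ℂ} {P' Q' : EuclideanSpace ℝ (Fin n) → ℂ} {t : ℝ}
    (hPc : ∀ s, Continuous (P s)) (hQc : ∀ s, Continuous (Q s)) (hP'c : Continuous P')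
    (hQ'c : Continuous Q') (hP : ∀ x, HasDerivAt (fun s => P s x) (P' x) t)
    (hQ : ∀ x, HasDerivAt (fun s => Q s x) (Q' x) t) (hPl : LocLip μ η P t)
    (hQl : LocLip μ η Q t) :
    HasDerivAt (fun s => ∫ x, (η x : ℂ) ^ 2 * (P s x * Q s x) ∂μ)
      (∫ x, (η x : ℂ) ^ 2 * (P' x * Q t x + P t x * Q' x) ∂μ) t := by
  obtain ⟨C₁, hC₁⟩ := hη.exists_bound (hPc t)
  obtain ⟨C₂, hC₂⟩ := hη.exists_bound (hQc t)
  obtain ⟨C₃, hC₃⟩ := hη.exists_bound hP'c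
  obtain ⟨C₄, hC₄⟩ := hη.exists_bound hQ'c
  obtain ⟨K₁, hK₁⟩ := hPl
  obtain ⟨K₂, hK₂⟩ := hQl
  have hnorm : ∀ x (z : ℂ), ‖(η x : ℂ) * z‖ = η x * ‖z‖ := fun x z => by
    rw [norm_mul, Complex.norm_real, Real.norm_eq_abs, abs_of_nonneg (hη.nonneg x)]
  have key := hasDerivAt_integral_mul_of_sq_control (μ := μ)
    (A := fun s x => (η x : ℂ) * P s x) (B := fun s x => (η x : ℂ) * Q s x)
    (A' := fun x => (η x : ℂ) * P' x) (B' := fun x => (η x : ℂ) * Q' x) (t := t)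
    (C := max (max C₁ C₂) (max C₃ C₄)) (C₁ := max K₁ K₂)
    (fun s => (hη.continuous_ofReal.mul (hPc s)).aestronglyMeasurable)
    (fun s => (hη.continuous_ofReal.mul (hQc s)).aestronglyMeasurable)
    (fun s => by simpa only [hnorm] using hη.integrable_sq (hPc s))
    (fun s => by simpa only [hnorm] using hη.integrable_sq (hQc s))
    (fun x => (hP x).const_mul _) (fun x => (hQ x).const_mul _)
    (hη.continuous_ofReal.mul hP'c).aestronglyMeasurable
    (hη.continuous_ofReal.mul hQ'c).aestronglyMeasurable
    (fun x => (hC₁ x).trans ((le_max_left _ _).trans (le_max_left _ _)))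
    (fun x => (hC₂ x).trans ((le_max_right _ _).trans (le_max_left _ _)))
    (fun x => (hC₃ x).trans ((le_max_left _ _).trans (le_max_right _ _)))
    (fun x => (hC₄ x).trans ((le_max_right _ _).trans (le_max_right _ _)))
    (hK₁.mono fun s hs => by
      simp only [← mul_sub, hnorm]
      refine hs.trans ?_
      gcongr; exact le_max_left _ _)
    (hK₂.mono fun s hs => by
      simp only [← mul_sub, hnorm]
      refine hs.trans ?_
      gcongr; exact le_max_right _ _)
  convert key using 1
  · ext s
    congr 1
    ext x
    ring
  · congr 1
    ext x
    ring

lemma IsCutoff.sq_smooth (hη : IsCutoff n η) : ContDiff ℝ ∞ fun x => (η x : ℂ) ^ 2 :=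
  hη.smooth.ofReal_comp.pow 2

lemma IsCutoff.sq_compact (hη : IsCutoff n η) : HasCompactSupport fun x => (η x : ℂ) ^ 2 := by
  simp only [sq]
  exact hη.compact_ofReal.mul_right

lemma IsCutoff.pdC_sq (hη : IsCutoff n η) (j : Fin n) (x : EuclideanSpace ℝ (Fin n)) :
    pdC n (fun y => (η y : ℂ) ^ 2) j x = 2 * (η x : ℂ) * (pdR n η j x : ℂ) := by
  have h := hη.smooth.of_smooth.ofReal_comp
  simp only [sq]
  rw [pdC_mul h h, pdC_ofReal hη.smooth.of_smooth]
  ring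

/-- Green's formula with a cutoff. -/
lemma IsGibbsMeasure.integral_cutoff_mul_LopC (hμ : IsGibbsMeasure n U μ) (hη : IsCutoff n η)
    {p q : EuclideanSpace ℝ (Fin n) → ℂ} (hp : ContDiff ℝ ∞ p) (hq : ContDiff ℝ 1 q) :
    ∫ x, (η x : ℂ) ^ 2 * (q x * LopC n U p x) ∂μ =
      -∫ x, ∑ j, (2 * (η x : ℂ) * (pdR n η j x : ℂ) * (q x * pdC n p j x) +
        (η x : ℂ) ^ 2 * (pdC n q j x * pdC n p j x)) ∂μ := by
  have h := hμ.integral_mul_LopC (hη.sq_smooth.of_smooth.mul hq) hη.sq_compact.mul_right hp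
  simp only [mul_assoc] at h ⊢
  rw [h]
  congr 2
  ext x
  refine Finset.sum_congr rfl fun j _ => ?_
  rw [pdC_mul hη.sq_smooth.of_smooth hq, hη.pdC_sq]
  ring

lemma IsCutoff.continuous_flux (hη : IsCutoff n η) {F : EuclideanSpace ℝ (Fin n) → ℂ}
    (hF : Continuous F) (j : Fin n) :
    Continuous fun x => 2 * (η x : ℂ) * (pdR n η j x : ℂ) * F x :=
  ((continuous_const.mul hη.continuous_ofReal).mul
    (Complex.continuous_ofReal.comp (hη.smooth.of_smooth.continuous_pdR j))).mul hF

lemma IsCutoff.integrable_flux [IsFiniteMeasure μ] (hη : IsCutoff n η)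
    {F : EuclideanSpace ℝ (Fin n) → ℂ} (hF : Continuous F) (j : Fin n) :
    Integrable (fun x => 2 * (η x : ℂ) * (pdR n η j x : ℂ) * F x) μ :=
  (hη.continuous_flux hF j).integrable_of_hasCompactSupport
    (hη.compact_ofReal.mul_left.mul_right.mul_right)

lemma IsCutoff.norm_flux_le (hη : IsCutoff n η) {C : ℝ} (hC : ∀ j x, |pdR n η j x| ≤ C)
    (j : Fin n) (x : EuclideanSpace ℝ (Fin n)) (z : ℂ) :
    ‖2 * (η x : ℂ) * (pdR n η j x : ℂ) * z‖ ≤ 2 * C * (η x * ‖z‖) := by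
  rw [norm_mul, norm_mul, norm_mul, Complex.norm_real, Complex.norm_real, Complex.norm_ofNat,
    Real.norm_eq_abs, Real.norm_eq_abs, abs_of_nonneg (hη.nonneg x)]
  have h1 := mul_le_mul_of_nonneg_left (hC j x) (mul_nonneg (hη.nonneg x) (norm_nonneg z))
  linarith

/-- The antisymmetric part of the cutoff Green formula only involves derivatives of the cutoff. -/
lemma IsGibbsMeasure.integral_cutoff_LopC_antisymm (hμ : IsGibbsMeasure n U μ)
    (hη : IsCutoff n η) {p q : EuclideanSpace ℝ (Fin n) → ℂ} (hp : ContDiff ℝ ∞ p)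
    (hq : ContDiff ℝ ∞ q) :
    ∫ x, (η x : ℂ) ^ 2 * (conj (q x) * LopC n U p x - p x * conj (LopC n U q x)) ∂μ =
      -∫ x, ∑ j, 2 * (η x : ℂ) * (pdR n η j x : ℂ) *
        (conj (q x) * pdC n p j x - p x * conj (pdC n q j x)) ∂μ := by
  have := hμ.isProbabilityMeasure
  have hqc := hq.of_smooth.conj
  have hpj := fun j => hp.of_smooth.continuous_pdC j
  have hqj := fun j => Complex.continuous_conj.comp (hq.of_smooth.continuous_pdC j)
  have h1 := hμ.integral_cutoff_mul_LopC hη hp hqc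
  have h2 := hμ.integral_cutoff_mul_LopC hη hq.conj hp.of_smooth
  simp only [LopC_conj hq, pdC_conj hq.of_smooth] at h1 h2
  have cL1 : Continuous fun x => conj (q x) * LopC n U p x :=
    hqc.continuous.mul (continuous_LopC hμ.smooth hp)
  have cL2 : Continuous fun x => p x * conj (LopC n U q x) :=
    hp.continuous.mul (Complex.continuous_conj.comp (continuous_LopC hμ.smooth hq))
  simp only [mul_sub]
  have i1 := integrable_finsetSum (μ := μ) Finset.univ fun j _ =>
    (hη.integrable_flux (μ := μ) (hqc.continuous.mul (hpj j)) j).add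
      (hη.integrable_sq_mul (μ := μ) ((hqj j).mul (hpj j)))
  have i2 := integrable_finsetSum (μ := μ) Finset.univ fun j _ =>
    (hη.integrable_flux (μ := μ) (hp.continuous.mul (hqj j)) j).add
      (hη.integrable_sq_mul (μ := μ) ((hpj j).mul (hqj j)))
  rw [integral_sub (hη.integrable_sq_mul cL1) (hη.integrable_sq_mul cL2), h1, h2, neg_sub_neg,
    ← neg_sub, neg_inj]
  refine Eq.trans (integral_sub i1 i2).symm (integral_congr_ae (Eventually.of_forall fun x => ?_))
  simp only [← Finset.sum_sub_distrib, Pi.add_apply, Pi.mul_apply, Function.comp_apply]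
  refine Finset.sum_congr rfl fun j _ => ?_
  ring

lemma IsGibbsMeasure.norm_integral_cutoff_LopC_antisymm_le (hμ : IsGibbsMeasure n U μ)
    (hη : IsCutoff n η) {C : ℝ} (hC : ∀ j x, |pdR n η j x| ≤ C)
    {p q : EuclideanSpace ℝ (Fin n) → ℂ} (hp : ContDiff ℝ ∞ p) (hq : ContDiff ℝ ∞ q) :
    ‖∫ x, (η x : ℂ) ^ 2 * (conj (q x) * LopC n U p x - p x * conj (LopC n U q x)) ∂μ‖ ≤
      2 * C * ∑ j, ∫ x, η x * (‖q x‖ * ‖pdC n p j x‖ + ‖p x‖ * ‖pdC n q j x‖) ∂μ := by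
  have := hμ.isProbabilityMeasure
  have hpj := fun j => hp.of_smooth.continuous_pdC j
  have hqj := fun j => hq.of_smooth.continuous_pdC j
  have hi : ∀ j, Integrable (fun x => η x * (‖q x‖ * ‖pdC n p j x‖ + ‖p x‖ * ‖pdC n q j x‖)) μ :=
    fun j => hη.integrable_mul ((hq.continuous.norm.mul (hpj j).norm).add
      (hp.continuous.norm.mul (hqj j).norm))
  rw [hμ.integral_cutoff_LopC_antisymm hη hp hq, norm_neg, ← integral_finsetSum _ fun j _ => hi j,
    ← integral_const_mul]
  refine norm_integral_le_of_norm_le ((integrable_finsetSum _ fun j _ => hi j).const_mul _)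
    (Eventually.of_forall fun x => ?_)
  rw [Finset.mul_sum]
  refine (norm_sum_le _ _).trans (Finset.sum_le_sum fun j _ => ?_)
  have hC0 : 0 ≤ C := (abs_nonneg _).trans (hC j x)
  refine (hη.norm_flux_le hC j x _).trans ?_
  have := hη.nonneg x
  gcongr
  refine (norm_sub_le _ _).trans_eq ?_
  simp

end Cutoffs

section L2Products

variable {X : Type*} [MeasurableSpace X] {μ : Measure X}

lemma integral_norm_mul_norm_le {u v : X → ℂ} (hum : AEStronglyMeasurable u μ)
    (hvm : AEStronglyMeasurable v μ) (hui : Integrable (fun x => ‖u x‖ ^ 2) μ)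
    (hvi : Integrable (fun x => ‖v x‖ ^ 2) μ) :
    ∫ x, ‖u x‖ * ‖v x‖ ∂μ ≤ √(∫ x, ‖u x‖ ^ 2 ∂μ) * √(∫ x, ‖v x‖ ^ 2 ∂μ) :=
  integral_mul_le_sqrt_mul_sqrt (fun _ => norm_nonneg _) (fun _ => norm_nonneg _) hum.norm
    hvm.norm hui hvi

lemma integrable_norm_mul_norm {u v : X → ℂ} (hum : AEStronglyMeasurable u μ)
    (hvm : AEStronglyMeasurable v μ) (hui : Integrable (fun x => ‖u x‖ ^ 2) μ)
    (hvi : Integrable (fun x => ‖v x‖ ^ 2) μ) : Integrable (fun x => ‖u x‖ * ‖v x‖) μ := by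
  simpa using (integrable_mul_of_sq hum hvm hui hvi).norm

lemma integrable_weight_mul {c u v : X → ℂ} (hcm : AEStronglyMeasurable c μ)
    (hc : ∀ x, ‖c x‖ ≤ 1) (hum : AEStronglyMeasurable u μ)
    (hvm : AEStronglyMeasurable v μ) (hui : Integrable (fun x => ‖u x‖ ^ 2) μ)
    (hvi : Integrable (fun x => ‖v x‖ ^ 2) μ) : Integrable (fun x => c x * (u x * v x)) μ :=
  (integrable_mul_of_sq hum hvm hui hvi).bdd_mul hcm (Eventually.of_forall hc)

/-- Weighted integrals of products are continuous for convergence in `L²`. -/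
lemma tendsto_integral_weight_mul {ι : Type*} {l : Filter ι} {u v : ι → X → ℂ}
    {u₀ v₀ c : X → ℂ} (hcm : AEStronglyMeasurable c μ) (hc : ∀ x, ‖c x‖ ≤ 1)
    (hum : ∀ i, AEStronglyMeasurable (u i) μ) (hvm : ∀ i, AEStronglyMeasurable (v i) μ)
    (hum₀ : AEStronglyMeasurable u₀ μ) (hvm₀ : AEStronglyMeasurable v₀ μ)
    (hui : ∀ i, Integrable (fun x => ‖u i x‖ ^ 2) μ)
    (hvi : ∀ i, Integrable (fun x => ‖v i x‖ ^ 2) μ)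
    (hui₀ : Integrable (fun x => ‖u₀ x‖ ^ 2) μ) (hvi₀ : Integrable (fun x => ‖v₀ x‖ ^ 2) μ)
    (hu : Tendsto (fun i => ∫ x, ‖u i x - u₀ x‖ ^ 2 ∂μ) l (𝓝 0))
    (hv : Tendsto (fun i => ∫ x, ‖v i x - v₀ x‖ ^ 2 ∂μ) l (𝓝 0)) :
    Tendsto (fun i => ∫ x, c x * (u i x * v i x) ∂μ) l (𝓝 (∫ x, c x * (u₀ x * v₀ x) ∂μ)) := by
  rw [tendsto_iff_norm_sub_tendsto_zero]
  have hsu : Tendsto (fun i => √(∫ x, ‖u i x - u₀ x‖ ^ 2 ∂μ)) l (𝓝 0) := by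
    simpa using hu.sqrt
  have hsv : Tendsto (fun i => √(∫ x, ‖v i x - v₀ x‖ ^ 2 ∂μ)) l (𝓝 0) := by
    simpa using hv.sqrt
  refine squeeze_zero (g := fun i => √(∫ x, ‖u i x - u₀ x‖ ^ 2 ∂μ) * √(∫ x, ‖v₀ x‖ ^ 2 ∂μ) +
      √(∫ x, ‖u₀ x‖ ^ 2 ∂μ) * √(∫ x, ‖v i x - v₀ x‖ ^ 2 ∂μ) +
      √(∫ x, ‖u i x - u₀ x‖ ^ 2 ∂μ) * √(∫ x, ‖v i x - v₀ x‖ ^ 2 ∂μ)) (fun i => norm_nonneg _)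
    (fun i => ?_) ?_
  · have dum := (hum i).sub hum₀
    have dvm := (hvm i).sub hvm₀
    have dui := integrable_norm_sub_sq (hum i) hum₀ (hui i) hui₀
    have dvi := integrable_norm_sub_sq (hvm i) hvm₀ (hvi i) hvi₀
    have i1 := integrable_norm_mul_norm dum hvm₀ dui hvi₀
    have i2 := integrable_norm_mul_norm hum₀ dvm hui₀ dvi
    have i3 := integrable_norm_mul_norm dum dvm dui dvi
    simp only [Pi.sub_apply] at i1 i2 i3
    rw [← integral_sub (integrable_weight_mul hcm hc (hum i) (hvm i) (hui i) (hvi i))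
      (integrable_weight_mul hcm hc hum₀ hvm₀ hui₀ hvi₀)]
    refine (norm_integral_le_of_norm_le ((i1.add i2).add i3) (Eventually.of_forall fun x => ?_)).trans
      ?_
    · have e : c x * (u i x * v i x) - c x * (u₀ x * v₀ x) = c x * ((u i x - u₀ x) * v₀ x +
        u₀ x * (v i x - v₀ x) + (u i x - u₀ x) * (v i x - v₀ x)) := by ring
      rw [e, norm_mul]
      refine (mul_le_of_le_one_left (norm_nonneg _) (hc x)).trans ?_
      refine (norm_add₃_le).trans_eq ?_
      simp
    · rw [integral_add' (i1.add i2) i3, integral_add' i1 i2]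
      exact add_le_add (add_le_add (integral_norm_mul_norm_le dum hvm₀ dui hvi₀)
        (integral_norm_mul_norm_le hum₀ dvm hui₀ dvi)) (integral_norm_mul_norm_le dum dvm dui dvi)
  · have := ((hsu.mul_const (√(∫ x, ‖v₀ x‖ ^ 2 ∂μ))).add
      (hsv.const_mul (√(∫ x, ‖u₀ x‖ ^ 2 ∂μ)))).add (hsu.mul hsv)
    simpa using this

end L2Products

section Flow

variable {n : ℕ} {U : EuclideanSpace ℝ (Fin n) → ℝ} {μ : Measure (EuclideanSpace ℝ (Fin n))}
  {lam : ℝ} {φ : ℝ → EuclideanSpace ℝ (Fin n) → ℂ} {η : EuclideanSpace ℝ (Fin n) → ℝ}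

/-- The mass `∫ |u|² dμ`. -/
def massOf (μ : Measure (EuclideanSpace ℝ (Fin n))) (u : EuclideanSpace ℝ (Fin n) → ℂ) : ℝ :=
  ∫ x, ‖u x‖ ^ 2 ∂μ

/-- The Dirichlet energy `∫ |∇u|² dμ`. -/
def gradE (n : ℕ) (μ : Measure (EuclideanSpace ℝ (Fin n))) (u : EuclideanSpace ℝ (Fin n) → ℂ) :
    ℝ :=
  ∫ x, gradSqC n u x ∂μ

/-- The absolute entropy `∫ |u|² |log |u|²| dμ`. -/
def entAbs (μ : Measure (EuclideanSpace ℝ (Fin n))) (u : EuclideanSpace ℝ (Fin n) → ℂ) : ℝ :=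
  ∫ x, ‖u x‖ ^ 2 * |Real.log (‖u x‖ ^ 2)| ∂μ

/-- The unnormalised entropy `∫ |u|² log |u|² dμ`. -/
def ent0 (μ : Measure (EuclideanSpace ℝ (Fin n))) (u : EuclideanSpace ℝ (Fin n) → ℂ) : ℝ :=
  ∫ x, ‖u x‖ ^ 2 * Real.log (‖u x‖ ^ 2) ∂μ

/-- The time derivative prescribed by the logarithmic Schrödinger equation. -/
def flowVel (n : ℕ) (U : EuclideanSpace ℝ (Fin n) → ℝ) (μ : Measure (EuclideanSpace ℝ (Fin n)))
    (lam : ℝ) (u : EuclideanSpace ℝ (Fin n) → ℂ) (x : EuclideanSpace ℝ (Fin n)) : ℂ :=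
  Complex.I * (LopC n U u x + lam * ((Real.log (massOf μ u) : ℂ) * u x - logNL (u x)))

/-- A finite-energy solution of the logarithmic Schrödinger equation. -/
structure IsLogFlow (n : ℕ) (U : EuclideanSpace ℝ (Fin n) → ℝ)
    (μ : Measure (EuclideanSpace ℝ (Fin n))) (lam : ℝ)
    (φ : ℝ → EuclideanSpace ℝ (Fin n) → ℂ) : Prop where
  gibbs : IsGibbsMeasure n U μ
  smooth : ∀ t, ContDiff ℝ ∞ (φ t)
  hasDerivAt : ∀ t x, HasDerivAt (fun s => φ s x) (flowVel n U μ lam (φ t) x) t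
  mass_int : ∀ t, Integrable (fun x => ‖φ t x‖ ^ 2) μ
  grad_int : ∀ t, Integrable (fun x => gradSqC n (φ t) x) μ
  ent_int : ∀ t, Integrable (fun x => ‖φ t x‖ ^ 2 * |Real.log (‖φ t x‖ ^ 2)|) μ

/-- Uniform bounds on mass, Dirichlet energy, entropy and logarithm of the mass at time `t`. -/
structure FlowBound (n : ℕ) (μ : Measure (EuclideanSpace ℝ (Fin n)))
    (φ : ℝ → EuclideanSpace ℝ (Fin n) → ℂ) (M t : ℝ) : Prop where
  mass_le : massOf μ (φ t) ≤ M
  grad_le : gradE n μ (φ t) ≤ M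
  ent_le : entAbs μ (φ t) ≤ M
  log_le : |Real.log (massOf μ (φ t))| ≤ M

lemma FlowBound.nonneg {M t : ℝ} (h : FlowBound n μ φ M t) : 0 ≤ M :=
  (abs_nonneg _).trans h.log_le

lemma IsLogFlow.continuous (hφ : IsLogFlow n U μ lam φ) (t : ℝ) : Continuous (φ t) :=
  (hφ.smooth t).continuous

lemma IsLogFlow.continuous_pd (hφ : IsLogFlow n U μ lam φ) (t : ℝ) (j : Fin n) :
    Continuous (pdC n (φ t) j) :=
  (hφ.smooth t).of_smooth.continuous_pdC j

lemma IsLogFlow.continuous_vel (hφ : IsLogFlow n U μ lam φ) (t : ℝ) :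
    Continuous (flowVel n U μ lam (φ t)) :=
  continuous_const.mul ((continuous_LopC hφ.gibbs.smooth (hφ.smooth t)).add
    (continuous_const.mul ((continuous_const.mul (hφ.continuous t)).sub
      (continuous_logNL.comp (hφ.continuous t)))))

lemma IsLogFlow.pd_int (hφ : IsLogFlow n U μ lam φ) (t : ℝ) (j : Fin n) :
    Integrable (fun x => ‖pdC n (φ t) j x‖ ^ 2) μ := by
  refine Integrable.mono' (hφ.grad_int t) ((hφ.continuous_pd t j).norm.pow 2).aestronglyMeasurable
    (Eventually.of_forall fun x => ?_)
  rw [Real.norm_eq_abs, abs_of_nonneg (by positivity)]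
  exact Finset.single_le_sum (f := fun j => ‖pdC n (φ t) j x‖ ^ 2) (fun _ _ => by positivity)
    (Finset.mem_univ j)

lemma IsLogFlow.integral_pd_le (hφ : IsLogFlow n U μ lam φ) (t : ℝ) (j : Fin n) :
    ∫ x, ‖pdC n (φ t) j x‖ ^ 2 ∂μ ≤ gradE n μ (φ t) :=
  integral_mono (hφ.pd_int t j) (hφ.grad_int t) fun x =>
    Finset.single_le_sum (f := fun j => ‖pdC n (φ t) j x‖ ^ 2) (fun _ _ => by positivity)
      (Finset.mem_univ j)

lemma IsLogFlow.tendsto_sub_sq (hφ : IsLogFlow n U μ lam φ) {M τ : ℝ} {S : Set ℝ} (hτ : τ ∈ S)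
    (hM : ∀ s ∈ S, entAbs μ (φ s) ≤ M) :
    Tendsto (fun s => ∫ x, ‖φ s x - φ τ x‖ ^ 2 ∂μ) (𝓝[S] τ) (𝓝 0) := by
  have := hφ.gibbs.isProbabilityMeasure
  refine tendsto_integral_norm_sub_sq_zero (M := M)
    (fun s => (hφ.continuous s).aestronglyMeasurable) (hφ.continuous τ).aestronglyMeasurable
    (fun x => (hφ.hasDerivAt τ x).continuousAt.tendsto.mono_left nhdsWithin_le_nhds) ?_
    (hφ.ent_int τ) (hM τ hτ)
  filter_upwards [self_mem_nhdsWithin] with s hs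
  exact ⟨hφ.ent_int s, hM s hs⟩

lemma IsLogFlow.integral_sub_sq_le (hφ : IsLogFlow n U μ lam φ) (s t : ℝ) :
    ∫ x, ‖φ s x - φ t x‖ ^ 2 ∂μ ≤ 2 * massOf μ (φ s) + 2 * massOf μ (φ t) := by
  have hs := hφ.mass_int s
  have ht := hφ.mass_int t
  rw [massOf, massOf, ← integral_const_mul, ← integral_const_mul,
    ← integral_add (hs.const_mul 2) (ht.const_mul 2)]
  exact integral_mono (integrable_norm_sub_sq (hφ.continuous s).aestronglyMeasurable
    (hφ.continuous t).aestronglyMeasurable hs ht) ((hs.const_mul 2).add (ht.const_mul 2))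
    fun x => norm_sub_sq_le_two _ _

lemma abs_re_I_mul_forcing_le {a b G : ℂ} {κ M l lam : ℝ} (hb : ‖b‖ ≤ κ) (hG : ‖G‖ ≤ κ)
    (hl : |l| ≤ M) :
    |(Complex.I * (conj (a - b) * (G + lam * ((l : ℂ) * a - logNL a)))).re| ≤
      ‖a - b‖ * (κ + |lam| * (M * κ + 2 + 2 * κ ^ 2)) + 2 * |lam| * ‖a - b‖ ^ 2 := by
  have hκ : 0 ≤ κ := (norm_nonneg b).trans hb
  have hM : 0 ≤ M := (abs_nonneg l).trans hl
  have e : (Complex.I * (conj (a - b) * (G + lam * ((l : ℂ) * a - logNL a)))).re =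
      (Complex.I * (conj (a - b) * (G + lam * ((l : ℂ) * b - logNL b)))).re +
        lam * ((logNL a - logNL b) * conj (a - b)).im := by
    generalize logNL a = A
    generalize logNL b = B
    simp
    ring
  have h1 := abs_im_log_nonlinearity_sub_le a b
  have h2 : ‖logNL b‖ ≤ 2 + 2 * κ ^ 2 := (norm_logNL_le b).trans (by gcongr)
  rw [e]
  refine (abs_add_le _ _).trans (add_le_add ?_ ?_)
  · refine (Complex.abs_re_le_norm _).trans ?_
    rw [norm_mul, norm_mul, Complex.norm_I, one_mul, RCLike.norm_conj]
    gcongr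
    refine (norm_add_le _ _).trans (add_le_add hG ?_)
    rw [norm_mul, Complex.norm_real, Real.norm_eq_abs, add_assoc]
    gcongr
    refine (norm_sub_le _ _).trans (add_le_add ?_ h2)
    rw [norm_mul, Complex.norm_real, Real.norm_eq_abs]
    gcongr
  · rw [abs_mul, mul_comm 2, mul_assoc]
    gcongr
    exact h1

end Flow

section Gap

variable {n : ℕ} {U : EuclideanSpace ℝ (Fin n) → ℝ} {μ : Measure (EuclideanSpace ℝ (Fin n))}
  {lam : ℝ} {φ : ℝ → EuclideanSpace ℝ (Fin n) → ℂ} {η : EuclideanSpace ℝ (Fin n) → ℝ}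

lemma IsCutoff.norm_ofReal_mul (hη : IsCutoff n η) (x : EuclideanSpace ℝ (Fin n)) (z : ℂ) :
    ‖(η x : ℂ) * z‖ = η x * ‖z‖ := by
  rw [norm_mul, Complex.norm_real, Real.norm_eq_abs, abs_of_nonneg (hη.nonneg x)]

lemma IsCutoff.norm_sq_le_one (hη : IsCutoff n η) (x : EuclideanSpace ℝ (Fin n)) :
    ‖(η x : ℂ) ^ 2‖ ≤ 1 := by
  rw [norm_pow, Complex.norm_real, Real.norm_eq_abs, abs_of_nonneg (hη.nonneg x)]
  exact pow_le_one₀ (hη.nonneg x) (hη.le_one x)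

lemma integral_cutoff_mul_conj (η : EuclideanSpace ℝ (Fin n) → ℝ)
    (u : EuclideanSpace ℝ (Fin n) → ℂ) :
    ∫ x, (η x : ℂ) ^ 2 * (u x * conj (u x)) ∂μ = ((∫ x, (η x * ‖u x‖) ^ 2 ∂μ : ℝ) : ℂ) := by
  rw [← integral_complex_ofReal]
  congr 1
  ext x
  rw [Complex.mul_conj, Complex.normSq_eq_norm_sq]
  push_cast
  ring

lemma IsLogFlow.integral_cutoff_sub_sq_le_massOf (hφ : IsLogFlow n U μ lam φ) (hη : IsCutoff n η)
    {M s t : ℝ} (hs : massOf μ (φ s) ≤ M) (ht : massOf μ (φ t) ≤ M) :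
    ∫ x, (η x * ‖φ s x - φ t x‖) ^ 2 ∂μ ≤ 4 * M := by
  have := hφ.gibbs.isProbabilityMeasure
  have h := hφ.integral_sub_sq_le s t
  refine le_trans (integral_mono (hη.integrable_sq ((hφ.continuous s).sub (hφ.continuous t)))
    (integrable_norm_sub_sq (hφ.continuous s).aestronglyMeasurable
    (hφ.continuous t).aestronglyMeasurable (hφ.mass_int s) (hφ.mass_int t)) fun x => ?_)
    (h.trans (by linarith))
  simp only [mul_pow]
  exact mul_le_of_le_one_left (by positivity) (pow_le_one₀ (hη.nonneg x) (hη.le_one x))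

/-- The boundary flux of the difference of two states is controlled by the weighted `L²` norm. -/
lemma IsLogFlow.norm_antisymm_sub_le (hφ : IsLogFlow n U μ lam φ) (hη : IsCutoff n η) {C : ℝ}
    (hC : ∀ j x, |pdR n η j x| ≤ C) (hC0 : 0 ≤ C) {M s t : ℝ} (hs : gradE n μ (φ s) ≤ M)
    (ht : gradE n μ (φ t) ≤ M) :
    ‖∫ x, (η x : ℂ) ^ 2 * (conj (φ s x - φ t x) * LopC n U (fun y => φ s y - φ t y) x -
      (φ s x - φ t x) * conj (LopC n U (fun y => φ s y - φ t y) x)) ∂μ‖ ≤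
      4 * C * n * √(4 * M) * √(∫ x, (η x * ‖φ s x - φ t x‖) ^ 2 ∂μ) := by
  have := hφ.gibbs.isProbabilityMeasure
  have hw := (hφ.smooth s).sub (hφ.smooth t)
  have hwc : Continuous fun x => φ s x - φ t x := (hφ.continuous s).sub (hφ.continuous t)
  refine (hφ.gibbs.norm_integral_cutoff_LopC_antisymm_le hη hC hw hw).trans ?_
  have hj : ∀ j, ∫ x, η x * (‖φ s x - φ t x‖ * ‖pdC n (fun y => φ s y - φ t y) j x‖ +
      ‖φ s x - φ t x‖ * ‖pdC n (fun y => φ s y - φ t y) j x‖) ∂μ ≤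
      2 * (√(4 * M) * √(∫ x, (η x * ‖φ s x - φ t x‖) ^ 2 ∂μ)) := by
    intro j
    have hpc : Continuous (pdC n (fun y => φ s y - φ t y) j) := hw.of_smooth.continuous_pdC j
    have hpe : ∀ x, pdC n (fun y => φ s y - φ t y) j x = pdC n (φ s) j x - pdC n (φ t) j x :=
      fun x => pdC_sub (hφ.smooth s).of_smooth (hφ.smooth t).of_smooth j x
    have hpi : Integrable (fun x => ‖pdC n (fun y => φ s y - φ t y) j x‖ ^ 2) μ := by
      simp only [hpe]
      exact integrable_norm_sub_sq (hφ.continuous_pd s j).aestronglyMeasurable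
        (hφ.continuous_pd t j).aestronglyMeasurable (hφ.pd_int s j) (hφ.pd_int t j)
    have hpM : ∫ x, ‖pdC n (fun y => φ s y - φ t y) j x‖ ^ 2 ∂μ ≤ 4 * M := by
      have h1 := hφ.integral_pd_le s j
      have h2 := hφ.integral_pd_le t j
      refine le_trans (integral_mono hpi (((hφ.pd_int s j).const_mul 2).add
        ((hφ.pd_int t j).const_mul 2)) fun x => ?_) ?_
      · simp only [hpe]
        exact norm_sub_sq_le_two _ _
      · rw [integral_add' ((hφ.pd_int s j).const_mul 2) ((hφ.pd_int t j).const_mul 2),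
          integral_const_mul, integral_const_mul]
        linarith
    have hcs := integral_mul_le_sqrt_mul_sqrt (μ := μ)
      (f := fun x => ‖pdC n (fun y => φ s y - φ t y) j x‖)
      (g := fun x => η x * ‖φ s x - φ t x‖) (fun x => norm_nonneg _)
      (fun x => mul_nonneg (hη.nonneg x) (norm_nonneg _)) hpc.norm.aestronglyMeasurable
      (hη.smooth.continuous.mul hwc.norm).aestronglyMeasurable hpi (hη.integrable_sq hwc)
    calc _ = 2 * ∫ x, ‖pdC n (fun y => φ s y - φ t y) j x‖ * (η x * ‖φ s x - φ t x‖) ∂μ := by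
          rw [← integral_const_mul]
          congr 1
          ext x
          ring
      _ ≤ _ := by
          gcongr
          refine hcs.trans ?_
          gcongr
  calc _ ≤ 2 * C * ∑ j : Fin n, 2 * (√(4 * M) * √(∫ x, (η x * ‖φ s x - φ t x‖) ^ 2 ∂μ)) := by
        gcongr with j
        exact hj j
    _ = _ := by
        rw [Finset.sum_const, Finset.card_univ, Fintype.card_fin, nsmul_eq_mul]
        ring

lemma two_re_I_mul (w L F : ℂ) :
    Complex.I * (L + F) * conj w + w * conj (Complex.I * (L + F)) =
      Complex.I * (conj w * L - w * conj L) + ((2 * (Complex.I * (conj w * F)).re : ℝ) : ℂ) := by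
  apply Complex.ext <;> simp <;> ring

/-- Lipschitz constant used to cross an interval on which the flow is `L²`-Lipschitz. -/
def gapConst (n : ℕ) (C κ M lam : ℝ) : ℝ :=
  4 * C * n * √(4 * M) + 2 * (κ + |lam| * (M * κ + 2 + 2 * κ ^ 2)) + 4 * |lam| * √(4 * M)

/-- On an interval where the flow is `L²`-Lipschitz at every interior point, the weighted `L²`
distance to an endpoint with a bounded state grows at a rate depending only on that bound. -/
lemma IsLogFlow.integral_cutoff_sub_sq_le (hφ : IsLogFlow n U μ lam φ) (hη : IsCutoff n η)
    {C κ M : ℝ} (hC : ∀ j x, |pdR n η j x| ≤ C) (hC0 : 0 ≤ C) (hκ : 0 ≤ κ) {s₀ s₁ : ℝ}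
    (hM : ∀ s ∈ Set.uIcc s₀ s₁, FlowBound n μ φ M s)
    (hb : ∀ x, η x ≠ 0 → ‖φ s₀ x‖ ≤ κ ∧ ‖LopC n U (φ s₀) x‖ ≤ κ)
    (hl : ∀ s ∈ Set.uIoo s₀ s₁, LocLip μ η φ s) :
    ∫ x, (η x * ‖φ s₁ x - φ s₀ x‖) ^ 2 ∂μ ≤ gapConst n C κ M lam ^ 2 * (s₁ - s₀) ^ 2 := by
  have := hφ.gibbs.isProbabilityMeasure
  have hM0 : 0 ≤ M := (hM s₀ Set.left_mem_uIcc).nonneg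
  have hB0 : 0 ≤ gapConst n C κ M lam := by unfold gapConst; positivity
  have hwc : ∀ s, Continuous fun x => φ s x - φ s₀ x :=
    fun s => (hφ.continuous s).sub (hφ.continuous s₀)
  have hwbc : ∀ s, Continuous fun x => conj (φ s x - φ s₀ x) :=
    fun s => Complex.continuous_conj.comp (hwc s)
  have hy : ∀ s, ∫ x, (η x * ‖φ s x - φ s₀ x‖) ^ 2 ∂μ =
      (∫ x, (η x : ℂ) ^ 2 * ((φ s x - φ s₀ x) * conj (φ s x - φ s₀ x)) ∂μ).re := fun s => by
    rw [integral_cutoff_mul_conj η fun x => φ s x - φ s₀ x, Complex.ofReal_re]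
  have hsqi : ∀ s, Integrable (fun x => ‖φ s x - φ s₀ x‖ ^ 2) μ := fun s =>
    integrable_norm_sub_sq (hφ.continuous s).aestronglyMeasurable
      (hφ.continuous s₀).aestronglyMeasurable (hφ.mass_int s) (hφ.mass_int s₀)
  refine le_sq_mul_sq_of_abs_deriv_le (y := fun s => ∫ x, (η x * ‖φ s x - φ s₀ x‖) ^ 2 ∂μ)
    (y' := fun s => (∫ x, (η x : ℂ) ^ 2 * (flowVel n U μ lam (φ s) x * conj (φ s x - φ s₀ x) +
      (φ s x - φ s₀ x) * conj (flowVel n U μ lam (φ s) x)) ∂μ).re) hB0 ?_ (by simp) ?_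
  · simp only [hy]
    intro τ hτ
    have h0 := hφ.tendsto_sub_sq hτ fun s hs => (hM s hs).ent_le
    refine (Complex.continuous_re.tendsto _).comp (tendsto_integral_weight_mul
      (c := fun x => (η x : ℂ) ^ 2) (hη.continuous_ofReal.pow 2).aestronglyMeasurable
      hη.norm_sq_le_one (fun s => (hwc s).aestronglyMeasurable)
      (fun s => (hwbc s).aestronglyMeasurable) (hwc τ).aestronglyMeasurable
      (hwbc τ).aestronglyMeasurable hsqi (fun s => by simpa only [RCLike.norm_conj] using hsqi s)
      (hsqi τ) (by simpa only [RCLike.norm_conj] using hsqi τ) ?_ ?_)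
    · simpa using h0
    · simpa only [← map_sub, RCLike.norm_conj, sub_sub_sub_cancel_right] using h0
  intro s hs
  have hsI : s ∈ Set.uIcc s₀ s₁ := Set.uIoo_subset_uIcc_self hs
  refine ⟨?_, ?_⟩
  · have hlw := (hl s hs).sub_const (φ s₀)
    have hd : ∀ x, HasDerivAt (fun s => φ s x - φ s₀ x) (flowVel n U μ lam (φ s) x) s :=
      fun x => (hφ.hasDerivAt s x).sub_const _
    have h := hasDerivAt_integral_cutoff_mul hη hwc hwbc (hφ.continuous_vel s)
      (Complex.continuous_conj.comp (hφ.continuous_vel s)) hd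
      (fun x => (Complex.conjCLE : ℂ →L[ℝ] ℂ).hasFDerivAt.comp_hasDerivAt s (hd x)) hlw hlw.conj
    simp only [hy]
    exact Complex.reCLM.hasFDerivAt.comp_hasDerivAt s h
  set Y := ∫ x, (η x * ‖φ s x - φ s₀ x‖) ^ 2 ∂μ with hY
  have hY0 : 0 ≤ Y := integral_nonneg fun x => by positivity
  have hYM : √Y ≤ √(4 * M) := Real.sqrt_le_sqrt (hφ.integral_cutoff_sub_sq_le_massOf hη
    (hM s hsI).mass_le (hM s₀ Set.left_mem_uIcc).mass_le)
  set κ' := κ + |lam| * (M * κ + 2 + 2 * κ ^ 2) with hκ'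
  have hκ'0 : 0 ≤ κ' := by positivity
  set F : EuclideanSpace ℝ (Fin n) → ℂ := fun x => LopC n U (φ s₀) x +
    lam * ((Real.log (massOf μ (φ s)) : ℂ) * φ s x - logNL (φ s x)) with hF
  have hFc : Continuous F := (continuous_LopC hφ.gibbs.smooth (hφ.smooth s₀)).add
    (continuous_const.mul ((continuous_const.mul (hφ.continuous s)).sub
      (continuous_logNL.comp (hφ.continuous s))))
  have hLc : Continuous fun x => LopC n U (fun y => φ s y - φ s₀ y) x :=
    continuous_LopC hφ.gibbs.smooth ((hφ.smooth s).sub (hφ.smooth s₀))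
  have hvel : ∀ x, flowVel n U μ lam (φ s) x =
      Complex.I * (LopC n U (fun y => φ s y - φ s₀ y) x + F x) := fun x => by
    rw [LopC_sub (hφ.smooth s) (hφ.smooth s₀)]
    simp only [flowVel, hF]
    ring
  have hsplit : ∫ x, (η x : ℂ) ^ 2 * (flowVel n U μ lam (φ s) x * conj (φ s x - φ s₀ x) +
      (φ s x - φ s₀ x) * conj (flowVel n U μ lam (φ s) x)) ∂μ =
      Complex.I * (∫ x, (η x : ℂ) ^ 2 * (conj (φ s x - φ s₀ x) *
        LopC n U (fun y => φ s y - φ s₀ y) x -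
        (φ s x - φ s₀ x) * conj (LopC n U (fun y => φ s y - φ s₀ y) x)) ∂μ) +
      ∫ x, (η x : ℂ) ^ 2 *
        ((2 * (Complex.I * (conj (φ s x - φ s₀ x) * F x)).re : ℝ) : ℂ) ∂μ := by
    rw [← integral_const_mul, ← integral_add]
    · congr 1
      ext x
      rw [hvel, two_re_I_mul]
      ring
    · exact (hη.integrable_sq_mul (((hwbc s).mul hLc).sub
        ((hwc s).mul (Complex.continuous_conj.comp hLc)))).const_mul _
    · exact hη.integrable_sq_mul (Complex.continuous_ofReal.comp (continuous_const.mul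
        (Complex.continuous_re.comp (continuous_const.mul ((hwbc s).mul hFc)))))
  have hfirst := hφ.norm_antisymm_sub_le hη hC hC0 (hM s hsI).grad_le
    (hM s₀ Set.left_mem_uIcc).grad_le
  have hi1 : Integrable (fun x => η x * (η x * ‖φ s x - φ s₀ x‖)) μ :=
    hη.integrable_mul (hη.smooth.continuous.mul (hwc s).norm)
  have hi2 : Integrable (fun x => (η x * ‖φ s x - φ s₀ x‖) ^ 2) μ := hη.integrable_sq (hwc s)
  have hcs : ∫ x, η x * (η x * ‖φ s x - φ s₀ x‖) ∂μ ≤ √Y := by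
    have hηi : Integrable (fun x => η x ^ 2) μ := by
      simpa only [sq] using hη.integrable_mul hη.smooth.continuous
    have h1 := integral_mul_le_sqrt_mul_sqrt (μ := μ) hη.nonneg
      (fun x => mul_nonneg (hη.nonneg x) (norm_nonneg (φ s x - φ s₀ x)))
      hη.smooth.continuous.aestronglyMeasurable
      (hη.smooth.continuous.mul (hwc s).norm).aestronglyMeasurable hηi hi2
    have h2 : ∫ x, η x ^ 2 ∂μ ≤ 1 := by
      refine (integral_mono hηi (integrable_const 1) fun x =>
        pow_le_one₀ (hη.nonneg x) (hη.le_one x)).trans_eq (by simp)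
    refine h1.trans (mul_le_of_le_one_left (Real.sqrt_nonneg _) ?_)
    rw [Real.sqrt_le_one]
    exact h2
  have hsecond : ‖∫ x, (η x : ℂ) ^ 2 *
      ((2 * (Complex.I * (conj (φ s x - φ s₀ x) * F x)).re : ℝ) : ℂ) ∂μ‖ ≤
      2 * κ' * √Y + 4 * |lam| * Y := by
    refine (norm_integral_le_of_norm_le ((hi1.const_mul (2 * κ')).add (hi2.const_mul (4 * |lam|)))
      (Eventually.of_forall fun x => ?_)).trans ?_
    · simp only [Pi.add_apply]
      by_cases hx : η x = 0
      · simp [hx]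
      have h1 := abs_re_I_mul_forcing_le (lam := lam) (a := φ s x) (hb x hx).1 (hb x hx).2
        (hM s hsI).log_le
      rw [norm_mul, norm_pow, Complex.norm_real, Complex.norm_real, Real.norm_eq_abs,
        abs_of_nonneg (hη.nonneg x), Real.norm_eq_abs, abs_mul, abs_two]
      calc η x ^ 2 * (2 * |(Complex.I * (conj (φ s x - φ s₀ x) * F x)).re|)
          ≤ η x ^ 2 * (2 * (‖φ s x - φ s₀ x‖ * κ' + 2 * |lam| * ‖φ s x - φ s₀ x‖ ^ 2)) := by
            gcongr
        _ = _ := by ring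
    · rw [integral_add' (hi1.const_mul _) (hi2.const_mul _), integral_const_mul,
        integral_const_mul]
      gcongr
  refine (Complex.abs_re_le_norm _).trans ?_
  rw [hsplit]
  refine (norm_add_le _ _).trans ?_
  rw [norm_mul, Complex.norm_I, one_mul]
  have hYY : Y ≤ √(4 * M) * √Y := by
    nlinarith [Real.sq_sqrt hY0, mul_le_mul_of_nonneg_right hYM (Real.sqrt_nonneg Y)]
  have hYl := mul_le_mul_of_nonneg_left hYY (abs_nonneg lam)
  simp only [gapConst]
  linarith

end Gap

section Crossing

lemma sq_lintegral_le {X : Type*} [MeasurableSpace X] {ν : Measure X} {ρ : X → ENNReal}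
    (hρ : AEMeasurable ρ ν) : (∫⁻ τ, ρ τ ∂ν) ^ 2 ≤ ν Set.univ * ∫⁻ τ, ρ τ ^ 2 ∂ν := by
  have h := ENNReal.lintegral_mul_le_Lp_mul_Lq ν Real.HolderConjugate.two_two
    (aemeasurable_const (b := (1 : ENNReal))) hρ
  simp only [Pi.mul_apply, one_mul, one_pow, lintegral_const, ENNReal.rpow_ofNat] at h
  calc (∫⁻ τ, ρ τ ∂ν) ^ 2 ≤ (ν Set.univ ^ (1 / 2 : ℝ) * (∫⁻ τ, ρ τ ^ 2 ∂ν) ^ (1 / 2 : ℝ)) ^ 2 := by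
        gcongr
    _ = _ := by
        rw [mul_pow, ← ENNReal.rpow_natCast, ← ENNReal.rpow_natCast, ← ENNReal.rpow_mul,
          ← ENNReal.rpow_mul]
        norm_num

/-- A family that moves at bounded speed on the compact set `K` and whose increments across the
gaps of `K` are bounded in `L²` has bounded `L²` speed across `K`. -/
lemma integral_norm_sub_sq_le_of_gaps {X : Type*} [MeasurableSpace X] {μ : Measure X}
    [IsProbabilityMeasure μ] {Φ Φ' : ℝ → X → ℂ} (hm : ∀ s, Measurable (Φ s))
    (hd : ∀ τ x, HasDerivAt (fun s => Φ s x) (Φ' τ x) τ) {K : Set ℝ} (hK : IsCompact K)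
    {s t k B : ℝ} (hk0 : 0 ≤ k) (hsK : s ∈ K) (htK : t ∈ K) (hKst : K ⊆ Set.Icc s t)
    (hk : ∀ τ ∈ K, ∀ x, ‖Φ' τ x‖ ≤ k)
    (hintg : ∀ c d, Integrable (fun x => ‖Φ d x - Φ c x‖ ^ 2) μ)
    (hgap : ∀ c ∈ K, ∀ d ∈ K, c ≤ d → (∀ τ ∈ Set.Ioo c d, τ ∉ K) →
      ∫ x, ‖Φ d x - Φ c x‖ ^ 2 ∂μ ≤ B ^ 2 * (d - c) ^ 2) :
    ∫ x, ‖Φ t x - Φ s x‖ ^ 2 ∂μ ≤ (2 * k ^ 2 + 2 * B ^ 2) * (t - s) ^ 2 := by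
  have hst : s ≤ t := (hKst hsK).2
  set α : ℝ → ℝ := fun τ => sSup (K ∩ Set.Iic (max s τ)) with hα
  set β : ℝ → ℝ := fun τ => sInf (K ∩ Set.Ici (min t τ)) with hβ
  have hαne : ∀ τ, (K ∩ Set.Iic (max s τ)).Nonempty := fun τ => ⟨s, hsK, le_max_left s τ⟩
  have hβne : ∀ τ, (K ∩ Set.Ici (min t τ)).Nonempty := fun τ => ⟨t, htK, min_le_left t τ⟩
  have hαg : ∀ τ, IsGreatest (K ∩ Set.Iic (max s τ)) (α τ) := fun τ =>
    (hK.inter_right isClosed_Iic).isGreatest_sSup (hαne τ)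
  have hβg : ∀ τ, IsLeast (K ∩ Set.Ici (min t τ)) (β τ) := fun τ =>
    (hK.inter_right isClosed_Ici).isLeast_sInf (hβne τ)
  have hαm : Measurable α := Monotone.measurable fun u v huv =>
    (hαg v).2 ⟨(hαg u).1.1, le_trans (hαg u).1.2 (max_le_max_left s huv)⟩
  have hβm : Measurable β := Monotone.measurable fun u v huv =>
    (hβg u).2 ⟨(hβg v).1.1, le_trans (min_le_min_left t huv) (hβg v).1.2⟩
  have hΦm : Measurable (Function.uncurry Φ) := measurable_uncurry_of_continuous_of_measurable
    (fun x => continuous_iff_continuousAt.2 fun τ => (hd τ x).continuousAt) hm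
  set ρ : X → ℝ → ENNReal := fun x τ =>
    ENNReal.ofReal (k + ‖Φ (β τ) x - Φ (α τ) x‖ / (β τ - α τ)) with hρ
  have hρm : Measurable (Function.uncurry ρ) := by
    have h1 : Measurable fun z : X × ℝ => Φ (β z.2) z.1 :=
      hΦm.comp ((hβm.comp measurable_snd).prodMk measurable_fst)
    have h2 : Measurable fun z : X × ℝ => Φ (α z.2) z.1 :=
      hΦm.comp ((hαm.comp measurable_snd).prodMk measurable_fst)
    exact (measurable_const.add ((h1.sub h2).norm.div
      ((hβm.comp measurable_snd).sub (hαm.comp measurable_snd)))).ennreal_ofReal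
  have hgapτ : ∀ τ ∈ Set.Ioc s t, α τ ≤ β τ ∧ ∀ q ∈ Set.Ioo (α τ) (β τ), q ∉ K := by
    intro τ hτ
    have h1 : max s τ = τ := max_eq_right hτ.1.le
    have h2 : min t τ = τ := min_eq_right hτ.2
    have hg1 := hαg τ
    have hg2 := hβg τ
    rw [h1] at hg1
    rw [h2] at hg2
    refine ⟨le_trans hg1.1.2 hg2.1.2, fun q hq hqK => ?_⟩
    rcases le_total q τ with h | h
    · exact absurd (hg1.2 ⟨hqK, h⟩) (not_le.2 hq.1)
    · exact absurd (hg2.2 ⟨hqK, h⟩) (not_le.2 hq.2)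
  have hpt : ∀ x, ENNReal.ofReal ‖Φ t x - Φ s x‖ ≤ ∫⁻ τ in Set.Ioc s t, ρ x τ := by
    intro x
    refine ofReal_norm_sub_le_lintegral (g := fun τ => Φ τ x) (g' := fun τ => Φ' τ x)
      (k := k) hK hsK htK hKst (fun τ _ => hd τ x) (fun τ hτ => hk τ hτ x) ?_ ?_
    · intro τ
      have hαβ : α τ ≤ β τ := by
        rcases le_total s τ with h1 | h1
        · rcases le_total τ t with h2 | h2
          · exact ((hαg τ).1.2.trans_eq (max_eq_right h1)).trans
              ((min_eq_right h2).symm.trans_le (hβg τ).1.2)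
          · exact (hKst (hαg τ).1.1).2.trans ((min_eq_left h2).symm.trans_le (hβg τ).1.2)
        · exact ((hαg τ).1.2.trans_eq (max_eq_left h1)).trans (hKst (hβg τ).1.1).1
      exact ENNReal.ofReal_le_ofReal
        (le_add_of_nonneg_right (div_nonneg (norm_nonneg _) (sub_nonneg.2 hαβ)))
    · intro c hc b hb hcb hgap τ hτ
      have hα' : α τ = c := by
        refine (hαg τ).unique ⟨⟨hc, le_max_of_le_right hτ.1.le⟩, fun q hq => ?_⟩
        have hqτ : q ≤ τ := by
          have := hq.2
          rwa [Set.mem_Iic, max_eq_right ((hKst hc).1.trans hτ.1.le)] at this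
        by_contra hcq
        exact hgap q ⟨not_le.1 hcq, hqτ.trans_lt hτ.2⟩ hq.1
      have hβ' : β τ = b := by
        refine (hβg τ).unique ⟨⟨hb, min_le_of_right_le hτ.2.le⟩, fun q hq => ?_⟩
        have hqτ : τ ≤ q := by
          have := hq.2
          rwa [Set.mem_Ici, min_eq_right (hτ.2.le.trans (hKst hb).2)] at this
        by_contra hcq
        exact hgap q ⟨hτ.1.trans_le hqτ, not_le.1 hcq⟩ hq.1
      rw [hρ]
      simp only [hα', hβ']
      exact ENNReal.ofReal_le_ofReal (le_add_of_nonneg_left hk0)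
  have hslice : ∀ τ ∈ Set.Ioc s t,
      ∫⁻ x, ρ x τ ^ 2 ∂μ ≤ ENNReal.ofReal (2 * k ^ 2 + 2 * B ^ 2) := by
    intro τ hτ
    obtain ⟨h1, h2⟩ := hgapτ τ hτ
    have h3 := hgap _ (hαg τ).1.1 _ (hβg τ).1.1 h1 h2
    have hi := hintg (α τ) (β τ)
    have hle : ∀ x, ρ x τ ^ 2 ≤ ENNReal.ofReal
        (2 * k ^ 2 + 2 * ((β τ - α τ) ^ 2)⁻¹ * ‖Φ (β τ) x - Φ (α τ) x‖ ^ 2) := by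
      intro x
      have h0 : 0 ≤ ‖Φ (β τ) x - Φ (α τ) x‖ / (β τ - α τ) :=
        div_nonneg (norm_nonneg _) (by linarith)
      rw [hρ, ← ENNReal.ofReal_pow (by positivity)]
      refine ENNReal.ofReal_le_ofReal ?_
      have e : 2 * ((β τ - α τ) ^ 2)⁻¹ * ‖Φ (β τ) x - Φ (α τ) x‖ ^ 2 =
        2 * (‖Φ (β τ) x - Φ (α τ) x‖ / (β τ - α τ)) ^ 2 := by rw [div_pow]; ring
      rw [e]
      nlinarith [sq_nonneg (k - ‖Φ (β τ) x - Φ (α τ) x‖ / (β τ - α τ))]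
    refine (lintegral_mono hle).trans ?_
    have hi' : Integrable (fun x => 2 * k ^ 2 +
        2 * ((β τ - α τ) ^ 2)⁻¹ * ‖Φ (β τ) x - Φ (α τ) x‖ ^ 2) μ :=
      (integrable_const _).add (hi.const_mul _)
    rw [← ofReal_integral_eq_lintegral_ofReal hi' (Eventually.of_forall fun x => by positivity)]
    refine ENNReal.ofReal_le_ofReal ?_
    rw [integral_add (integrable_const _) (hi.const_mul _), integral_const]
    simp only [probReal_univ, one_smul]
    rw [integral_const_mul, mul_assoc]
    gcongr
    rcases eq_or_ne (β τ - α τ) 0 with h | h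
    · rw [h]; simp; positivity
    · rw [inv_mul_le_iff₀ (by positivity)]
      linarith
  have hmain : ∫⁻ x, ENNReal.ofReal (‖Φ t x - Φ s x‖ ^ 2) ∂μ ≤
      ENNReal.ofReal ((2 * k ^ 2 + 2 * B ^ 2) * (t - s) ^ 2) := by
    calc ∫⁻ x, ENNReal.ofReal (‖Φ t x - Φ s x‖ ^ 2) ∂μ
        ≤ ∫⁻ x, (ENNReal.ofReal (t - s) * ∫⁻ τ in Set.Ioc s t, ρ x τ ^ 2) ∂μ := by
          refine lintegral_mono fun x => ?_
          rw [ENNReal.ofReal_pow (norm_nonneg _)]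
          refine (pow_le_pow_left₀ (zero_le) (hpt x) 2).trans ?_
          refine (sq_lintegral_le (ρ := ρ x)
            (hρm.comp (measurable_const.prodMk measurable_id)).aemeasurable).trans_eq ?_
          rw [Measure.restrict_apply_univ, Real.volume_Ioc]
      _ = ENNReal.ofReal (t - s) * ∫⁻ τ in Set.Ioc s t, ∫⁻ x, ρ x τ ^ 2 ∂μ := by
          have hm2 : Measurable fun x => ∫⁻ τ in Set.Ioc s t, ρ x τ ^ 2 :=
            Measurable.lintegral_prod_right' (f := fun z => Function.uncurry ρ z ^ 2)
              (hρm.pow_const 2)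
          rw [lintegral_const_mul _ hm2, lintegral_lintegral_swap (f := fun x τ => ρ x τ ^ 2)
            (hρm.pow_const 2).aemeasurable]
      _ ≤ ENNReal.ofReal (t - s) * (ENNReal.ofReal (2 * k ^ 2 + 2 * B ^ 2) *
            ENNReal.ofReal (t - s)) := by
          gcongr
          rw [← Real.volume_Ioc, ← setLIntegral_const]
          exact setLIntegral_mono' measurableSet_Ioc hslice
      _ = _ := by
          rw [← ENNReal.ofReal_mul (by positivity), ← ENNReal.ofReal_mul (by linarith)]
          congr 1
          ring
  rw [← ofReal_integral_eq_lintegral_ofReal (hintg s t) (Eventually.of_forall fun x => by positivity)]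
    at hmain
  exact (ENNReal.ofReal_le_ofReal_iff (by positivity)).1 hmain

end Crossing

section LocalLipschitz

variable {n : ℕ} {U : EuclideanSpace ℝ (Fin n) → ℝ} {μ : Measure (EuclideanSpace ℝ (Fin n))}
  {lam : ℝ} {φ : ℝ → EuclideanSpace ℝ (Fin n) → ℂ} {η : EuclideanSpace ℝ (Fin n) → ℝ}

lemma IsLogFlow.tendsto_integral_mul_of_compact (hφ : IsLogFlow n U μ lam φ) {M t : ℝ}
    {S : Set ℝ} (ht : t ∈ S) (hM : ∀ s ∈ S, entAbs μ (φ s) ≤ M)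
    {p : EuclideanSpace ℝ (Fin n) → ℂ} (hp : Continuous p) (hpc : HasCompactSupport p) :
    Tendsto (fun s => ∫ x, p x * φ s x ∂μ) (𝓝[S] t) (𝓝 (∫ x, p x * φ t x ∂μ)) := by
  have := hφ.gibbs.isProbabilityMeasure
  have h0 := hφ.tendsto_sub_sq ht hM
  have hpi : Integrable (fun x => ‖p x‖ ^ 2) μ := by
    refine (hp.norm.pow 2).integrable_of_hasCompactSupport ?_
    simp only [sq]
    exact hpc.norm.mul_right
  have h := tendsto_integral_weight_mul (μ := μ) (l := 𝓝[S] t) (c := fun _ => 1)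
    (u := fun _ => p) (u₀ := p) (v := φ) (v₀ := φ t) aestronglyMeasurable_const (by simp)
    (fun _ => hp.aestronglyMeasurable) (fun s => (hφ.continuous s).aestronglyMeasurable)
    hp.aestronglyMeasurable (hφ.continuous t).aestronglyMeasurable (fun _ => hpi) hφ.mass_int hpi
    (hφ.mass_int t) (by simpa using tendsto_const_nhds) h0
  simpa using h

/-- Bounds on `L φ` on the support of a cutoff pass to limits in time. -/
lemma IsLogFlow.norm_LopC_le_of_frequently (hφ : IsLogFlow n U μ lam φ)
    (hη : Continuous η) {M t k : ℝ} {S : Set ℝ} (hS : S ∈ 𝓝 t)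
    (hM : ∀ s ∈ S, entAbs μ (φ s) ≤ M)
    (hf : ∃ᶠ s in 𝓝 t, ∀ x, η x ≠ 0 → ‖LopC n U (φ s) x‖ ≤ k)
    {x₀ : EuclideanSpace ℝ (Fin n)} (hx₀ : η x₀ ≠ 0) : ‖LopC n U (φ t) x₀‖ ≤ k := by
  have := hφ.gibbs.isProbabilityMeasure
  have := hφ.gibbs.isOpenPosMeasure
  by_contra! hk
  set G := LopC n U (φ t) with hG
  have hGc : Continuous G := continuous_LopC hφ.gibbs.smooth (hφ.smooth t)
  set c := conj (G x₀) with hc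
  have hV : {x | η x ≠ 0 ∧ k * ‖c‖ < (c * G x).re} ∈ 𝓝 x₀ := by
    refine IsOpen.mem_nhds ?_ ⟨hx₀, ?_⟩
    · exact (isOpen_ne_fun hη continuous_const).inter (isOpen_lt continuous_const
        (Complex.continuous_re.comp (continuous_const.mul hGc)))
    · rw [hc, ← Complex.normSq_eq_conj_mul_self, Complex.ofReal_re, Complex.normSq_eq_norm_sq,
        RCLike.norm_conj, sq]
      have hk0 : 0 ≤ k := by
        obtain ⟨s, hs⟩ := hf.exists
        exact (norm_nonneg _).trans (hs x₀ hx₀)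
      exact mul_lt_mul_of_pos_right hk (hk0.trans_lt hk)
  obtain ⟨ψ, hψs, hψc, hψd, hψr, hψ1⟩ := exists_contDiff_tsupport_subset (n := (⊤ : ℕ∞)) hV
  have hψ0 : ∀ x, 0 ≤ ψ x := fun x => (hψr ⟨x, rfl⟩).1
  have hψC : ContDiff ℝ ∞ fun x => (ψ x : ℂ) := hψd.ofReal_comp
  have hψCc : HasCompactSupport fun x => (ψ x : ℂ) := hψc.comp_left Complex.ofReal_zero
  have hψV : ∀ x, ψ x ≠ 0 → η x ≠ 0 ∧ k * ‖c‖ < (c * G x).re := fun x hx =>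
    hψs (subset_tsupport _ hx)
  have hψi : Integrable ψ μ := hψd.continuous.integrable_of_hasCompactSupport hψc
  have hLc : HasCompactSupport (LopC n U fun x => (ψ x : ℂ)) := by
    refine HasCompactSupport.of_support_subset_isCompact hψCc fun x hx => ?_
    by_contra hxs
    have hz : ∀ j, ∀ᶠ y in 𝓝 x, pdC n (fun x => (ψ x : ℂ)) j y = 0 := fun j => by
      have hev : ∀ᶠ y in 𝓝 x, y ∉ tsupport fun x => (ψ x : ℂ) :=
        (isClosed_tsupport _).isOpen_compl.mem_nhds hxs
      filter_upwards [hev] with y hy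
      have h := image_eq_zero_of_notMem_tsupport (f := pdC n (fun x => (ψ x : ℂ)) j) (x := y)
        fun h => hy (tsupport_fderiv_apply_subset ℝ _ h)
      exact h
    have hz2 : ∀ j, pdC n (fun y => pdC n (fun x => (ψ x : ℂ)) j y) j x = 0 := fun j => by
      have : (fun y => pdC n (fun x => (ψ x : ℂ)) j y) =ᶠ[𝓝 x] fun _ => 0 := hz j
      rw [pdC, this.fderiv_eq]
      simp
    refine hx ?_
    simp [LopC, hz2, fun j => (hz j).self_of_nhds]
  have hlim := hφ.tendsto_integral_mul_of_compact (mem_of_mem_nhds hS) hM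
    (continuous_LopC hφ.gibbs.smooth hψC) hLc
  rw [nhdsWithin_eq_nhds.2 hS] at hlim
  simp only [← hφ.gibbs.integral_LopC_comm hψC hψCc (hφ.smooth _)] at hlim
  have hle : ‖∫ x, (ψ x : ℂ) * G x ∂μ‖ ≤ k * ∫ x, ψ x ∂μ := by
    refine le_of_tendsto_of_frequently hlim.norm (hf.mono fun s hs => ?_)
    rw [← integral_const_mul]
    refine norm_integral_le_of_norm_le (hψi.const_mul k) (Eventually.of_forall fun x => ?_)
    rw [norm_mul, Complex.norm_real, Real.norm_eq_abs, abs_of_nonneg (hψ0 x), mul_comm]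
    by_cases hx : ψ x = 0
    · simp [hx]
    · exact mul_le_mul_of_nonneg_right (hs x (hψV x hx).1) (hψ0 x)
  have hrc : Continuous fun x => ψ x * ((c * G x).re - k * ‖c‖) :=
    hψd.continuous.mul ((Complex.continuous_re.comp (continuous_const.mul hGc)).sub
      continuous_const)
  have hpos : 0 < ∫ x, ψ x * ((c * G x).re - k * ‖c‖) ∂μ := by
    refine hrc.integral_pos_of_hasCompactSupport_nonneg_nonzero hψc.mul_right
      (fun x => ?_) (x := x₀) ?_
    · by_cases hx : ψ x = 0
      · simp [hx]
      · exact mul_nonneg (hψ0 x) (sub_nonneg.2 (hψV x hx).2.le)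
    · have h1 : ψ x₀ ≠ 0 := by rw [hψ1]; norm_num
      exact mul_ne_zero h1 (sub_pos.2 (hψV x₀ h1).2).ne'
  have hGi : Integrable (fun x => c * ((ψ x : ℂ) * G x)) μ :=
    ((hψC.continuous.mul hGc).integrable_of_hasCompactSupport hψCc.mul_right).const_mul c
  have he : ∫ x, ψ x * ((c * G x).re - k * ‖c‖) ∂μ =
      (c * ∫ x, (ψ x : ℂ) * G x ∂μ).re - k * ‖c‖ * ∫ x, ψ x ∂μ := by
    rw [← integral_const_mul, ← integral_const_mul]
    have h1 : (∫ x, c * ((ψ x : ℂ) * G x) ∂μ).re = ∫ x, (c * ((ψ x : ℂ) * G x)).re ∂μ :=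
      (integral_re hGi).symm
    rw [h1]
    refine Eq.trans (integral_congr_ae (Eventually.of_forall fun x => ?_))
      (integral_sub hGi.re (hψi.const_mul _))
    change _ = (c * ((ψ x : ℂ) * G x)).re - k * ‖c‖ * ψ x
    rw [mul_left_comm c, Complex.re_ofReal_mul]
    ring
  have hfin : (c * ∫ x, (ψ x : ℂ) * G x ∂μ).re ≤ ‖c‖ * (k * ∫ x, ψ x ∂μ) := by
    refine (Complex.re_le_norm _).trans ?_
    rw [norm_mul]
    gcongr
  linarith

end LocalLipschitz

section LocalLipschitzOfBound

variable {n : ℕ} {U : EuclideanSpace ℝ (Fin n) → ℝ} {μ : Measure (EuclideanSpace ℝ (Fin n))}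
  {lam : ℝ} {φ : ℝ → EuclideanSpace ℝ (Fin n) → ℂ} {η : EuclideanSpace ℝ (Fin n) → ℝ}

lemma norm_flowVel_le {u : EuclideanSpace ℝ (Fin n) → ℂ} {x : EuclideanSpace ℝ (Fin n)} {κ M : ℝ}
    (hM : |Real.log (massOf μ u)| ≤ M) (hu : ‖u x‖ ≤ κ) (hL : ‖LopC n U u x‖ ≤ κ) :
    ‖flowVel n U μ lam u x‖ ≤ κ + |lam| * (M * κ + 2 + 2 * κ ^ 2) := by
  have hM0 : 0 ≤ M := (abs_nonneg _).trans hM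
  rw [flowVel, norm_mul, Complex.norm_I, one_mul]
  refine (norm_add_le _ _).trans (add_le_add hL ?_)
  rw [norm_mul, Complex.norm_real, Real.norm_eq_abs]
  refine mul_le_mul_of_nonneg_left ((norm_sub_le _ _).trans ?_) (abs_nonneg _)
  rw [norm_mul, Complex.norm_real, Real.norm_eq_abs, add_assoc]
  refine add_le_add (mul_le_mul hM hu (norm_nonneg _) hM0) ((norm_logNL_le _).trans ?_)
  gcongr

lemma IsLogFlow.integral_cutoff_sub_sq_triangle (hφ : IsLogFlow n U μ lam φ) (hη : IsCutoff n η)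
    (s q t : ℝ) : ∫ x, (η x * ‖φ s x - φ t x‖) ^ 2 ∂μ ≤
      2 * ∫ x, (η x * ‖φ s x - φ q x‖) ^ 2 ∂μ + 2 * ∫ x, (η x * ‖φ q x - φ t x‖) ^ 2 ∂μ := by
  have := hφ.gibbs.isProbabilityMeasure
  have hi : ∀ s t, Integrable (fun x => (η x * ‖φ s x - φ t x‖) ^ 2) μ := fun s t =>
    hη.integrable_sq ((hφ.continuous s).sub (hφ.continuous t))
  rw [← integral_const_mul, ← integral_const_mul,
    ← integral_add ((hi s q).const_mul 2) ((hi q t).const_mul 2)]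
  refine integral_mono (hi s t) (((hi s q).const_mul 2).add ((hi q t).const_mul 2)) fun x => ?_
  have h := norm_sub_sq_le_two (φ s x - φ q x) (φ t x - φ q x)
  rw [sub_sub_sub_cancel_right, norm_sub_rev (φ t x)] at h
  simp only [mul_pow]
  nlinarith [sq_nonneg (η x)]

lemma IsLogFlow.integral_cutoff_sub_sq_swap (s t : ℝ) :
    ∫ x, (η x * ‖φ s x - φ t x‖) ^ 2 ∂μ = ∫ x, (η x * ‖φ t x - φ s x‖) ^ 2 ∂μ := by
  simp only [norm_sub_rev]

/-- If the flow is locally Lipschitz on the open set `G` and bounded off `G`, then it is Lipschitz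
at every point off `G`. -/
lemma IsLogFlow.integral_cutoff_sub_sq_le_of_notMem (hφ : IsLogFlow n U μ lam φ)
    (hη : IsCutoff n η) {C κ M : ℝ} (hC : ∀ j x, |pdR n η j x| ≤ C) (hC0 : 0 ≤ C) (hκ : 0 ≤ κ)
    {G : Set ℝ} (hG : IsOpen G) {c d : ℝ} (hM : ∀ s ∈ Set.Ioo c d, FlowBound n μ φ M s)
    (hl : ∀ s ∈ G, LocLip μ η φ s)
    (hb : ∀ τ ∈ Set.Ioo c d, τ ∉ G → ∀ x, η x ≠ 0 → ‖φ τ x‖ ≤ κ ∧ ‖LopC n U (φ τ) x‖ ≤ κ)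
    {t : ℝ} (ht : t ∈ Set.Ioo c d) (htG : t ∉ G) :
    ∃ A, ∀ s ∈ Set.Ioo c d, ∫ x, (η x * ‖φ s x - φ t x‖) ^ 2 ∂μ ≤ A * (s - t) ^ 2 := by
  have := hφ.gibbs.isProbabilityMeasure
  have hM0 : 0 ≤ M := (hM t ht).nonneg
  set B := gapConst n C κ M lam with hB
  set k := κ + |lam| * (M * κ + 2 + 2 * κ ^ 2) with hk
  have hk0 : 0 ≤ k := by positivity
  have hord : Set.OrdConnected (Set.Ioo c d) := Set.ordConnected_Ioo
  have hgap : ∀ q ∈ Set.Ioo c d, q ∉ G → ∀ r ∈ Set.Ioo c d, (∀ τ ∈ Set.uIoo q r, τ ∈ G) →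
      ∫ x, (η x * ‖φ r x - φ q x‖) ^ 2 ∂μ ≤ B ^ 2 * (r - q) ^ 2 := fun q hq hqG r hr hqr =>
    hφ.integral_cutoff_sub_sq_le hη hC hC0 hκ (fun s hs => hM s (hord.uIcc_subset hq hr hs))
      (hb q hq hqG) fun s hs => hl s (hqr s hs)
  have hcross : ∀ s ∈ Set.Ioo c d, s ∉ G → ∀ r ∈ Set.Ioo c d, r ∉ G → s ≤ r →
      ∫ x, (η x * ‖φ r x - φ s x‖) ^ 2 ∂μ ≤ (2 * k ^ 2 + 2 * B ^ 2) * (r - s) ^ 2 := by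
    intro s hs hsG r hr hrG hsr
    have hsub : Set.Icc s r ⊆ Set.Ioo c d := hord.out hs hr
    have e : ∀ a b x, ‖(η x : ℂ) * φ a x - (η x : ℂ) * φ b x‖ ^ 2 =
        (η x * ‖φ a x - φ b x‖) ^ 2 := fun a b x => by
      rw [← mul_sub, hη.norm_ofReal_mul]
    have h := integral_norm_sub_sq_le_of_gaps (μ := μ) (K := Set.Icc s r \ G) (s := s) (t := r)
      (k := k) (B := B) (Φ := fun s x => (η x : ℂ) * φ s x)
      (Φ' := fun s x => (η x : ℂ) * flowVel n U μ lam (φ s) x)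
      (fun a => (hη.continuous_ofReal.mul (hφ.continuous a)).measurable)
      (fun τ x => (hφ.hasDerivAt τ x).const_mul _) (isCompact_Icc.diff hG) hk0
      ⟨Set.left_mem_Icc.2 hsr, hsG⟩ ⟨Set.right_mem_Icc.2 hsr, hrG⟩ Set.sdiff_subset ?_ ?_ ?_
    · simpa only [e] using h
    · intro τ hτ x
      rw [hη.norm_ofReal_mul]
      by_cases hx : η x = 0
      · simpa [hx] using hk0
      · have hbx := hb τ (hsub hτ.1) hτ.2 x hx
        exact (mul_le_of_le_one_left (norm_nonneg _) (hη.le_one x)).trans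
          (norm_flowVel_le (hM τ (hsub hτ.1)).log_le hbx.1 hbx.2)
    · intro a b
      simp only [e]
      exact hη.integrable_sq ((hφ.continuous b).sub (hφ.continuous a))
    · intro a ha b hb hab hK
      simp only [e]
      refine hgap a (hsub ha.1) ha.2 b (hsub hb.1) fun τ hτ => ?_
      rw [Set.uIoo_of_le hab] at hτ
      by_contra hτG
      exact hK τ hτ ⟨⟨ha.1.1.trans hτ.1.le, hτ.2.le.trans hb.1.2⟩, hτG⟩
  refine ⟨2 * B ^ 2 + 2 * (2 * k ^ 2 + 2 * B ^ 2), fun s hs => ?_⟩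
  have hfin : ∀ q ∈ Set.uIcc t s, ∫ x, (η x * ‖φ s x - φ q x‖) ^ 2 ∂μ ≤ B ^ 2 * (s - q) ^ 2 →
      ∫ x, (η x * ‖φ q x - φ t x‖) ^ 2 ∂μ ≤ (2 * k ^ 2 + 2 * B ^ 2) * (q - t) ^ 2 →
      ∫ x, (η x * ‖φ s x - φ t x‖) ^ 2 ∂μ ≤
        (2 * B ^ 2 + 2 * (2 * k ^ 2 + 2 * B ^ 2)) * (s - t) ^ 2 := by
    intro q hq h1 h2
    have h3 : (s - q) ^ 2 ≤ (s - t) ^ 2 := by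
      rcases Set.mem_uIcc.1 hq with h | h <;> nlinarith
    have h4 : (q - t) ^ 2 ≤ (s - t) ^ 2 := by
      rcases Set.mem_uIcc.1 hq with h | h <;> nlinarith
    have h5 := mul_le_mul_of_nonneg_left h3 (sq_nonneg B)
    have h6 := mul_le_mul_of_nonneg_left h4 (show 0 ≤ 2 * k ^ 2 + 2 * B ^ 2 by positivity)
    have h7 := hφ.integral_cutoff_sub_sq_triangle hη s q t
    linarith
  rcases le_total t s with hts | hts
  · obtain ⟨q, hq⟩ : ∃ q, IsGreatest (Set.Icc t s \ G) q :=
      (isCompact_Icc.diff hG).exists_isGreatest ⟨t, Set.left_mem_Icc.2 hts, htG⟩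
    have hqJ : q ∈ Set.Ioo c d := hord.out ht hs hq.1.1
    refine hfin q (by rw [Set.uIcc_of_le hts]; exact hq.1.1) ?_
      (hcross t ht htG q hqJ hq.1.2 hq.1.1.1)
    refine hgap q hqJ hq.1.2 s hs fun τ hτ => ?_
    rw [Set.uIoo_of_le hq.1.1.2] at hτ
    by_contra hτG
    exact absurd (hq.2 ⟨⟨hq.1.1.1.trans hτ.1.le, hτ.2.le⟩, hτG⟩) (not_le.2 hτ.1)
  · obtain ⟨q, hq⟩ : ∃ q, IsLeast (Set.Icc s t \ G) q :=
      (isCompact_Icc.diff hG).exists_isLeast ⟨t, Set.right_mem_Icc.2 hts, htG⟩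
    have hqJ : q ∈ Set.Ioo c d := hord.out hs ht hq.1.1
    refine hfin q (by rw [Set.uIcc_of_ge hts]; exact hq.1.1) ?_ ?_
    · refine hgap q hqJ hq.1.2 s hs fun τ hτ => ?_
      rw [Set.uIoo_of_ge hq.1.1.1] at hτ
      by_contra hτG
      exact absurd (hq.2 ⟨⟨hτ.1.le, hτ.2.le.trans hq.1.1.2⟩, hτG⟩) (not_le.2 hτ.2)
    · have h := hcross q hqJ hq.1.2 t ht htG hq.1.1.2
      rw [integral_cutoff_sub_sq_swap]
      linarith [show (t - q) ^ 2 = (q - t) ^ 2 by ring]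

/-- A flow with bounded mass, energy and entropy is locally Lipschitz in weighted `L²`. -/
theorem IsLogFlow.locLip_of_flowBound (hφ : IsLogFlow n U μ lam φ) (hη : IsCutoff n η)
    {M a b : ℝ} (hM : ∀ s ∈ Set.Ioo a b, FlowBound n μ φ M s) {t : ℝ} (ht : t ∈ Set.Ioo a b) :
    LocLip μ η φ t := by
  set G : Set ℝ := {t | ∀ᶠ τ in 𝓝 t, LocLip μ η φ τ} with hGdef
  have hG : IsOpen G := isOpen_setOfPred_eventually_nhds
  have hlG : ∀ s ∈ G, LocLip μ η φ s := fun s hs => Eventually.self_of_nhds hs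
  by_contra htl
  have hne : (Set.Ioo a b \ G).Nonempty := ⟨t, ht, fun h => htl (hlG t h)⟩
  have hLC : IsLocallyClosed (Set.Ioo a b \ G) :=
    isOpen_Ioo.isLocallyClosed.inter hG.isClosed_compl.isLocallyClosed
  obtain ⟨C, hC0, hC⟩ : ∃ C, 0 ≤ C ∧ ∀ j x, |pdR n η j x| ≤ C := by
    have h : ∀ j, ∃ C, ∀ x, ‖pdR n η j x‖ ≤ C := fun j =>
      (ContDiff.continuous_pdR hη.smooth.of_smooth j).bounded_above_of_compact_support
        (hη.compact.fderiv_apply (𝕜 := ℝ) _)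
    choose C hC using h
    refine ⟨∑ j, |C j|, Finset.sum_nonneg fun j _ => abs_nonneg _, fun j x => ?_⟩
    exact (hC j x).trans ((le_abs_self _).trans (Finset.single_le_sum (f := fun j => |C j|)
      (fun j _ => abs_nonneg _) (Finset.mem_univ j)))
  obtain ⟨k, p, hp, δ, hδ, hA⟩ := hLC.exists_portion_subset hne
    (A := fun k : ℕ => {s | ∀ x, η x ≠ 0 → ‖φ s x‖ ≤ k ∧ ‖LopC n U (φ s) x‖ ≤ k}) (by
      intro k s hs hf x hx
      have hf' := hf.mono fun r hr => hr.2
      refine ⟨?_, ?_⟩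
      · exact le_of_tendsto_of_frequently (hφ.hasDerivAt s x).continuousAt.tendsto.norm
          (hf'.mono fun r hr => (hr x hx).1)
      · exact hφ.norm_LopC_le_of_frequently hη.smooth.continuous (Ioo_mem_nhds hs.1.1 hs.1.2)
          (fun r hr => (hM r hr).ent_le) (hf'.mono fun r hr y hy => (hr y hy).2) hx) (by
      intro s hs
      obtain ⟨C₁, hC₁⟩ := hη.compact.isCompact.exists_bound_of_continuousOn
        (hφ.continuous s).continuousOn
      obtain ⟨C₂, hC₂⟩ := hη.compact.isCompact.exists_bound_of_continuousOn
        (continuous_LopC hφ.gibbs.smooth (hφ.smooth s)).continuousOn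
      obtain ⟨k, hk⟩ := exists_nat_ge (max C₁ C₂)
      refine ⟨k, fun x hx => ⟨?_, ?_⟩⟩
      · exact (hC₁ x (subset_tsupport _ hx)).trans ((le_max_left _ _).trans hk)
      · exact (hC₂ x (subset_tsupport _ hx)).trans ((le_max_right _ _).trans hk))
  refine hp.2 ?_
  have hJ : Set.Ioo (max a (p - δ)) (min b (p + δ)) ∈ 𝓝 p :=
    Ioo_mem_nhds (max_lt hp.1.1 (by linarith)) (lt_min hp.1.2 (by linarith))
  have hJs : ∀ s ∈ Set.Ioo (max a (p - δ)) (min b (p + δ)), s ∈ Set.Ioo a b ∧ |s - p| < δ := by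
    intro s hs
    have h1 := max_lt_iff.1 hs.1
    have h2 := lt_min_iff.1 hs.2
    exact ⟨⟨h1.1, h2.1⟩, abs_lt.2 ⟨by linarith, by linarith⟩⟩
  filter_upwards [hJ] with s hs
  by_cases hsG : s ∈ G
  · exact hlG s hsG
  obtain ⟨A, hA'⟩ := hφ.integral_cutoff_sub_sq_le_of_notMem hη hC hC0 (Nat.cast_nonneg k) hG
    (fun r hr => hM r (hJs r hr).1) hlG
    (fun r hr hrG => hA r ⟨(hJs r hr).1, hrG⟩ (hJs r hr).2) hs hsG
  exact ⟨A, eventually_of_mem (Ioo_mem_nhds hs.1 hs.2) hA'⟩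

end LocalLipschitzOfBound

lemma im_integral {X : Type*} [MeasurableSpace X] {μ : Measure X} {f : X → ℂ}
    (hf : Integrable f μ) : (∫ x, f x ∂μ).im = ∫ x, (f x).im ∂μ :=
  (integral_im hf).symm

lemma re_integral {X : Type*} [MeasurableSpace X] {μ : Measure X} {f : X → ℂ}
    (hf : Integrable f μ) : (∫ x, f x ∂μ).re = ∫ x, (f x).re ∂μ :=
  (integral_re hf).symm

section Profile

variable {n : ℕ} {U : EuclideanSpace ℝ (Fin n) → ℝ} {μ : Measure (EuclideanSpace ℝ (Fin n))}
  {lam : ℝ} {φ : ℝ → EuclideanSpace ℝ (Fin n) → ℂ} {η : EuclideanSpace ℝ (Fin n) → ℝ}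

/-- A function `β` on the half-line, with derivative `β'` bounded by `K`, and
`0 ≤ v β''(v) ≤ θ`. -/
structure IsProfile (β β' : ℝ → ℝ) (K θ : ℝ) : Prop where
  hasDerivAt : ∀ v, 0 ≤ v → HasDerivAt β (β' v) v
  contDiffAt : ∀ v, 0 ≤ v → ContDiffAt ℝ 1 β' v
  bound : ∀ v, 0 ≤ v → |β' v| ≤ K
  nonneg : ∀ v, 0 ≤ v → 0 ≤ deriv β' v
  mul_le : ∀ v, 0 ≤ v → v * deriv β' v ≤ θ

variable {β β' : ℝ → ℝ} {K θ : ℝ}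

lemma IsProfile.const_nonneg (h : IsProfile β β' K θ) : 0 ≤ K :=
  (abs_nonneg _).trans (h.bound 0 le_rfl)

lemma IsProfile.abs_sub_le (h : IsProfile β β' K θ) {v w : ℝ} (hv : 0 ≤ v) (hw : 0 ≤ w) :
    |β v - β w| ≤ K * |v - w| :=
  (convex_Ici (0 : ℝ)).norm_image_sub_le_of_norm_hasDerivWithin_le
    (fun x hx => (h.hasDerivAt x hx).hasDerivWithinAt) (fun x hx => h.bound x hx) hw hv

lemma IsProfile.contDiff_comp (h : IsProfile β β' K θ) {u : EuclideanSpace ℝ (Fin n) → ℂ}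
    (hu : ContDiff ℝ ∞ u) : ContDiff ℝ 1 fun x => β' (‖u x‖ ^ 2) :=
  contDiff_iff_contDiffAt.2 fun x => ContDiffAt.comp (f := fun x => ‖u x‖ ^ 2) x
    (h.contDiffAt _ (sq_nonneg _)) (hu.of_smooth.norm_sq ℝ).contDiffAt

lemma IsProfile.continuous_comp (h : IsProfile β β' K θ) {u : EuclideanSpace ℝ (Fin n) → ℂ}
    (hu : Continuous u) : Continuous fun x => β (‖u x‖ ^ 2) :=
  continuous_iff_continuousAt.2 fun _ => ContinuousAt.comp (f := fun x => ‖u x‖ ^ 2)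
    (h.hasDerivAt _ (sq_nonneg _)).continuousAt (hu.norm.pow 2).continuousAt

lemma IsProfile.pdR_comp (h : IsProfile β β' K θ) {u : EuclideanSpace ℝ (Fin n) → ℂ}
    (hu : ContDiff ℝ ∞ u) (j : Fin n) (x : EuclideanSpace ℝ (Fin n)) :
    pdR n (fun x => β' (‖u x‖ ^ 2)) j x =
      deriv β' (‖u x‖ ^ 2) * (2 * (conj (u x) * pdC n u j x).re) := by
  have h1 := ((hu.of_smooth.differentiable (by simp)) x).hasFDerivAt.norm_sq
  have h2 := ((h.contDiffAt (‖u x‖ ^ 2) (sq_nonneg _)).differentiableAt (by simp)).hasDerivAt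
  have h3 := h2.comp_hasFDerivAt x h1
  have h4 : HasFDerivAt (fun x => β' (‖u x‖ ^ 2)) _ x := h3
  rw [pdR, h4.fderiv]
  simp only [pdC, _root_.smul_apply, ContinuousLinearMap.comp_apply,
    innerSL_apply_apply, Complex.inner, smul_eq_mul, nsmul_eq_mul, Nat.cast_ofNat]
  ring_nf

lemma norm_sq_sub_norm_sq_le (z w : ℂ) :
    |‖z‖ ^ 2 - ‖w‖ ^ 2| ≤ 2 * (‖w‖ * ‖z - w‖) + ‖z - w‖ ^ 2 := by
  have h := abs_norm_sub_norm_le z w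
  rw [abs_le] at h
  have h1 := norm_nonneg z
  have h2 := norm_nonneg w
  have h3 := norm_nonneg (z - w)
  rw [abs_le]
  constructor <;> nlinarith

lemma IsLogFlow.integral_norm_mul_pd_le (hφ : IsLogFlow n U μ lam φ) {M s t : ℝ}
    (hs : massOf μ (φ s) ≤ M) (ht : gradE n μ (φ t) ≤ M) (j : Fin n) :
    ∫ x, ‖φ s x‖ * ‖pdC n (φ t) j x‖ ∂μ ≤ M := by
  have hM : 0 ≤ M := le_trans (integral_nonneg fun x => by positivity) hs
  refine (integral_norm_mul_norm_le (hφ.continuous s).aestronglyMeasurable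
    (hφ.continuous_pd t j).aestronglyMeasurable (hφ.mass_int s) (hφ.pd_int t j)).trans ?_
  calc _ ≤ √M * √M := by
        gcongr
        · exact hs
        · exact (hφ.integral_pd_le t j).trans ht
    _ = M := Real.mul_self_sqrt hM

lemma IsLogFlow.integrable_norm_mul_pd (hφ : IsLogFlow n U μ lam φ) (s t : ℝ) (j : Fin n) :
    Integrable (fun x => ‖φ s x‖ * ‖pdC n (φ t) j x‖) μ :=
  integrable_norm_mul_norm (hφ.continuous s).aestronglyMeasurable
    (hφ.continuous_pd t j).aestronglyMeasurable (hφ.mass_int s) (hφ.pd_int t j)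

lemma IsProfile.abs_im_integral_le (h : IsProfile β β' K θ) (hφ : IsLogFlow n U μ lam φ)
    (hη : IsCutoff n η) {C M : ℝ} (hC : ∀ j x, |pdR n η j x| ≤ C) (hC0 : 0 ≤ C) {t : ℝ}
    (hM : FlowBound n μ φ M t) :
    |(∫ x, (η x : ℂ) ^ 2 * ((β' (‖φ t x‖ ^ 2) : ℂ) * conj (φ t x) * LopC n U (φ t) x) ∂μ).im| ≤
      2 * C * K * n * M + θ * gradE n μ (φ t) := by
  have := hφ.gibbs.isProbabilityMeasure
  have hK := h.const_nonneg
  have hq1 := h.contDiff_comp (hφ.smooth t)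
  have hqc := (hφ.smooth t).of_smooth.conj
  have hq : ContDiff ℝ 1 fun x => (β' (‖φ t x‖ ^ 2) : ℂ) * conj (φ t x) :=
    hq1.ofReal_comp.mul hqc
  rw [hφ.gibbs.integral_cutoff_mul_LopC hη (hφ.smooth t) hq, Complex.neg_im, abs_neg]
  have hpq : ∀ j x, pdC n (fun x => (β' (‖φ t x‖ ^ 2) : ℂ) * conj (φ t x)) j x =
      ((deriv β' (‖φ t x‖ ^ 2) * (2 * (conj (φ t x) * pdC n (φ t) j x).re) : ℝ) : ℂ) *
        conj (φ t x) + (β' (‖φ t x‖ ^ 2) : ℂ) * conj (pdC n (φ t) j x) := fun j x => by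
    rw [pdC_mul hq1.ofReal_comp hqc, pdC_ofReal hq1, h.pdR_comp (hφ.smooth t),
      pdC_conj (hφ.smooth t).of_smooth]
  have hSi : Integrable (fun x => ∑ j, (2 * (η x : ℂ) * (pdR n η j x : ℂ) *
      ((β' (‖φ t x‖ ^ 2) : ℂ) * conj (φ t x) * pdC n (φ t) j x) + (η x : ℂ) ^ 2 *
      (pdC n (fun x => (β' (‖φ t x‖ ^ 2) : ℂ) * conj (φ t x)) j x * pdC n (φ t) j x))) μ :=
    integrable_finsetSum _ fun j _ =>
      (hη.integrable_flux (hq.continuous.mul (hφ.continuous_pd t j)) j).add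
        (hη.integrable_sq_mul ((hq.continuous_pdC j).mul (hφ.continuous_pd t j)))
  rw [im_integral hSi, ← Real.norm_eq_abs]
  have hdomj : ∀ j ∈ Finset.univ, Integrable (fun x => 2 * C * K *
      (‖φ t x‖ * ‖pdC n (φ t) j x‖) + θ * ‖pdC n (φ t) j x‖ ^ 2) μ := fun j _ =>
    ((hφ.integrable_norm_mul_pd t t j).const_mul _).add ((hφ.pd_int t j).const_mul _)
  have hdom := integrable_finsetSum _ hdomj
  refine (norm_integral_le_of_norm_le hdom (Eventually.of_forall fun x => ?_)).trans ?_
  · rw [Real.norm_eq_abs, Complex.im_sum]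
    refine (Finset.abs_sum_le_sum_abs _ _).trans (Finset.sum_le_sum fun j _ => ?_)
    rw [Complex.add_im]
    refine (abs_add_le _ _).trans (add_le_add ?_ ?_)
    · refine (Complex.abs_im_le_norm _).trans ((hη.norm_flux_le hC j x _).trans ?_)
      rw [norm_mul, norm_mul, Complex.norm_real, Real.norm_eq_abs, RCLike.norm_conj]
      have h1 := h.bound _ (sq_nonneg ‖φ t x‖)
      calc _ ≤ 2 * C * (1 * (K * ‖φ t x‖ * ‖pdC n (φ t) j x‖)) := by
            gcongr
            exact hη.le_one x
        _ = _ := by ring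
    · set z := conj (φ t x) * pdC n (φ t) j x with hz
      have e : (η x : ℂ) ^ 2 * (pdC n (fun x => (β' (‖φ t x‖ ^ 2) : ℂ) * conj (φ t x)) j x *
          pdC n (φ t) j x) = ((η x ^ 2 * (deriv β' (‖φ t x‖ ^ 2) * (2 * z.re)) : ℝ) : ℂ) * z +
          ((η x ^ 2 * (β' (‖φ t x‖ ^ 2) * ‖pdC n (φ t) j x‖ ^ 2) : ℝ) : ℂ) := by
        rw [hpq]
        have h5 : conj (pdC n (φ t) j x) * pdC n (φ t) j x = ((‖pdC n (φ t) j x‖ ^ 2 : ℝ) : ℂ) := by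
          rw [← Complex.normSq_eq_norm_sq, Complex.normSq_eq_conj_mul_self]
        push_cast at h5 ⊢
        rw [← h5, hz]
        ring
      rw [e, Complex.add_im, Complex.ofReal_im, add_zero, Complex.im_ofReal_mul]
      have hzn : ‖z‖ ^ 2 = ‖φ t x‖ ^ 2 * ‖pdC n (φ t) j x‖ ^ 2 := by
        rw [hz, norm_mul, RCLike.norm_conj, mul_pow]
      have hzs : z.re * z.re + z.im * z.im = ‖z‖ ^ 2 := by
        rw [← Complex.normSq_eq_norm_sq, Complex.normSq_apply]
      have h6 : |2 * z.re * z.im| ≤ ‖z‖ ^ 2 := by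
        rw [abs_le]
        constructor <;> nlinarith [sq_nonneg (z.re + z.im), sq_nonneg (z.re - z.im)]
      have h7 := h.nonneg _ (sq_nonneg ‖φ t x‖)
      have h8 := h.mul_le _ (sq_nonneg ‖φ t x‖)
      have h9 : η x ^ 2 ≤ 1 := pow_le_one₀ (hη.nonneg x) (hη.le_one x)
      rw [show η x ^ 2 * (deriv β' (‖φ t x‖ ^ 2) * (2 * z.re)) * z.im =
        η x ^ 2 * deriv β' (‖φ t x‖ ^ 2) * (2 * z.re * z.im) by ring, abs_mul,
        abs_of_nonneg (by positivity)]
      calc _ ≤ 1 * deriv β' (‖φ t x‖ ^ 2) * ‖z‖ ^ 2 := by gcongr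
        _ = (‖φ t x‖ ^ 2 * deriv β' (‖φ t x‖ ^ 2)) * ‖pdC n (φ t) j x‖ ^ 2 := by rw [hzn]; ring
        _ ≤ _ := by gcongr
  · rw [integral_finsetSum _ hdomj]
    have hj : ∀ j, ∫ x, (2 * C * K * (‖φ t x‖ * ‖pdC n (φ t) j x‖) +
        θ * ‖pdC n (φ t) j x‖ ^ 2) ∂μ ≤ 2 * C * K * M + θ * ∫ x, ‖pdC n (φ t) j x‖ ^ 2 ∂μ := by
      intro j
      rw [integral_add ((hφ.integrable_norm_mul_pd t t j).const_mul _)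
        ((hφ.pd_int t j).const_mul _), integral_const_mul, integral_const_mul]
      gcongr
      exact hφ.integral_norm_mul_pd_le hM.mass_le hM.grad_le j
    refine (Finset.sum_le_sum fun j _ => hj j).trans_eq ?_
    rw [Finset.sum_add_distrib, ← Finset.mul_sum, ← Finset.mul_sum,
      ← integral_finsetSum _ fun j _ => hφ.pd_int t j]
    simp only [gradE, gradSqC, Finset.sum_const, Finset.card_univ, Fintype.card_fin, nsmul_eq_mul]
    ring

lemma IsProfile.hasDerivAt_integral (h : IsProfile β β' K θ) (hφ : IsLogFlow n U μ lam φ)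
    (hη : IsCutoff n η) {t : ℝ} (hl : LocLip μ η φ t) :
    HasDerivAt (fun s => ∫ x, (η x : ℂ) ^ 2 * (β (‖φ s x‖ ^ 2) : ℂ) ∂μ)
      ((-2 * (∫ x, (η x : ℂ) ^ 2 * ((β' (‖φ t x‖ ^ 2) : ℂ) * conj (φ t x) *
        LopC n U (φ t) x) ∂μ).im : ℝ) : ℂ) t := by
  have := hφ.gibbs.isProbabilityMeasure
  have hK := h.const_nonneg
  have hq1 := h.contDiff_comp (hφ.smooth t)
  have hqc := (hφ.smooth t).of_smooth.conj
  have hLc : Continuous fun x => (β' (‖φ t x‖ ^ 2) : ℂ) * conj (φ t x) * LopC n U (φ t) x :=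
    (hq1.ofReal_comp.mul hqc).continuous.mul (continuous_LopC hφ.gibbs.smooth (hφ.smooth t))
  have hLi := hη.integrable_sq_mul (μ := μ) hLc
  have hΦc : Continuous fun x => (((β' (‖φ t x‖ ^ 2) *
      (2 * (conj (φ t x) * flowVel n U μ lam (φ t) x).re) : ℝ)) : ℂ) :=
    Complex.continuous_ofReal.comp (hq1.continuous.mul (continuous_const.mul
      (Complex.continuous_re.comp (hqc.continuous.mul (hφ.continuous_vel t)))))
  have hintg : ((-2 * (∫ x, (η x : ℂ) ^ 2 * ((β' (‖φ t x‖ ^ 2) : ℂ) * conj (φ t x) *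
        LopC n U (φ t) x) ∂μ).im : ℝ) : ℂ) = ∫ x, (η x : ℂ) ^ 2 * (((β' (‖φ t x‖ ^ 2) *
      (2 * (conj (φ t x) * flowVel n U μ lam (φ t) x).re) : ℝ)) : ℂ) ∂μ := by
    rw [im_integral hLi, ← integral_const_mul, ← integral_complex_ofReal]
    refine integral_congr_ae (Eventually.of_forall fun x => ?_)
    have e : (conj (φ t x) * flowVel n U μ lam (φ t) x).re =
        -(conj (φ t x) * LopC n U (φ t) x).im := by
      rw [flowVel, logNL]
      simp only [Complex.mul_re, Complex.mul_im, Complex.add_re, Complex.add_im, Complex.sub_re,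
        Complex.sub_im, Complex.I_re, Complex.I_im, Complex.ofReal_re, Complex.ofReal_im,
        Complex.conj_re, Complex.conj_im]
      ring
    simp only [e]
    rw [mul_assoc ((β' (‖φ t x‖ ^ 2) : ℂ)), ← Complex.ofReal_pow, ← Complex.ofReal_mul,
      Complex.im_ofReal_mul, Complex.im_ofReal_mul]
    congr 1
    ring
  rw [hintg]
  obtain ⟨κ, hκ⟩ := hη.exists_bound (hφ.continuous t)
  obtain ⟨κ', hκ'⟩ := hη.exists_bound hΦc
  obtain ⟨C₁, hC₁⟩ := hl
  have hκ0 : 0 ≤ κ := (norm_nonneg _).trans (hκ 0)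
  refine hasDerivAt_integral_of_sq_control (C₀ := K * (2 * κ + 1)) (C₁ := C₁) (C₂ := κ')
    (d := fun s x => η x * ‖φ s x - φ t x‖) (by positivity) ?_ ?_ ?_ ?_ ?_ ?_ hC₁
  · exact fun s => hη.integrable_sq_mul
      (Complex.continuous_ofReal.comp (h.continuous_comp (hφ.continuous s)))
  · intro x
    have h1 := (hφ.hasDerivAt t x).norm_sq
    have h2 := (h.hasDerivAt (‖φ t x‖ ^ 2) (sq_nonneg _)).comp t h1
    have h3 := (h2.ofReal_comp).const_mul ((η x : ℂ) ^ 2)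
    simpa [Complex.inner, mul_comm] using h3
  · exact (((hη.continuous_ofReal.pow 2).mul hΦc)).aestronglyMeasurable
  · intro x
    refine le_trans ?_ (hκ' x)
    rw [pow_two, mul_assoc, hη.norm_ofReal_mul]
    exact mul_le_of_le_one_left (norm_nonneg _) (hη.le_one x)
  · intro s x
    rw [← mul_sub, ← Complex.ofReal_sub, norm_mul, norm_pow, Complex.norm_real, Complex.norm_real,
      Real.norm_eq_abs, Real.norm_eq_abs, abs_of_nonneg (hη.nonneg x)]
    have h1 := h.abs_sub_le (sq_nonneg ‖φ s x‖) (sq_nonneg ‖φ t x‖)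
    have h2 := norm_sq_sub_norm_sq_le (φ s x) (φ t x)
    have h3 := hκ x
    rw [hη.norm_ofReal_mul] at h3
    have h0 := hη.nonneg x
    have h4 : 0 ≤ η x * ‖φ s x - φ t x‖ := by positivity
    calc η x ^ 2 * |β (‖φ s x‖ ^ 2) - β (‖φ t x‖ ^ 2)|
        ≤ η x ^ 2 * (K * (2 * (‖φ t x‖ * ‖φ s x - φ t x‖) + ‖φ s x - φ t x‖ ^ 2)) := by
          gcongr
          exact h1.trans (by gcongr)
      _ = K * (2 * ((η x * ‖φ t x‖) * (η x * ‖φ s x - φ t x‖)) +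
          (η x * ‖φ s x - φ t x‖) ^ 2) := by ring
      _ ≤ K * (2 * (κ * (η x * ‖φ s x - φ t x‖)) + (η x * ‖φ s x - φ t x‖) ^ 2) := by gcongr
      _ ≤ _ := by
          rw [mul_assoc]
          gcongr
          nlinarith [mul_nonneg hκ0 (sq_nonneg (η x * ‖φ s x - φ t x‖))]
  · exact fun s => hη.integrable_sq ((hφ.continuous s).sub (hφ.continuous t))

end Profile

section EntropyProfile

/-- A profile approximating `v log v - v`. -/
def entProfile (ε v : ℝ) : ℝ :=
  (v + ε) * Real.log (v + ε) - (1 + ε * v) * Real.log (1 + ε * v) / ε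

lemma hasDerivAt_mul_log_comp {f : ℝ → ℝ} {f' v : ℝ} (hf : HasDerivAt f f' v) (h : f v ≠ 0) :
    HasDerivAt (fun v => f v * Real.log (f v)) ((Real.log (f v) + 1) * f') v :=
  (Real.hasDerivAt_mul_log h).comp v hf

lemma isProfile_entProfile {ε : ℝ} (hε : 0 < ε) (hε1 : ε ≤ 1) :
    IsProfile (entProfile ε) (fun v => Real.log (v + ε) - Real.log (1 + ε * v))
      (-Real.log ε) 1 := by
  have hp : ∀ v, 0 ≤ v → 0 < v + ε ∧ 0 < 1 + ε * v := fun v hv => ⟨by positivity, by positivity⟩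
  have hd1 : ∀ v : ℝ, HasDerivAt (fun v => v + ε) 1 v := fun v => (hasDerivAt_id v).add_const ε
  have hd2 : ∀ v : ℝ, HasDerivAt (fun v => 1 + ε * v) ε v := fun v => by
    simpa using ((hasDerivAt_id v).const_mul ε).const_add 1
  have hder : ∀ v, 0 ≤ v → deriv (fun v => Real.log (v + ε) - Real.log (1 + ε * v)) v =
      (1 - ε ^ 2) / ((v + ε) * (1 + ε * v)) := fun v hv => by
    obtain ⟨h1, h2⟩ := hp v hv
    have h3 : HasDerivAt (fun v => Real.log (v + ε) - Real.log (1 + ε * v)) _ v :=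
      ((hd1 v).log h1.ne').sub ((hd2 v).log h2.ne')
    rw [h3.deriv]
    field_simp
    ring
  have hε2 : 0 ≤ 1 - ε ^ 2 := by nlinarith
  refine ⟨fun v hv => ?_, fun v hv => ?_, fun v hv => ?_, fun v hv => ?_, fun v hv => ?_⟩
  · obtain ⟨h1, h2⟩ := hp v hv
    have h := (hasDerivAt_mul_log_comp (hd1 v) h1.ne').sub
      ((hasDerivAt_mul_log_comp (hd2 v) h2.ne').div_const ε)
    have h3 : HasDerivAt (entProfile ε) _ v := h
    exact h3.congr_deriv (by field_simp; ring)
  · obtain ⟨h1, h2⟩ := hp v hv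
    exact ((contDiffAt_id.add contDiffAt_const).log h1.ne').sub
      ((contDiffAt_const.add (contDiffAt_const.mul contDiffAt_id)).log h2.ne')
  · obtain ⟨h1, h2⟩ := hp v hv
    rw [abs_le, neg_neg]
    constructor
    · have h3 : ε * (1 + ε * v) ≤ v + ε := by nlinarith
      have h4 := Real.log_le_log (by positivity) h3
      rw [Real.log_mul hε.ne' h2.ne'] at h4
      linarith
    · have h3 : ε * (v + ε) ≤ 1 + ε * v := by nlinarith
      have h4 := Real.log_le_log (by positivity) h3
      rw [Real.log_mul hε.ne' h1.ne'] at h4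
      linarith
  · rw [hder v hv]
    obtain ⟨h1, h2⟩ := hp v hv
    positivity
  · rw [hder v hv]
    obtain ⟨h1, h2⟩ := hp v hv
    rw [← mul_div_assoc, div_le_one (by positivity)]
    nlinarith [mul_nonneg hv hv, mul_nonneg hε.le (mul_nonneg hv hv)]

lemma mul_log_one_add_le {v : ℝ} (hv : 0 ≤ v) : v * Real.log (v + 1) ≤ v * |Real.log v| + 1 := by
  rcases hv.eq_or_lt with rfl | hv
  · simp
  have h1 : Real.log (v + 1) - Real.log v ≤ 1 / v := by
    rw [← Real.log_div (by positivity) hv.ne']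
    refine (Real.log_le_sub_one_of_pos (by positivity)).trans_eq ?_
    field_simp
    ring
  have h2 : v * (Real.log (v + 1) - Real.log v) ≤ 1 := by
    calc _ ≤ v * (1 / v) := by gcongr
      _ = 1 := by field_simp
  nlinarith [le_abs_self (Real.log v)]

lemma abs_entProfile_le {ε v : ℝ} (hε : 0 < ε) (hε1 : ε ≤ 1) (hv : 0 ≤ v) :
    |entProfile ε v| ≤ 2 + v + v * |Real.log v| := by
  have h0 := mul_log_one_add_le hv
  have hl : Real.log (v + 1) ≤ v := by
    have := Real.log_le_sub_one_of_pos (show 0 < v + 1 by positivity)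
    linarith
  have hl0 : 0 ≤ Real.log (v + 1) := Real.log_nonneg (by linarith)
  have hA1 : -1 ≤ (v + ε) * Real.log (v + ε) := by
    have h := Real.one_sub_inv_le_log_of_pos (show 0 < v + ε by positivity)
    have h2 : (v + ε) * (1 - (v + ε)⁻¹) = v + ε - 1 := by field_simp
    nlinarith [mul_le_mul_of_nonneg_left h (show 0 ≤ v + ε by positivity)]
  have hA2 : (v + ε) * Real.log (v + ε) ≤ 1 + v + v * |Real.log v| := by
    have h1 : Real.log (v + ε) ≤ Real.log (v + 1) := Real.log_le_log (by positivity) (by linarith)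
    calc _ ≤ (v + ε) * Real.log (v + 1) := by gcongr
      _ ≤ (v + 1) * Real.log (v + 1) := by gcongr
      _ ≤ _ := by linarith
  have hB0 : 0 ≤ Real.log (1 + ε * v) := Real.log_nonneg (by nlinarith)
  have hB1 : 0 ≤ (1 + ε * v) * Real.log (1 + ε * v) / ε := by positivity
  have hB2 : (1 + ε * v) * Real.log (1 + ε * v) / ε ≤ 1 + v + v * |Real.log v| := by
    rw [div_le_iff₀ hε]
    have h1 : Real.log (1 + ε * v) ≤ ε * v := by
      have := Real.log_le_sub_one_of_pos (show 0 < 1 + ε * v by positivity)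
      linarith
    have h2 : Real.log (1 + ε * v) ≤ Real.log (v + 1) :=
      Real.log_le_log (by positivity) (by nlinarith)
    have h3 : ε * (v * Real.log (1 + ε * v)) ≤ ε * (v * |Real.log v| + 1) := by
      refine mul_le_mul_of_nonneg_left (le_trans ?_ h0) hε.le
      gcongr
    nlinarith
  rw [entProfile, abs_le]
  constructor <;> linarith

lemma tendsto_entProfile {v : ℝ} :
    Tendsto (fun ε => entProfile ε v) (𝓝[>] 0) (𝓝 (v * Real.log v - v)) := by
  refine Tendsto.sub ?_ ?_
  · have h : Continuous fun ε => (v + ε) * Real.log (v + ε) :=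
      Real.continuous_mul_log.comp (continuous_const.add continuous_id)
    simpa using (h.tendsto 0).mono_left nhdsWithin_le_nhds
  · have hd : HasDerivAt (fun ε => 1 + ε * v) v 0 := by
      simpa using ((hasDerivAt_id (0 : ℝ)).mul_const v).const_add 1
    have h := (hasDerivAt_mul_log_comp hd (by simp)).tendsto_slope_zero_right
    simpa [div_eq_inv_mul] using h

end EntropyProfile

section CutoffRemoval

variable {n : ℕ} {U : EuclideanSpace ℝ (Fin n) → ℝ} {μ : Measure (EuclideanSpace ℝ (Fin n))}
  {lam : ℝ} {φ : ℝ → EuclideanSpace ℝ (Fin n) → ℂ} {η : EuclideanSpace ℝ (Fin n) → ℝ}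
  {β β' : ℝ → ℝ} {K θ : ℝ}

/-- A sequence of cutoffs exhausting space, with gradients tending to zero. -/
structure IsCutoffSeq (n : ℕ) (η : ℕ → EuclideanSpace ℝ (Fin n) → ℝ) (C : ℝ) : Prop where
  nonneg : 0 ≤ C
  isCutoff : ∀ k, IsCutoff n (η k)
  bound : ∀ k j x, |pdR n (η k) j x| ≤ C / (k + 1)
  eventually_one : ∀ R : ℝ, ∀ᶠ k in atTop, ∀ x, ‖x‖ ≤ R → η k x = 1

lemma exists_isCutoffSeq (n : ℕ) : ∃ η C, IsCutoffSeq n η C := by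
  obtain ⟨η, C, h0, h1, h2, h3⟩ := exists_cutoff_seq n
  exact ⟨η, C, h0, h1, h2, h3⟩

lemma IsCutoffSeq.tendsto_integral {ηs : ℕ → EuclideanSpace ℝ (Fin n) → ℝ} {C : ℝ}
    (h : IsCutoffSeq n ηs C) {F : EuclideanSpace ℝ (Fin n) → ℂ} (hF : Integrable F μ) :
    Tendsto (fun k => ∫ x, (ηs k x : ℂ) ^ 2 * F x ∂μ) atTop (𝓝 (∫ x, F x ∂μ)) := by
  refine tendsto_integral_of_dominated_convergence (fun x => ‖F x‖) (fun k =>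
    ((h.isCutoff k).continuous_ofReal.pow 2).aestronglyMeasurable.mul hF.aestronglyMeasurable)
    hF.norm (fun k => Eventually.of_forall fun x => ?_) (Eventually.of_forall fun x => ?_)
  · rw [norm_mul]
    exact mul_le_of_le_one_left (norm_nonneg _) ((h.isCutoff k).norm_sq_le_one x)
  · refine tendsto_const_nhds.congr' ?_
    filter_upwards [h.eventually_one ‖x‖] with k hk
    simp [hk x le_rfl]

lemma IsCutoffSeq.tendsto_const {C : ℝ} (A B D : ℝ) :
    Tendsto (fun k : ℕ => A * (C / ((k : ℝ) + 1)) * B + D) atTop (𝓝 D) := by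
  have h : Tendsto (fun k : ℕ => C / ((k : ℝ) + 1)) atTop (𝓝 0) := by
    have := (tendsto_one_div_add_atTop_nhds_zero_nat (𝕜 := ℝ)).const_mul C
    simpa [div_eq_mul_inv] using this
  simpa using ((h.const_mul A).mul_const B).add_const D

lemma IsCutoffSeq.div_nonneg {ηs : ℕ → EuclideanSpace ℝ (Fin n) → ℝ} {C : ℝ}
    (h : IsCutoffSeq n ηs C) (k : ℕ) : 0 ≤ C / ((k : ℝ) + 1) :=
  _root_.div_nonneg h.nonneg (by positivity)

lemma IsLogFlow.integrable_abs_sub (hφ : IsLogFlow n U μ lam φ) (s t : ℝ) :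
    Integrable (fun x => |‖φ s x‖ ^ 2 - ‖φ t x‖ ^ 2|) μ :=
  ((hφ.mass_int s).sub (hφ.mass_int t)).abs

lemma IsLogFlow.integral_abs_sub_le (hφ : IsLogFlow n U μ lam φ) (s t : ℝ) :
    ∫ x, |‖φ s x‖ ^ 2 - ‖φ t x‖ ^ 2| ∂μ ≤
      2 * (√(massOf μ (φ t)) * √(∫ x, ‖φ s x - φ t x‖ ^ 2 ∂μ)) +
        ∫ x, ‖φ s x - φ t x‖ ^ 2 ∂μ := by
  have hd := integrable_norm_sub_sq (hφ.continuous s).aestronglyMeasurable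
    (hφ.continuous t).aestronglyMeasurable (hφ.mass_int s) (hφ.mass_int t)
  have hdm : AEStronglyMeasurable (fun x => φ s x - φ t x) μ :=
    ((hφ.continuous s).sub (hφ.continuous t)).aestronglyMeasurable
  have hp := integrable_norm_mul_norm (hφ.continuous t).aestronglyMeasurable hdm (hφ.mass_int t) hd
  refine (integral_mono (hφ.integrable_abs_sub s t) ((hp.const_mul 2).add hd) fun x =>
    norm_sq_sub_norm_sq_le _ _).trans ?_
  rw [integral_add' (hp.const_mul 2) hd, integral_const_mul]
  gcongr
  exact integral_norm_mul_norm_le (hφ.continuous t).aestronglyMeasurable hdm (hφ.mass_int t) hd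

lemma IsLogFlow.tendsto_integral_abs_sub (hφ : IsLogFlow n U μ lam φ) {M τ : ℝ} {S : Set ℝ}
    (hτ : τ ∈ S) (hM : ∀ s ∈ S, entAbs μ (φ s) ≤ M) :
    Tendsto (fun s => ∫ x, |‖φ s x‖ ^ 2 - ‖φ τ x‖ ^ 2| ∂μ) (𝓝[S] τ) (𝓝 0) := by
  have h := hφ.tendsto_sub_sq hτ hM
  refine squeeze_zero (fun s => integral_nonneg fun x => abs_nonneg _)
    (fun s => hφ.integral_abs_sub_le s τ) ?_
  simpa using ((h.sqrt.const_mul (√(massOf μ (φ τ)))).const_mul 2).add h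

lemma IsProfile.integrable_comp (h : IsProfile β β' K θ) (hφ : IsLogFlow n U μ lam φ) (t : ℝ) :
    Integrable (fun x => (β (‖φ t x‖ ^ 2) : ℂ)) μ := by
  have := hφ.gibbs.isProbabilityMeasure
  refine Integrable.mono' ((integrable_const |β 0|).add ((hφ.mass_int t).const_mul K))
    (Complex.continuous_ofReal.comp (h.continuous_comp (hφ.continuous t))).aestronglyMeasurable
    (Eventually.of_forall fun x => ?_)
  have h1 := h.abs_sub_le (sq_nonneg ‖φ t x‖) le_rfl
  rw [sub_zero, abs_of_nonneg (sq_nonneg ‖φ t x‖)] at h1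
  rw [Complex.norm_real, Real.norm_eq_abs]
  have h2 := abs_sub_abs_le_abs_sub (β (‖φ t x‖ ^ 2)) (β 0)
  simp only [Pi.add_apply]
  linarith

lemma IsProfile.norm_integral_cutoff_sub_le (h : IsProfile β β' K θ) (hφ : IsLogFlow n U μ lam φ)
    (hη : IsCutoff n η) {C M G a b : ℝ} (hC : ∀ j x, |pdR n η j x| ≤ C) (hC0 : 0 ≤ C)
    (hab : a ≤ b) (hM : ∀ s ∈ Set.Icc a b, FlowBound n μ φ M s)
    (hG : ∀ s ∈ Set.Icc a b, gradE n μ (φ s) ≤ G) :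
    ‖∫ x, (η x : ℂ) ^ 2 * (β (‖φ b x‖ ^ 2) : ℂ) ∂μ -
      ∫ x, (η x : ℂ) ^ 2 * (β (‖φ a x‖ ^ 2) : ℂ) ∂μ‖ ≤
      (4 * C * (K * n * M) + 2 * θ * G) * (b - a) := by
  have := hφ.gibbs.isProbabilityMeasure
  have hK := h.const_nonneg
  have hθ : 0 ≤ θ := by simpa using h.mul_le 0 le_rfl
  refine norm_sub_le_of_hasDerivAt_Ioo hab (f := fun s => ∫ x, (η x : ℂ) ^ 2 *
    (β (‖φ s x‖ ^ 2) : ℂ) ∂μ) ?_ fun s hs => ⟨h.hasDerivAt_integral hφ hη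
      (hφ.locLip_of_flowBound hη (fun r hr => hM r (Set.Ioo_subset_Icc_self hr)) hs), ?_⟩
  · intro τ hτ
    rw [ContinuousWithinAt, tendsto_iff_norm_sub_tendsto_zero]
    have h1 := (hφ.tendsto_integral_abs_sub hτ fun s hs => (hM s hs).ent_le).const_mul K
    rw [mul_zero] at h1
    refine squeeze_zero (fun s => norm_nonneg _) (fun s => ?_) h1
    have hi : ∀ s, Integrable (fun x => (η x : ℂ) ^ 2 * (β (‖φ s x‖ ^ 2) : ℂ)) μ := fun s =>
      hη.integrable_sq_mul (Complex.continuous_ofReal.comp (h.continuous_comp (hφ.continuous s)))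
    rw [← integral_sub (hi s) (hi τ), ← integral_const_mul]
    refine norm_integral_le_of_norm_le ((hφ.integrable_abs_sub s τ).const_mul K)
      (Eventually.of_forall fun x => ?_)
    rw [← mul_sub, norm_mul, ← Complex.ofReal_sub, Complex.norm_real, Real.norm_eq_abs]
    exact (mul_le_of_le_one_left (abs_nonneg _) (hη.norm_sq_le_one x)).trans
      (h.abs_sub_le (sq_nonneg _) (sq_nonneg _))
  · have hs' := Set.Ioo_subset_Icc_self hs
    have h1 := h.abs_im_integral_le hφ hη hC hC0 (hM s hs')
    have h2 := mul_le_mul_of_nonneg_left (hG s hs') hθ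
    rw [Complex.norm_real, Real.norm_eq_abs, abs_mul, abs_neg, abs_two]
    linarith

lemma IsProfile.abs_integral_sub_le (h : IsProfile β β' K θ) (hφ : IsLogFlow n U μ lam φ)
    {M G a b : ℝ} (hab : a ≤ b) (hM : ∀ s ∈ Set.Icc a b, FlowBound n μ φ M s)
    (hG : ∀ s ∈ Set.Icc a b, gradE n μ (φ s) ≤ G) :
    |∫ x, β (‖φ b x‖ ^ 2) ∂μ - ∫ x, β (‖φ a x‖ ^ 2) ∂μ| ≤ 2 * θ * G * (b - a) := by
  obtain ⟨ηs, C, hs⟩ := exists_isCutoffSeq n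
  have h1 := ((hs.tendsto_integral (h.integrable_comp hφ b)).sub
    (hs.tendsto_integral (h.integrable_comp hφ a))).norm
  have h2 := (IsCutoffSeq.tendsto_const (C := C) 4 (K * n * M) (2 * θ * G)).mul_const (b - a)
  have h3 := le_of_tendsto_of_tendsto' h1 h2 fun k => h.norm_integral_cutoff_sub_le hφ
    (hs.isCutoff k) (hs.bound k) (hs.div_nonneg k) hab hM hG
  rwa [integral_complex_ofReal, integral_complex_ofReal, ← Complex.ofReal_sub, Complex.norm_real,
    Real.norm_eq_abs] at h3

lemma isProfile_id : IsProfile (fun v => v) (fun _ => 1) 1 0 :=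
  ⟨fun v _ => hasDerivAt_id v, fun _ _ => contDiffAt_const, fun _ _ => by simp,
    fun _ _ => by simp, fun _ _ => by simp⟩

lemma IsLogFlow.massOf_eq (hφ : IsLogFlow n U μ lam φ) {M a b : ℝ} (hab : a ≤ b)
    (hM : ∀ s ∈ Set.Icc a b, FlowBound n μ φ M s) : massOf μ (φ b) = massOf μ (φ a) := by
  have h := isProfile_id.abs_integral_sub_le hφ hab hM fun s hs => (hM s hs).grad_le
  have h0 := abs_nonpos_iff.1 (h.trans_eq (by ring))
  exact sub_eq_zero.1 h0

lemma IsLogFlow.abs_ent0_sub_le (hφ : IsLogFlow n U μ lam φ) {M G a b : ℝ} (hab : a ≤ b)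
    (hM : ∀ s ∈ Set.Icc a b, FlowBound n μ φ M s)
    (hG : ∀ s ∈ Set.Icc a b, gradE n μ (φ s) ≤ G) :
    |ent0 μ (φ b) - ent0 μ (φ a)| ≤ 2 * G * (b - a) := by
  have := hφ.gibbs.isProbabilityMeasure
  have hei : ∀ t, Integrable (fun x => ‖φ t x‖ ^ 2 * Real.log (‖φ t x‖ ^ 2)) μ := fun t => by
    refine Integrable.mono' (hφ.ent_int t) ((Real.continuous_mul_log.comp
      ((hφ.continuous t).norm.pow 2)).aestronglyMeasurable) (Eventually.of_forall fun x => ?_)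
    simp [abs_mul]
  have hlim : ∀ t, Tendsto (fun ε => ∫ x, entProfile ε (‖φ t x‖ ^ 2) ∂μ) (𝓝[>] 0)
      (𝓝 (ent0 μ (φ t) - massOf μ (φ t))) := fun t => by
    rw [ent0, massOf, ← integral_sub (hei t) (hφ.mass_int t)]
    have hev : ∀ᶠ ε : ℝ in 𝓝[>] 0, 0 < ε ∧ ε ≤ 1 := by
      filter_upwards [Ioc_mem_nhdsGT zero_lt_one] with ε hε using hε
    refine tendsto_integral_filter_of_dominated_convergence
      (fun x => 2 + ‖φ t x‖ ^ 2 + ‖φ t x‖ ^ 2 * |Real.log (‖φ t x‖ ^ 2)|)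
      (hev.mono fun ε hε => ((isProfile_entProfile hε.1 hε.2).continuous_comp
        (hφ.continuous t)).aestronglyMeasurable)
      (hev.mono fun ε hε => Eventually.of_forall fun x =>
        abs_entProfile_le hε.1 hε.2 (sq_nonneg _))
      (((integrable_const _).add (hφ.mass_int t)).add (hφ.ent_int t))
      (Eventually.of_forall fun x => tendsto_entProfile)
  have h := ((hlim b).sub (hlim a)).abs
  have h2 := le_of_tendsto h (b := 2 * 1 * G * (b - a)) (by
    filter_upwards [Ioc_mem_nhdsGT zero_lt_one] with ε hε
    exact (isProfile_entProfile hε.1 hε.2).abs_integral_sub_le hφ hab hM hG)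
  rw [hφ.massOf_eq hab hM, sub_sub_sub_cancel_right] at h2
  linarith

end CutoffRemoval

section WeakConvergence

variable {X : Type*} [MeasurableSpace X] {μ : Measure X}

lemma norm_integral_weight_mul_sub_le {c p q : X → ℂ} (hcm : AEStronglyMeasurable c μ)
    (hc : ∀ x, ‖c x‖ ≤ 1) (hpm : AEStronglyMeasurable p μ) (hqm : AEStronglyMeasurable q μ)
    (hpi : Integrable (fun x => ‖p x‖ ^ 2) μ) (hqi : Integrable (fun x => ‖q x‖ ^ 2) μ) :
    ‖∫ x, c x * (p x * q x) ∂μ - ∫ x, p x * q x ∂μ‖ ≤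
      √(∫ x, ‖(1 - c x) * p x‖ ^ 2 ∂μ) * √(∫ x, ‖q x‖ ^ 2 ∂μ) := by
  have hdm : AEStronglyMeasurable (fun x => (1 - c x) * p x) μ :=
    (aestronglyMeasurable_const.sub hcm).mul hpm
  have hdi : Integrable (fun x => ‖(1 - c x) * p x‖ ^ 2) μ := by
    refine Integrable.mono' (hpi.const_mul 4) (hdm.norm.pow 2) (Eventually.of_forall fun x => ?_)
    have h1 : ‖1 - c x‖ ≤ 2 := (norm_sub_le _ _).trans (by rw [norm_one]; linarith [hc x])
    rw [norm_pow, norm_norm, norm_mul, mul_pow]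
    gcongr
    nlinarith [norm_nonneg (1 - c x)]
  rw [← integral_sub (integrable_weight_mul hcm hc hpm hqm hpi hqi)
    (integrable_mul_of_sq hpm hqm hpi hqi)]
  refine (norm_integral_le_of_norm_le (integrable_norm_mul_norm hdm hqm hdi hqi)
    (Eventually.of_forall fun x => ?_)).trans (integral_norm_mul_norm_le hdm hqm hdi hqi)
  rw [← norm_mul, ← norm_neg]
  refine le_of_eq (congrArg _ ?_)
  ring

/-- Weights increasing to one may be removed from weak limits, jointly with the limit. -/
lemma tendsto_integral_weight_mul_of_weak {ι : Type*} {l : Filter ι} {c : ℕ → X → ℂ}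
    {p q₀ : X → ℂ} {q : ι → X → ℂ} {M : ℝ} (hcm : ∀ k, AEStronglyMeasurable (c k) μ)
    (hc : ∀ k x, ‖c k x‖ ≤ 1) (hc1 : ∀ x, Tendsto (fun k => c k x) atTop (𝓝 1))
    (hpm : AEStronglyMeasurable p μ) (hqm : ∀ i, AEStronglyMeasurable (q i) μ)
    (hqm₀ : AEStronglyMeasurable q₀ μ) (hpi : Integrable (fun x => ‖p x‖ ^ 2) μ)
    (hqi : ∀ i, Integrable (fun x => ‖q i x‖ ^ 2) μ) (hqi₀ : Integrable (fun x => ‖q₀ x‖ ^ 2) μ)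
    (hqM : ∀ᶠ i in l, ∫ x, ‖q i x‖ ^ 2 ∂μ ≤ M) (hqM₀ : ∫ x, ‖q₀ x‖ ^ 2 ∂μ ≤ M)
    (hw : ∀ k, Tendsto (fun i => ∫ x, c k x * (p x * q i x) ∂μ) l
      (𝓝 (∫ x, c k x * (p x * q₀ x) ∂μ))) :
    Tendsto (fun z : ι × ℕ => ∫ x, c z.2 x * (p x * q z.1 x) ∂μ) (l ×ˢ atTop)
      (𝓝 (∫ x, p x * q₀ x ∂μ)) := by
  set e : ℕ → ℝ := fun k => √(∫ x, ‖(1 - c k x) * p x‖ ^ 2 ∂μ) * √M with he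
  have hel : Tendsto e atTop (𝓝 0) := by
    have h : Tendsto (fun k => ∫ x, ‖(1 - c k x) * p x‖ ^ 2 ∂μ) atTop (𝓝 (∫ _, (0 : ℝ) ∂μ)) := by
      refine tendsto_integral_of_dominated_convergence (fun x => 4 * ‖p x‖ ^ 2)
        (fun k => (((aestronglyMeasurable_const.sub (hcm k)).mul hpm).norm.pow 2))
        (hpi.const_mul 4) (fun k => Eventually.of_forall fun x => ?_)
        (Eventually.of_forall fun x => ?_)
      · have h1 : ‖1 - c k x‖ ≤ 2 := (norm_sub_le _ _).trans (by rw [norm_one]; linarith [hc k x])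
        rw [norm_pow, norm_norm, norm_mul, mul_pow]
        gcongr
        nlinarith [norm_nonneg (1 - c k x)]
      · have := (((hc1 x).const_sub 1).mul_const (p x)).norm.pow 2
        simpa using this
    have h2 := h.sqrt.mul_const (√M)
    rwa [integral_zero, Real.sqrt_zero, zero_mul] at h2
  have hle : ∀ k (r : X → ℂ), AEStronglyMeasurable r μ → Integrable (fun x => ‖r x‖ ^ 2) μ →
      ∫ x, ‖r x‖ ^ 2 ∂μ ≤ M → ‖∫ x, c k x * (p x * r x) ∂μ - ∫ x, p x * r x ∂μ‖ ≤ e k :=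
    fun k r hr1 hr2 hr3 => (norm_integral_weight_mul_sub_le (hcm k) (hc k) hpm hr1 hpi hr2).trans
      (mul_le_mul_of_nonneg_left (Real.sqrt_le_sqrt hr3) (Real.sqrt_nonneg _))
  rw [Metric.tendsto_nhds]
  intro ε hε
  have hek := hel.eventually (gt_mem_nhds (show (0 : ℝ) < ε / 4 by positivity))
  obtain ⟨k₀, hk₀⟩ := hek.exists
  have h1 := (Metric.tendsto_nhds.1 (hw k₀)) (ε / 4) (by positivity)
  filter_upwards [(h1.and hqM).prod_mk hek] with ⟨i, k⟩ ⟨⟨h2, h3⟩, h4⟩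
  have a1 := hle k (q i) (hqm i) (hqi i) h3
  have a2 := hle k₀ (q i) (hqm i) (hqi i) h3
  have a3 := hle k₀ q₀ hqm₀ hqi₀ hqM₀
  rw [dist_eq_norm] at h2 ⊢
  simp only at h4 ⊢
  set A := ∫ x, c k x * (p x * q i x) ∂μ
  set B := ∫ x, p x * q i x ∂μ
  set D := ∫ x, c k₀ x * (p x * q i x) ∂μ
  set F := ∫ x, c k₀ x * (p x * q₀ x) ∂μ
  set G := ∫ x, p x * q₀ x ∂μ
  have : A - G = (A - B) - (D - B) + (D - F) + (F - G) := by ring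
  rw [this]
  have b1 := norm_add_le ((A - B) - (D - B) + (D - F)) (F - G)
  have b2 := norm_add_le ((A - B) - (D - B)) (D - F)
  have b3 := norm_sub_le (A - B) (D - B)
  linarith

lemma MeasureTheory.Integrable.exists_integral_max_sub_le {B : X → ℝ} (hB : Integrable B μ)
    {ε : ℝ} (hε : 0 < ε) : ∃ R : ℝ, Integrable (fun x => max (B x - R) 0) μ ∧
      ∫ x, max (B x - R) 0 ∂μ ≤ ε := by
  have hb : ∀ (R : ℕ) x, ‖max (B x - R) 0‖ ≤ ‖B x‖ := fun R x => by
    have hR : (0 : ℝ) ≤ R := R.cast_nonneg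
    rw [Real.norm_eq_abs, abs_of_nonneg (le_max_right _ _), Real.norm_eq_abs]
    exact max_le (by linarith [le_abs_self (B x)]) (abs_nonneg _)
  have hm : ∀ R : ℕ, AEStronglyMeasurable (fun x => max (B x - R) 0) μ := fun R =>
    (hB.aestronglyMeasurable.sub aestronglyMeasurable_const).sup aestronglyMeasurable_const
  have h : Tendsto (fun R : ℕ => ∫ x, max (B x - R) 0 ∂μ) atTop (𝓝 (∫ _, (0 : ℝ) ∂μ)) := by
    refine tendsto_integral_of_dominated_convergence (fun x => ‖B x‖) hm hB.norm
      (fun R => Eventually.of_forall (hb R)) (Eventually.of_forall fun x => ?_)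
    refine tendsto_const_nhds.congr' ?_
    filter_upwards [eventually_ge_atTop ⌈B x⌉₊] with R hR
    rw [max_eq_right]
    linarith [Nat.ceil_le.1 hR]
  rw [integral_zero] at h
  obtain ⟨R, hR⟩ := (h.eventually (ge_mem_nhds hε)).exists
  exact ⟨R, Integrable.mono' hB.norm (hm R) (Eventually.of_forall (hb R)), hR⟩

end WeakConvergence

section Pairing

variable {n : ℕ} {U : EuclideanSpace ℝ (Fin n) → ℝ} {μ : Measure (EuclideanSpace ℝ (Fin n))}
  {lam : ℝ} {φ : ℝ → EuclideanSpace ℝ (Fin n) → ℂ} {η : EuclideanSpace ℝ (Fin n) → ℝ}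

lemma IsLogFlow.tendsto_integral_cutoff_mul_pd (hφ : IsLogFlow n U μ lam φ) (hη : IsCutoff n η)
    {M τ : ℝ} {S : Set ℝ} (hτ : τ ∈ S) (hM : ∀ s ∈ S, entAbs μ (φ s) ≤ M)
    {p : EuclideanSpace ℝ (Fin n) → ℂ} (hp : ContDiff ℝ 1 p) (j : Fin n) :
    Tendsto (fun s => ∫ x, (η x : ℂ) ^ 2 * (p x * pdC n (φ s) j x) ∂μ) (𝓝[S] τ)
      (𝓝 (∫ x, (η x : ℂ) ^ 2 * (p x * pdC n (φ τ) j x) ∂μ)) := by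
  have hP : ContDiff ℝ 1 fun x => (η x : ℂ) ^ 2 * p x := hη.sq_smooth.of_smooth.mul hp
  have hPc : HasCompactSupport fun x => (η x : ℂ) ^ 2 * p x := hη.sq_compact.mul_right
  have e : ∀ s, ∫ x, (η x : ℂ) ^ 2 * (p x * pdC n (φ s) j x) ∂μ =
      -∫ x, (pdC n (fun x => (η x : ℂ) ^ 2 * p x) j x -
        (pdR n U j x : ℂ) * ((η x : ℂ) ^ 2 * p x)) * φ s x ∂μ := fun s => by
    rw [← hφ.gibbs.integral_mul_pdC j _ _ hP (hφ.smooth s).of_smooth hPc]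
    simp only [mul_assoc]
  simp only [e]
  refine (hφ.tendsto_integral_mul_of_compact hτ hM ?_ ?_).neg
  · exact (hP.continuous_pdC j).sub ((Complex.continuous_ofReal.comp
      (hφ.gibbs.smooth.of_smooth.continuous_pdR j)).mul hP.continuous)
  · exact (hPc.pdC j).sub hPc.mul_left

lemma IsLogFlow.tendsto_integral_logNL_sub (hφ : IsLogFlow n U μ lam φ)
    {M τ : ℝ} {S : Set ℝ} (hτ : τ ∈ S) (hM : ∀ s ∈ S, entAbs μ (φ s) ≤ M) :
    Tendsto (fun s => ∫ x, ‖conj (φ τ x) * (logNL (φ s x) - logNL (φ τ x))‖ ∂μ) (𝓝[S] τ)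
      (𝓝 0) := by
  have := hφ.gibbs.isProbabilityMeasure
  have hcc : ∀ s, Continuous fun x => ‖conj (φ τ x) * (logNL (φ s x) - logNL (φ τ x))‖ :=
    fun s => ((hφ.smooth τ).of_smooth.conj.continuous.mul
      ((continuous_logNL.comp (hφ.continuous s)).sub
        (continuous_logNL.comp (hφ.continuous τ)))).norm
  refine tendsto_integral_zero_of_le_const_add
    (Eventually.of_forall fun s => (hcc s).aestronglyMeasurable)
    (Eventually.of_forall fun s x => norm_nonneg _) (fun x => ?_) fun ε hε => ?_
  · have h1 : ContinuousAt (fun s => logNL (φ s x)) τ :=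
      continuous_logNL.continuousAt.comp (hφ.hasDerivAt τ x).continuousAt
    have h2 : Tendsto (fun s => ‖conj (φ τ x) * (logNL (φ s x) - logNL (φ τ x))‖) (𝓝 τ)
        (𝓝 ‖conj (φ τ x) * (logNL (φ τ x) - logNL (φ τ x))‖) :=
      ((h1.tendsto.sub_const _).const_mul _).norm
    rw [sub_self, mul_zero, norm_zero] at h2
    exact h2.mono_left nhdsWithin_le_nhds
  · have hM0 : 0 ≤ M := le_trans (integral_nonneg fun x => by positivity) (hM τ hτ)
    set K := 1 + 2 * M / ε with hKdef
    have hK : 1 ≤ K := le_add_of_nonneg_right (by positivity)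
    have hKM : 1 / K * M ≤ ε / 2 := by
      rw [one_div_mul_eq_div, div_le_iff₀ (by linarith), hKdef]
      have : ε / 2 * (1 + 2 * M / ε) = ε / 2 + M := by field_simp
      linarith
    set B : EuclideanSpace ℝ (Fin n) → ℝ := fun x => (2 * (1 + ‖φ τ x‖ ^ 2) +
      K * (‖φ τ x‖ ^ 2 * (2 * Real.log K) + ‖φ τ x‖ ^ 2 * |Real.log (‖φ τ x‖ ^ 2)|)) +
      ‖φ τ x‖ ^ 2 * |Real.log (‖φ τ x‖ ^ 2)| with hB
    have hBi : Integrable B μ :=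
      ((((integrable_const 1).add (hφ.mass_int τ)).const_mul 2).add
        ((((hφ.mass_int τ).mul_const _).add (hφ.ent_int τ)).const_mul K)).add (hφ.ent_int τ)
    obtain ⟨R, hR1, hR2⟩ := hBi.exists_integral_max_sub_le (half_pos hε)
    refine ⟨R, fun s x => 1 / K * (‖φ s x‖ ^ 2 * |Real.log (‖φ s x‖ ^ 2)|) +
      max (B x - R) 0, ?_⟩
    filter_upwards [self_mem_nhdsWithin] with s hs
    refine ⟨((hφ.ent_int s).const_mul _).add hR1, ?_, fun x => ⟨?_, ?_⟩⟩
    · rw [integral_add ((hφ.ent_int s).const_mul _) hR1, integral_const_mul]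
      have h1 : 1 / K * entAbs μ (φ s) ≤ 1 / K * M :=
        mul_le_mul_of_nonneg_left (hM s hs) (by positivity)
      rw [entAbs] at h1
      linarith
    · have := le_max_right (B x - R) 0
      positivity
    · rw [norm_mul, RCLike.norm_conj]
      have h1 := norm_mul_logNL_le hK (φ τ x) (φ s x)
      have h2 : ‖φ τ x‖ * ‖logNL (φ τ x)‖ = ‖φ τ x‖ ^ 2 * |Real.log (‖φ τ x‖ ^ 2)| := by
        rw [norm_logNL]
        ring
      have h3 : ‖φ τ x‖ * ‖logNL (φ s x) - logNL (φ τ x)‖ ≤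
          ‖φ τ x‖ * ‖logNL (φ s x)‖ + ‖φ τ x‖ * ‖logNL (φ τ x)‖ := by
        rw [← mul_add]
        exact mul_le_mul_of_nonneg_left (norm_sub_le _ _) (norm_nonneg _)
      have h4 := le_max_left (B x - R) 0
      have h5 : 2 * ‖φ τ x‖ ≤ 2 * (1 + ‖φ τ x‖ ^ 2) := by nlinarith [sq_nonneg (‖φ τ x‖ - 1)]
      simp only [hB] at h4 ⊢
      linarith

end Pairing

section PairingDerivative

variable {n : ℕ} {U : EuclideanSpace ℝ (Fin n) → ℝ} {μ : Measure (EuclideanSpace ℝ (Fin n))}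
  {lam : ℝ} {φ : ℝ → EuclideanSpace ℝ (Fin n) → ℂ} {η : EuclideanSpace ℝ (Fin n) → ℝ}

/-- The conserved energy of the logarithmic Schrödinger equation. -/
def energyOf (n : ℕ) (μ : Measure (EuclideanSpace ℝ (Fin n))) (lam : ℝ)
    (u : EuclideanSpace ℝ (Fin n) → ℂ) : ℝ :=
  gradE n μ u + lam * (ent0 μ u - massOf μ u * Real.log (massOf μ u))

lemma IsLogFlow.massOf_const (hφ : IsLogFlow n U μ lam φ) {M a b s t : ℝ}
    (hM : ∀ r ∈ Set.Icc a b, FlowBound n μ φ M r) (hs : s ∈ Set.Icc a b) (ht : t ∈ Set.Icc a b) :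
    massOf μ (φ s) = massOf μ (φ t) := by
  rcases le_total s t with h | h
  · exact (hφ.massOf_eq h fun r hr => hM r ⟨hs.1.trans hr.1, hr.2.trans ht.2⟩).symm
  · exact hφ.massOf_eq h fun r hr => hM r ⟨ht.1.trans hr.1, hr.2.trans hs.2⟩

lemma IsLogFlow.continuous_conj (hφ : IsLogFlow n U μ lam φ) (t : ℝ) :
    Continuous fun x => conj (φ t x) :=
  (hφ.smooth t).of_smooth.conj.continuous

lemma IsLogFlow.integral_cutoff_vel_mul_conj (hφ : IsLogFlow n U μ lam φ) (hη : IsCutoff n η)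
    (s τ : ℝ) :
    ∫ x, (η x : ℂ) ^ 2 * (flowVel n U μ lam (φ s) x * conj (φ τ x)) ∂μ =
      Complex.I * (-(∑ j, ∫ x, 2 * (η x : ℂ) * (pdR n η j x : ℂ) *
          (conj (φ τ x) * pdC n (φ s) j x) ∂μ) -
        (∑ j, ∫ x, (η x : ℂ) ^ 2 * (conj (pdC n (φ τ) j x) * pdC n (φ s) j x) ∂μ) +
        lam * ((Real.log (massOf μ (φ s)) : ℂ) * (∫ x, (η x : ℂ) ^ 2 * (conj (φ τ x) * φ s x) ∂μ) -
          ∫ x, (η x : ℂ) ^ 2 * (conj (φ τ x) * logNL (φ s x)) ∂μ)) := by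
  have := hφ.gibbs.isProbabilityMeasure
  have hc := hφ.continuous_conj τ
  have i1 : Integrable (fun x => (η x : ℂ) ^ 2 * (conj (φ τ x) * LopC n U (φ s) x)) μ :=
    hη.integrable_sq_mul (hc.mul (continuous_LopC hφ.gibbs.smooth (hφ.smooth s)))
  have i2 : Integrable (fun x => (η x : ℂ) ^ 2 * (conj (φ τ x) * φ s x)) μ :=
    hη.integrable_sq_mul (hc.mul (hφ.continuous s))
  have i3 : Integrable (fun x => (η x : ℂ) ^ 2 * (conj (φ τ x) * logNL (φ s x))) μ :=
    hη.integrable_sq_mul (hc.mul (continuous_logNL.comp (hφ.continuous s)))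
  have i4 : ∀ j, Integrable (fun x => 2 * (η x : ℂ) * (pdR n η j x : ℂ) *
      (conj (φ τ x) * pdC n (φ s) j x)) μ := fun j =>
    hη.integrable_flux (hc.mul (hφ.continuous_pd s j)) j
  have i5 : ∀ j, Integrable (fun x => (η x : ℂ) ^ 2 *
      (conj (pdC n (φ τ) j x) * pdC n (φ s) j x)) μ := fun j =>
    hη.integrable_sq_mul ((Complex.continuous_conj.comp (hφ.continuous_pd τ j)).mul
      (hφ.continuous_pd s j))
  have hG := hφ.gibbs.integral_cutoff_mul_LopC hη (hφ.smooth s) (hφ.smooth τ).of_smooth.conj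
  simp only [pdC_conj (hφ.smooth τ).of_smooth] at hG
  have i6 : ∀ j ∈ Finset.univ, Integrable (fun x => 2 * (η x : ℂ) * (pdR n η j x : ℂ) *
      (conj (φ τ x) * pdC n (φ s) j x) + (η x : ℂ) ^ 2 *
      (conj (pdC n (φ τ) j x) * pdC n (φ s) j x)) μ := fun j _ => (i4 j).add (i5 j)
  have i7 : Integrable (fun x => (Real.log (massOf μ (φ s)) : ℂ) * ((η x : ℂ) ^ 2 *
      (conj (φ τ x) * φ s x)) - (η x : ℂ) ^ 2 * (conj (φ τ x) * logNL (φ s x))) μ :=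
    (i2.const_mul _).sub i3
  rw [integral_finsetSum _ i6] at hG
  simp only [integral_add (i4 _) (i5 _), Finset.sum_add_distrib, neg_add, ← sub_eq_add_neg] at hG
  rw [← hG, ← integral_const_mul, ← integral_sub (i2.const_mul _) i3, ← integral_const_mul,
    ← integral_add i1 (i7.const_mul _), ← integral_const_mul]
  refine integral_congr_ae (Eventually.of_forall fun x => ?_)
  simp only [flowVel]
  ring

lemma IsLogFlow.norm_sum_integral_flux_le (hφ : IsLogFlow n U μ lam φ) (hη : IsCutoff n η)
    {C M : ℝ} (hC : ∀ j x, |pdR n η j x| ≤ C) (hC0 : 0 ≤ C) {s τ : ℝ}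
    (hs : gradE n μ (φ s) ≤ M) (hτ : massOf μ (φ τ) ≤ M) :
    ‖∑ j, ∫ x, 2 * (η x : ℂ) * (pdR n η j x : ℂ) * (conj (φ τ x) * pdC n (φ s) j x) ∂μ‖ ≤
      2 * C * (n * M) := by
  refine (norm_sum_le_of_le _ (f := fun j => ∫ x, 2 * (η x : ℂ) * (pdR n η j x : ℂ) *
    (conj (φ τ x) * pdC n (φ s) j x) ∂μ) (n := fun _ => 2 * C * M) fun j _ => ?_).trans_eq ?_
  · refine (norm_integral_le_of_norm_le ((hφ.integrable_norm_mul_pd τ s j).const_mul (2 * C))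
      (Eventually.of_forall fun x => ?_)).trans ?_
    · refine (hη.norm_flux_le hC j x _).trans ?_
      rw [norm_mul, RCLike.norm_conj]
      exact mul_le_mul_of_nonneg_left
        (mul_le_of_le_one_left (by positivity) (hη.le_one x)) (by positivity)
    · rw [integral_const_mul]
      exact mul_le_mul_of_nonneg_left (hφ.integral_norm_mul_pd_le hτ hs j) (by positivity)
  · simp
    ring

lemma IsCutoffSeq.tendsto_sq {ηs : ℕ → EuclideanSpace ℝ (Fin n) → ℝ} {C : ℝ}
    (h : IsCutoffSeq n ηs C) (x : EuclideanSpace ℝ (Fin n)) :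
    Tendsto (fun k => (ηs k x : ℂ) ^ 2) atTop (𝓝 1) := by
  refine tendsto_const_nhds.congr' ?_
  filter_upwards [h.eventually_one ‖x‖] with k hk
  simp [hk x le_rfl]

lemma IsCutoffSeq.aestronglyMeasurable_sq {ηs : ℕ → EuclideanSpace ℝ (Fin n) → ℝ} {C : ℝ}
    (h : IsCutoffSeq n ηs C) (k : ℕ) : AEStronglyMeasurable (fun x => (ηs k x : ℂ) ^ 2) μ :=
  ((h.isCutoff k).continuous_ofReal.pow 2).aestronglyMeasurable

section Limits

variable {ηs : ℕ → EuclideanSpace ℝ (Fin n) → ℝ} {C M τ : ℝ} {S : Set ℝ}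

lemma IsLogFlow.tendsto_integral_conj_mul_pd (hφ : IsLogFlow n U μ lam φ)
    (h : IsCutoffSeq n ηs C) (hτ : τ ∈ S) (hE : ∀ s ∈ S, entAbs μ (φ s) ≤ M)
    (hg : ∀ s ∈ S, gradE n μ (φ s) ≤ M) (j : Fin n) :
    Tendsto (fun z : ℝ × ℕ => ∫ x, (ηs z.2 x : ℂ) ^ 2 *
      (conj (pdC n (φ τ) j x) * pdC n (φ z.1) j x) ∂μ) (𝓝[S] τ ×ˢ atTop)
      (𝓝 (∫ x, conj (pdC n (φ τ) j x) * pdC n (φ τ) j x ∂μ)) := by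
  refine tendsto_integral_weight_mul_of_weak (M := M) (c := fun k x => (ηs k x : ℂ) ^ 2)
    (p := fun x => conj (pdC n (φ τ) j x)) (q := fun s => pdC n (φ s) j) (q₀ := pdC n (φ τ) j)
    h.aestronglyMeasurable_sq (fun k x => (h.isCutoff k).norm_sq_le_one x) h.tendsto_sq
    (Complex.continuous_conj.comp (hφ.continuous_pd τ j)).aestronglyMeasurable
    (fun s => (hφ.continuous_pd s j).aestronglyMeasurable)
    (hφ.continuous_pd τ j).aestronglyMeasurable ?_
    (fun s => hφ.pd_int s j) (hφ.pd_int τ j) ?_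
    ((hφ.integral_pd_le τ j).trans (hg τ hτ)) fun k => ?_
  · simpa only [RCLike.norm_conj] using hφ.pd_int τ j
  · filter_upwards [self_mem_nhdsWithin] with s hs
    exact (hφ.integral_pd_le s j).trans (hg s hs)
  · exact hφ.tendsto_integral_cutoff_mul_pd (h.isCutoff k) hτ hE
      ((hφ.smooth τ).pdC_smooth j).of_smooth.conj j

lemma IsLogFlow.tendsto_integral_conj_mul (hφ : IsLogFlow n U μ lam φ)
    (h : IsCutoffSeq n ηs C) (hτ : τ ∈ S) (hE : ∀ s ∈ S, entAbs μ (φ s) ≤ M)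
    (hm : ∀ s ∈ S, massOf μ (φ s) ≤ M) :
    Tendsto (fun z : ℝ × ℕ => ∫ x, (ηs z.2 x : ℂ) ^ 2 * (conj (φ τ x) * φ z.1 x) ∂μ)
      (𝓝[S] τ ×ˢ atTop) (𝓝 (∫ x, conj (φ τ x) * φ τ x ∂μ)) := by
  refine tendsto_integral_weight_mul_of_weak (M := M) (c := fun k x => (ηs k x : ℂ) ^ 2)
    (p := fun x => conj (φ τ x)) (q := φ) (q₀ := φ τ)
    h.aestronglyMeasurable_sq (fun k x => (h.isCutoff k).norm_sq_le_one x) h.tendsto_sq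
    (hφ.continuous_conj τ).aestronglyMeasurable (fun s => (hφ.continuous s).aestronglyMeasurable)
    (hφ.continuous τ).aestronglyMeasurable ?_
    hφ.mass_int (hφ.mass_int τ) ?_ (hm τ hτ) fun k => ?_
  · simpa only [RCLike.norm_conj] using hφ.mass_int τ
  · filter_upwards [self_mem_nhdsWithin] with s hs using hm s hs
  · simp only [← mul_assoc]
    exact hφ.tendsto_integral_mul_of_compact hτ hE
      (((h.isCutoff k).continuous_ofReal.pow 2).mul (hφ.continuous_conj τ))
      (h.isCutoff k).sq_compact.mul_right

lemma IsLogFlow.integrable_conj_mul_logNL (hφ : IsLogFlow n U μ lam φ) (τ : ℝ) :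
    Integrable (fun x => conj (φ τ x) * logNL (φ τ x)) μ := by
  refine Integrable.mono' (hφ.ent_int τ) ((hφ.continuous_conj τ).mul
    (continuous_logNL.comp (hφ.continuous τ))).aestronglyMeasurable
    (Eventually.of_forall fun x => ?_)
  rw [norm_mul, RCLike.norm_conj, norm_logNL]
  apply le_of_eq
  ring

lemma IsLogFlow.integrable_conj_mul_logNL_of_ne (hφ : IsLogFlow n U μ lam φ) (s τ : ℝ) :
    Integrable (fun x => conj (φ τ x) * logNL (φ s x)) μ := by
  have := hφ.gibbs.isProbabilityMeasure
  refine Integrable.mono' (((hφ.ent_int s).const_mul (1 / 1)).add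
    (((integrable_const 1).add (hφ.mass_int τ)).add (hφ.ent_int τ)))
    ((hφ.continuous_conj τ).mul (continuous_logNL.comp (hφ.continuous s))).aestronglyMeasurable
    (Eventually.of_forall fun x => ?_)
  rw [norm_mul, RCLike.norm_conj]
  refine (norm_mul_logNL_le le_rfl (φ τ x) (φ s x)).trans ?_
  simp only [Pi.add_apply, Real.log_one]
  nlinarith [sq_nonneg (‖φ τ x‖ - 1)]

lemma IsLogFlow.tendsto_integral_conj_mul_logNL (hφ : IsLogFlow n U μ lam φ)
    (h : IsCutoffSeq n ηs C) (hτ : τ ∈ S) (hE : ∀ s ∈ S, entAbs μ (φ s) ≤ M) :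
    Tendsto (fun z : ℝ × ℕ => ∫ x, (ηs z.2 x : ℂ) ^ 2 * (conj (φ τ x) * logNL (φ z.1 x)) ∂μ)
      (𝓝[S] τ ×ˢ atTop) (𝓝 (∫ x, conj (φ τ x) * logNL (φ τ x) ∂μ)) := by
  have := hφ.gibbs.isProbabilityMeasure
  have hi : ∀ k s, Integrable (fun x => (ηs k x : ℂ) ^ 2 * (conj (φ τ x) * logNL (φ s x))) μ :=
    fun k s => (h.isCutoff k).integrable_sq_mul
      ((hφ.continuous_conj τ).mul (continuous_logNL.comp (hφ.continuous s)))
  have h1 := (h.tendsto_integral (hφ.integrable_conj_mul_logNL τ)).comp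
    (tendsto_snd (f := 𝓝[S] τ) (g := atTop))
  have h2 : Tendsto (fun z : ℝ × ℕ => ∫ x, (ηs z.2 x : ℂ) ^ 2 * (conj (φ τ x) *
      logNL (φ z.1 x)) ∂μ - ∫ x, (ηs z.2 x : ℂ) ^ 2 * (conj (φ τ x) * logNL (φ τ x)) ∂μ)
      (𝓝[S] τ ×ˢ atTop) (𝓝 0) := by
    refine squeeze_zero_norm (fun z => ?_)
      ((hφ.tendsto_integral_logNL_sub hτ hE).comp tendsto_fst)
    have hd : Integrable (fun x => conj (φ τ x) * (logNL (φ z.1 x) - logNL (φ τ x))) μ := by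
      simp only [mul_sub]
      exact (hφ.integrable_conj_mul_logNL_of_ne z.1 τ).sub (hφ.integrable_conj_mul_logNL τ)
    rw [← integral_sub (hi _ _) (hi _ _)]
    refine norm_integral_le_of_norm_le hd.norm (Eventually.of_forall fun x => ?_)
    rw [← mul_sub, ← mul_sub, norm_mul]
    exact mul_le_of_le_one_left (norm_nonneg _) ((h.isCutoff z.2).norm_sq_le_one x)
  simpa using h2.add h1

end Limits

lemma integral_conj_mul_self (u : EuclideanSpace ℝ (Fin n) → ℂ) :
    ∫ x, conj (u x) * u x ∂μ = ((∫ x, ‖u x‖ ^ 2 ∂μ : ℝ) : ℂ) := by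
  rw [← integral_complex_ofReal]
  congr 1
  ext x
  rw [← Complex.normSq_eq_conj_mul_self, Complex.normSq_eq_norm_sq]

lemma integral_conj_mul_logNL (u : EuclideanSpace ℝ (Fin n) → ℂ) :
    ∫ x, conj (u x) * logNL (u x) ∂μ = (ent0 μ u : ℂ) := by
  rw [ent0, ← integral_complex_ofReal]
  congr 1
  ext x
  rw [logNL, ← mul_assoc, ← Complex.normSq_eq_conj_mul_self, Complex.normSq_eq_norm_sq,
    Complex.ofReal_mul]

lemma IsLogFlow.sum_integral_conj_mul_pd (hφ : IsLogFlow n U μ lam φ) (τ : ℝ) :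
    ∑ j, ∫ x, conj (pdC n (φ τ) j x) * pdC n (φ τ) j x ∂μ = (gradE n μ (φ τ) : ℂ) := by
  simp only [integral_conj_mul_self, gradE, gradSqC]
  rw [integral_finsetSum _ fun j _ => hφ.pd_int τ j, Complex.ofReal_sum]

lemma IsLogFlow.tendsto_integral_vel_mul_conj (hφ : IsLogFlow n U μ lam φ)
    {ηs : ℕ → EuclideanSpace ℝ (Fin n) → ℝ} {C : ℝ} (h : IsCutoffSeq n ηs C) {M a b τ : ℝ}
    (hM : ∀ r ∈ Set.Icc a b, FlowBound n μ φ M r) (hτ : τ ∈ Set.Icc a b) :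
    Tendsto (fun z : ℝ × ℕ => ∫ x, (ηs z.2 x : ℂ) ^ 2 *
        (flowVel n U μ lam (φ z.1) x * conj (φ τ x)) ∂μ) (𝓝[Set.Icc a b] τ ×ˢ atTop)
      (𝓝 (-Complex.I * (energyOf n μ lam (φ τ) : ℂ))) := by
  have hE : ∀ s ∈ Set.Icc a b, entAbs μ (φ s) ≤ M := fun s hs => (hM s hs).ent_le
  have hev : ∀ᶠ s in 𝓝[Set.Icc a b] τ, s ∈ Set.Icc a b := self_mem_nhdsWithin
  simp only [hφ.integral_cutoff_vel_mul_conj (h.isCutoff _)]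
  have t1 : Tendsto (fun z : ℝ × ℕ => ∑ j, ∫ x, 2 * (ηs z.2 x : ℂ) * (pdR n (ηs z.2) j x : ℂ) *
      (conj (φ τ x) * pdC n (φ z.1) j x) ∂μ) (𝓝[Set.Icc a b] τ ×ˢ atTop) (𝓝 0) := by
    refine squeeze_zero_norm' (a := fun z : ℝ × ℕ => 2 * (C / ((z.2 : ℝ) + 1)) * (n * M) + 0) ?_
      ((IsCutoffSeq.tendsto_const 2 (n * M) 0).comp tendsto_snd)
    filter_upwards [tendsto_fst.eventually hev] with z hz
    rw [add_zero]
    exact hφ.norm_sum_integral_flux_le (h.isCutoff z.2) (h.bound z.2) (h.div_nonneg z.2)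
      (hM _ hz).grad_le (hM _ hτ).mass_le
  have t2 := tendsto_finsetSum Finset.univ fun j _ => hφ.tendsto_integral_conj_mul_pd h hτ hE
    (fun s hs => (hM s hs).grad_le) j
  have t3 := hφ.tendsto_integral_conj_mul h hτ hE fun s hs => (hM s hs).mass_le
  have t4 := hφ.tendsto_integral_conj_mul_logNL h hτ hE
  have t5 : Tendsto (fun z : ℝ × ℕ => (Real.log (massOf μ (φ z.1)) : ℂ))
      (𝓝[Set.Icc a b] τ ×ˢ atTop) (𝓝 (Real.log (massOf μ (φ τ)) : ℂ)) := by
    refine tendsto_const_nhds.congr' ?_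
    filter_upwards [tendsto_fst.eventually hev] with z hz
    rw [hφ.massOf_const hM hz hτ]
  have t := ((t1.neg.sub t2).add (((t5.mul t3).sub t4).const_mul (lam : ℂ))).const_mul Complex.I
  rw [hφ.sum_integral_conj_mul_pd, integral_conj_mul_self, integral_conj_mul_logNL] at t
  convert t using 2
  rw [energyOf, massOf]
  push_cast
  ring

end PairingDerivative

section Pairing

variable {n : ℕ} {U : EuclideanSpace ℝ (Fin n) → ℝ} {μ : Measure (EuclideanSpace ℝ (Fin n))}
  {lam : ℝ} {φ : ℝ → EuclideanSpace ℝ (Fin n) → ℂ} {η : EuclideanSpace ℝ (Fin n) → ℝ}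

lemma IsLogFlow.tendsto_comp_sub_sq (hφ : IsLogFlow n U μ lam φ) {M a b : ℝ}
    (hM : ∀ r ∈ Set.Icc a b, entAbs μ (φ r) ≤ M) {S : Set ℝ} {α : ℝ → ℝ}
    (hα : ContinuousOn α S) (hαS : Set.MapsTo α S (Set.Icc a b)) {r : ℝ} (hr : r ∈ S) :
    Tendsto (fun s => ∫ x, ‖φ (α s) x - φ (α r) x‖ ^ 2 ∂μ) (𝓝[S] r) (𝓝 0) :=
  (hφ.tendsto_sub_sq (hαS hr) hM).comp ((hα r hr).tendsto_nhdsWithin hαS)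

lemma IsLogFlow.continuousOn_weight_pairing (hφ : IsLogFlow n U μ lam φ) {M a b : ℝ}
    (hM : ∀ r ∈ Set.Icc a b, entAbs μ (φ r) ≤ M) {S : Set ℝ} {α β : ℝ → ℝ}
    (hα : ContinuousOn α S) (hαS : Set.MapsTo α S (Set.Icc a b))
    (hβ : ContinuousOn β S) (hβS : Set.MapsTo β S (Set.Icc a b))
    {c : EuclideanSpace ℝ (Fin n) → ℂ} (hcm : AEStronglyMeasurable c μ) (hc : ∀ x, ‖c x‖ ≤ 1) :
    ContinuousOn (fun r => ∫ x, c x * (φ (α r) x * conj (φ (β r) x)) ∂μ) S := by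
  intro r hr
  refine tendsto_integral_weight_mul (u := fun r => φ (α r)) (v := fun r x => conj (φ (β r) x))
    hcm hc (fun s => (hφ.continuous _).aestronglyMeasurable)
    (fun s => (hφ.continuous_conj _).aestronglyMeasurable) (hφ.continuous _).aestronglyMeasurable
    (hφ.continuous_conj _).aestronglyMeasurable (fun s => hφ.mass_int _) (fun s => ?_)
    (hφ.mass_int _) ?_ (hφ.tendsto_comp_sub_sq hM hα hαS hr) ?_
  · simpa only [RCLike.norm_conj] using hφ.mass_int (β s)
  · simpa only [RCLike.norm_conj] using hφ.mass_int (β r)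
  · simpa only [← map_sub, RCLike.norm_conj] using hφ.tendsto_comp_sub_sq hM hβ hβS hr

lemma IsLogFlow.integrable_mul_conj (hφ : IsLogFlow n U μ lam φ) (s t : ℝ) :
    Integrable (fun x => φ s x * conj (φ t x)) μ :=
  integrable_mul_of_sq (hφ.continuous s).aestronglyMeasurable
    (hφ.continuous_conj t).aestronglyMeasurable (hφ.mass_int s)
    (by simpa only [RCLike.norm_conj] using hφ.mass_int t)

lemma IsLogFlow.norm_cutoff_pairing_sub_le (hφ : IsLogFlow n U μ lam φ) (hη : IsCutoff n η)
    {M a b s t τ ε : ℝ} {z : ℂ} (hM : ∀ r ∈ Set.Icc a b, FlowBound n μ φ M r)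
    (has : a ≤ s) (hst : s ≤ t) (htb : t ≤ b) (hτ : τ ∈ Set.Icc a b)
    (hz : ∀ r ∈ Set.Icc s t,
      ‖∫ x, (η x : ℂ) ^ 2 * (flowVel n U μ lam (φ r) x * conj (φ τ x)) ∂μ - z‖ ≤ ε) :
    ‖∫ x, (η x : ℂ) ^ 2 * (φ t x * conj (φ τ x)) ∂μ -
      ∫ x, (η x : ℂ) ^ 2 * (φ s x * conj (φ τ x)) ∂μ - z * (t - s)‖ ≤ ε * (t - s) := by
  have := hφ.gibbs.isProbabilityMeasure
  have hsub : Set.Icc s t ⊆ Set.Icc a b := Set.Icc_subset_Icc has htb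
  have hcont := hφ.continuousOn_weight_pairing (S := Set.Icc s t) (α := id) (β := fun _ => τ)
    (c := fun x => (η x : ℂ) ^ 2) (fun r hr => (hM r hr).ent_le)
    continuousOn_id hsub continuousOn_const (fun _ _ => hτ)
    (hη.continuous_ofReal.pow 2).aestronglyMeasurable hη.norm_sq_le_one
  have key := norm_sub_le_of_hasDerivAt_Ioo (C := ε) hst
    (f := fun r => ∫ x, (η x : ℂ) ^ 2 * (φ r x * conj (φ τ x)) ∂μ - z * r)
    (f' := fun r => ∫ x, (η x : ℂ) ^ 2 * (flowVel n U μ lam (φ r) x * conj (φ τ x)) ∂μ - z)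
    (hcont.sub (continuousOn_const.mul Complex.continuous_ofReal.continuousOn)) fun r hr => by
      refine ⟨?_, hz r (Set.Ioo_subset_Icc_self hr)⟩
      have h1 := hasDerivAt_integral_cutoff_mul (μ := μ) hη (P := φ)
        (Q := fun _ x => conj (φ τ x)) (P' := flowVel n U μ lam (φ r)) (Q' := fun _ => 0) (t := r)
        hφ.continuous (fun _ => hφ.continuous_conj τ) (hφ.continuous_vel r) continuous_const
        (hφ.hasDerivAt r) (fun x => hasDerivAt_const _ _)
        (hφ.locLip_of_flowBound hη (fun q hq => hM q (hsub (Set.Ioo_subset_Icc_self hq))) hr)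
        (LocLip.const _ _)
      simp only [mul_zero, add_zero] at h1
      have h2 : HasDerivAt (fun r : ℝ => z * (r : ℂ)) z r := by
        simpa using (Complex.ofRealCLM.hasDerivAt (x := r)).const_mul z
      exact h1.sub h2
  refine le_trans (le_of_eq ?_) key
  congr 1
  ring

/-- The derivative of the pairing, in integrated form. -/
lemma IsLogFlow.norm_pairing_sub_le (hφ : IsLogFlow n U μ lam φ)
    {ηs : ℕ → EuclideanSpace ℝ (Fin n) → ℝ} {C : ℝ} (h : IsCutoffSeq n ηs C)
    {M a b s τ ε : ℝ} {z : ℂ} (hM : ∀ r ∈ Set.Icc a b, FlowBound n μ φ M r)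
    (hs : s ∈ Set.Icc a b) (hτ : τ ∈ Set.Icc a b)
    (hz : ∀ᶠ k in atTop, ∀ r ∈ Set.uIcc s τ,
      ‖∫ x, (ηs k x : ℂ) ^ 2 * (flowVel n U μ lam (φ r) x * conj (φ τ x)) ∂μ - z‖ ≤ ε) :
    ‖∫ x, φ s x * conj (φ τ x) ∂μ - massOf μ (φ τ) - z * (s - τ)‖ ≤ ε * |s - τ| := by
  have hm : ∫ x, φ τ x * conj (φ τ x) ∂μ = (massOf μ (φ τ) : ℂ) := by
    simp only [mul_comm (φ τ _)]
    exact integral_conj_mul_self _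
  have hl := (((h.tendsto_integral (hφ.integrable_mul_conj s τ)).sub
    (h.tendsto_integral (hφ.integrable_mul_conj τ τ))).sub_const (z * (s - τ))).norm
  rw [hm] at hl
  refine le_of_tendsto hl ?_
  filter_upwards [hz] with k hk
  rcases le_total s τ with hst | hst
  · rw [Set.uIcc_of_le hst] at hk
    have h1 := hφ.norm_cutoff_pairing_sub_le (h.isCutoff k) hM hs.1 hst hτ.2 hτ hk
    rw [abs_sub_comm, abs_of_nonneg (sub_nonneg.2 hst), ← norm_neg]
    refine le_trans (le_of_eq ?_) h1
    congr 1
    ring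
  · rw [Set.uIcc_of_ge hst] at hk
    rw [abs_of_nonneg (sub_nonneg.2 hst)]
    exact hφ.norm_cutoff_pairing_sub_le (h.isCutoff k) hM hτ.1 hst hs.2 hτ hk

lemma IsLogFlow.eventually_norm_pairing_sub_le (hφ : IsLogFlow n U μ lam φ) {M a b τ ε : ℝ}
    (hM : ∀ r ∈ Set.Icc a b, FlowBound n μ φ M r) (hτ : τ ∈ Set.Icc a b) (hε : 0 < ε) :
    ∀ᶠ s in 𝓝[Set.Icc a b] τ, ‖∫ x, φ s x * conj (φ τ x) ∂μ - massOf μ (φ τ) +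
      Complex.I * energyOf n μ lam (φ τ) * (s - τ)‖ ≤ ε * |s - τ| := by
  obtain ⟨ηs, C, h⟩ := exists_isCutoffSeq n
  have ht := hφ.tendsto_integral_vel_mul_conj h hM hτ
  have hev := (ht.eventually (Metric.closedBall_mem_nhds _ hε))
  obtain ⟨p, hp, q, hq, hpq⟩ := eventually_prod_iff.1 hev
  obtain ⟨δ, hδ, hδp⟩ := Metric.mem_nhdsWithin_iff.1 hp
  filter_upwards [inter_mem_nhdsWithin _ (Metric.ball_mem_nhds τ hδ)] with s hs
  have hz := hφ.norm_pairing_sub_le (z := -Complex.I * energyOf n μ lam (φ τ)) (ε := ε) h hM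
    hs.1 hτ ?_
  · refine le_trans (le_of_eq ?_) hz
    congr 1
    ring
  · filter_upwards [hq] with k hk r hr
    have hr1 : r ∈ Set.Icc a b := (Set.ordConnected_Icc.uIcc_subset hs.1 hτ) hr
    have hr2 : r ∈ Metric.ball τ δ := by
      have := Set.abs_sub_right_of_mem_uIcc hr
      rw [Metric.mem_ball, Real.dist_eq]
      have h2 := hs.2
      rw [Metric.mem_ball, Real.dist_eq] at h2
      rw [abs_sub_comm] at this h2
      exact this.trans_lt h2
    have := hpq (hδp ⟨hr2, hr1⟩) hk
    rwa [dist_eq_norm] at this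

lemma IsLogFlow.norm_integral_cutoff_vel_le (hφ : IsLogFlow n U μ lam φ) (hη : IsCutoff n η)
    {C M s τ : ℝ} (hC : ∀ j x, |pdR n η j x| ≤ C) (hC0 : 0 ≤ C)
    (hs : FlowBound n μ φ M s) (hτ : FlowBound n μ φ M τ) :
    ‖∫ x, (η x : ℂ) ^ 2 * (flowVel n U μ lam (φ s) x * conj (φ τ x)) ∂μ‖ ≤
      2 * C * (n * M) + n * M + |lam| * (M * M + (1 + 3 * M)) := by
  have := hφ.gibbs.isProbabilityMeasure
  have hM0 := hs.nonneg
  have hw : ∀ {F : EuclideanSpace ℝ (Fin n) → ℂ} {G : EuclideanSpace ℝ (Fin n) → ℝ} {B : ℝ},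
      Integrable G μ → (∀ x, ‖F x‖ ≤ G x) → ∫ x, G x ∂μ ≤ B →
      ‖∫ x, (η x : ℂ) ^ 2 * F x ∂μ‖ ≤ B := fun {F G B} hG hFG hB => by
    refine (norm_integral_le_of_norm_le hG (Eventually.of_forall fun x => ?_)).trans hB
    rw [norm_mul]
    exact (mul_le_of_le_one_left (norm_nonneg _) (hη.norm_sq_le_one x)).trans (hFG x)
  have hsq : ∀ {A B : ℝ}, A ≤ M → B ≤ M → √A * √B ≤ M := fun {A B} hA hB => by
    calc √A * √B ≤ √M * √M := by gcongr
      _ = M := Real.mul_self_sqrt hM0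
  have b1 := hφ.norm_sum_integral_flux_le hη hC hC0 hs.grad_le hτ.mass_le
  have b2 : ‖∑ j, ∫ x, (η x : ℂ) ^ 2 * (conj (pdC n (φ τ) j x) * pdC n (φ s) j x) ∂μ‖ ≤ n * M := by
    refine (norm_sum_le_of_le _ (n := fun _ => M) fun j _ => ?_).trans_eq (by simp)
    refine hw (G := fun x => ‖pdC n (φ τ) j x‖ * ‖pdC n (φ s) j x‖)
      (integrable_norm_mul_norm (hφ.continuous_pd τ j).aestronglyMeasurable
        (hφ.continuous_pd s j).aestronglyMeasurable (hφ.pd_int τ j) (hφ.pd_int s j))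
      (fun x => by rw [norm_mul, RCLike.norm_conj])
      ((integral_norm_mul_norm_le (hφ.continuous_pd τ j).aestronglyMeasurable
        (hφ.continuous_pd s j).aestronglyMeasurable (hφ.pd_int τ j) (hφ.pd_int s j)).trans ?_)
    exact hsq ((hφ.integral_pd_le τ j).trans hτ.grad_le) ((hφ.integral_pd_le s j).trans hs.grad_le)
  have b3 : ‖∫ x, (η x : ℂ) ^ 2 * (conj (φ τ x) * φ s x) ∂μ‖ ≤ M :=
    hw (G := fun x => ‖φ τ x‖ * ‖φ s x‖)
      (integrable_norm_mul_norm (hφ.continuous τ).aestronglyMeasurable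
        (hφ.continuous s).aestronglyMeasurable (hφ.mass_int τ) (hφ.mass_int s))
      (fun x => by rw [norm_mul, RCLike.norm_conj])
      ((integral_norm_mul_norm_le (hφ.continuous τ).aestronglyMeasurable
        (hφ.continuous s).aestronglyMeasurable (hφ.mass_int τ) (hφ.mass_int s)).trans
        (hsq hτ.mass_le hs.mass_le))
  have i1 : Integrable (fun x => 1 + ‖φ τ x‖ ^ 2) μ := (integrable_const 1).add (hφ.mass_int τ)
  have i2 : Integrable (fun x => ‖φ s x‖ ^ 2 * |Real.log (‖φ s x‖ ^ 2)| +
      ‖φ τ x‖ ^ 2 * |Real.log (‖φ τ x‖ ^ 2)|) μ := (hφ.ent_int s).add (hφ.ent_int τ)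
  have b4 : ‖∫ x, (η x : ℂ) ^ 2 * (conj (φ τ x) * logNL (φ s x)) ∂μ‖ ≤ 1 + 3 * M := by
    refine hw (G := fun x => (1 + ‖φ τ x‖ ^ 2) + (‖φ s x‖ ^ 2 * |Real.log (‖φ s x‖ ^ 2)| +
      ‖φ τ x‖ ^ 2 * |Real.log (‖φ τ x‖ ^ 2)|)) (i1.add i2) (fun x => ?_) ?_
    · rw [norm_mul, RCLike.norm_conj]
      refine (norm_mul_logNL_le le_rfl (φ τ x) (φ s x)).trans ?_
      rw [Real.log_one]
      nlinarith [sq_nonneg (‖φ τ x‖ - 1)]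
    · rw [integral_add i1 i2, integral_add (integrable_const 1) (hφ.mass_int τ),
        integral_add (hφ.ent_int s) (hφ.ent_int τ)]
      have h1 := hs.ent_le
      have h2 := hτ.ent_le
      have h3 := hτ.mass_le
      rw [entAbs] at h1 h2
      rw [massOf] at h3
      simp only [integral_const, probReal_univ, smul_eq_mul, mul_one]
      linarith
  rw [hφ.integral_cutoff_vel_mul_conj hη, norm_mul, Complex.norm_I, one_mul]
  refine (norm_add_le _ _).trans (add_le_add ((norm_sub_le _ _).trans (add_le_add ?_ b2)) ?_)
  · rwa [norm_neg]
  · rw [norm_mul, Complex.norm_real, Real.norm_eq_abs]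
    refine mul_le_mul_of_nonneg_left ((norm_sub_le _ _).trans (add_le_add ?_ b4)) (abs_nonneg _)
    rw [norm_mul, Complex.norm_real, Real.norm_eq_abs]
    exact mul_le_mul hs.log_le b3 (norm_nonneg _) hM0

lemma IsLogFlow.exists_norm_pairing_sub_le (hφ : IsLogFlow n U μ lam φ) {M a b : ℝ}
    (hM : ∀ r ∈ Set.Icc a b, FlowBound n μ φ M r) :
    ∃ D, ∀ s ∈ Set.Icc a b, ∀ τ ∈ Set.Icc a b,
      ‖∫ x, φ s x * conj (φ τ x) ∂μ - massOf μ (φ τ)‖ ≤ D * |s - τ| := by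
  obtain ⟨ηs, C, h⟩ := exists_isCutoffSeq n
  refine ⟨2 * C * (n * M) + n * M + |lam| * (M * M + (1 + 3 * M)), fun s hs τ hτ => ?_⟩
  have hM0 := (hM s hs).nonneg
  have hz := hφ.norm_pairing_sub_le (z := 0)
    (ε := 2 * C * (n * M) + n * M + |lam| * (M * M + (1 + 3 * M))) h hM hs hτ ?_
  · simpa using hz
  · refine Eventually.of_forall fun k r hr => ?_
    rw [sub_zero]
    refine (hφ.norm_integral_cutoff_vel_le (h.isCutoff k) (h.bound k) (h.div_nonneg k)
      (hM r (Set.ordConnected_Icc.uIcc_subset hs hτ hr)) (hM τ hτ)).trans ?_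
    have hCk : C / ((k : ℝ) + 1) ≤ C := div_le_self h.nonneg (by linarith [k.cast_nonneg (α := ℝ)])
    gcongr

lemma IsLogFlow.integral_sub_sq_eq (hφ : IsLogFlow n U μ lam φ) (s t : ℝ) :
    ∫ x, ‖φ s x - φ t x‖ ^ 2 ∂μ = massOf μ (φ s) + massOf μ (φ t) -
      2 * (∫ x, φ s x * conj (φ t x) ∂μ).re := by
  have hi := hφ.integrable_mul_conj s t
  have hr : Integrable (fun x => 2 * (φ s x * conj (φ t x)).re) μ := hi.re.const_mul 2
  have ha : Integrable (fun x => ‖φ s x‖ ^ 2 + ‖φ t x‖ ^ 2) μ :=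
    (hφ.mass_int s).add (hφ.mass_int t)
  rw [re_integral hi, massOf, massOf, ← integral_const_mul,
    ← integral_add (hφ.mass_int s) (hφ.mass_int t), ← integral_sub ha hr]
  congr 1
  ext x
  rw [re_mul_conj_eq]
  ring

lemma IsLogFlow.integral_sub_sq_le_norm (hφ : IsLogFlow n U μ lam φ) {M a b s τ : ℝ}
    (hM : ∀ r ∈ Set.Icc a b, FlowBound n μ φ M r) (hs : s ∈ Set.Icc a b) (hτ : τ ∈ Set.Icc a b)
    (c : ℝ) :
    ∫ x, ‖φ s x - φ τ x‖ ^ 2 ∂μ ≤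
      2 * ‖∫ x, φ s x * conj (φ τ x) ∂μ - massOf μ (φ τ) + Complex.I * c‖ := by
  rw [hφ.integral_sub_sq_eq, hφ.massOf_const hM hs hτ]
  have h := Complex.abs_re_le_norm
    (∫ x, φ s x * conj (φ τ x) ∂μ - massOf μ (φ τ) + Complex.I * c)
  have h2 := neg_abs_le (∫ x, φ s x * conj (φ τ x) ∂μ - massOf μ (φ τ) + Complex.I * c).re
  simp only [Complex.add_re, Complex.sub_re, Complex.ofReal_re, Complex.re_mul_ofReal,
    Complex.I_re, zero_mul, add_zero] at h h2
  linarith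

end Pairing

section EnergyConservation

variable {n : ℕ} {U : EuclideanSpace ℝ (Fin n) → ℝ} {μ : Measure (EuclideanSpace ℝ (Fin n))}
  {lam : ℝ} {φ : ℝ → EuclideanSpace ℝ (Fin n) → ℂ} {η : EuclideanSpace ℝ (Fin n) → ℝ}

lemma re_conj_mul_logNL_sub (p q : ℂ) : (conj q * logNL p - p * conj (logNL q)).re =
    (p * conj q).re * (Real.log (‖p‖ ^ 2) - Real.log (‖q‖ ^ 2)) := by
  rw [logNL, logNL]
  generalize Real.log (‖p‖ ^ 2) = A
  generalize Real.log (‖q‖ ^ 2) = B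
  simp
  ring

lemma IsLogFlow.abs_im_integral_pairing_deriv_le (hφ : IsLogFlow n U μ lam φ) (hη : IsCutoff n η)
    {C M s t : ℝ} (hC : ∀ j x, |pdR n η j x| ≤ C) (hC0 : 0 ≤ C)
    (hM : ∀ r ∈ Set.Icc s t, FlowBound n μ φ M r) (hst : s ≤ t) :
    |(∫ x, (η x : ℂ) ^ 2 * (flowVel n U μ lam (φ t) x * conj (φ s x) +
        φ t x * conj (flowVel n U μ lam (φ s) x)) ∂μ).im| ≤
      4 * C * (n * M) * (1 + |lam| * (t - s)) + 9 * |lam| * ∫ x, ‖φ t x - φ s x‖ ^ 2 ∂μ := by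
  have := hφ.gibbs.isProbabilityMeasure
  have hs : FlowBound n μ φ M s := hM s ⟨le_rfl, hst⟩
  have ht : FlowBound n μ φ M t := hM t ⟨hst, le_rfl⟩
  have hcs := hφ.continuous_conj s
  have hA : Continuous fun x => conj (φ s x) * LopC n U (φ t) x - φ t x *
      conj (LopC n U (φ s) x) :=
    (hcs.mul (continuous_LopC hφ.gibbs.smooth (hφ.smooth t))).sub ((hφ.continuous t).mul
      (Complex.continuous_conj.comp (continuous_LopC hφ.gibbs.smooth (hφ.smooth s))))
  have hB : Continuous fun x => conj (φ s x) * logNL (φ t x) - φ t x * conj (logNL (φ s x)) :=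
    (hcs.mul (continuous_logNL.comp (hφ.continuous t))).sub ((hφ.continuous t).mul
      (Complex.continuous_conj.comp (continuous_logNL.comp (hφ.continuous s))))
  have iA := hη.integrable_sq_mul (μ := μ) hA
  have iB := hη.integrable_sq_mul (μ := μ) hB
  have hsplit : ∫ x, (η x : ℂ) ^ 2 * (flowVel n U μ lam (φ t) x * conj (φ s x) +
        φ t x * conj (flowVel n U μ lam (φ s) x)) ∂μ = Complex.I *
      (∫ x, (η x : ℂ) ^ 2 * (conj (φ s x) * LopC n U (φ t) x - φ t x *
        conj (LopC n U (φ s) x)) ∂μ - lam * ∫ x, (η x : ℂ) ^ 2 *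
        (conj (φ s x) * logNL (φ t x) - φ t x * conj (logNL (φ s x))) ∂μ) := by
    rw [← integral_const_mul, ← integral_sub iA (iB.const_mul _), ← integral_const_mul]
    congr 1
    ext x
    simp only [flowVel, hφ.massOf_const hM ⟨hst, le_rfl⟩ ⟨le_rfl, hst⟩, map_mul, map_add, map_sub,
      Complex.conj_I, Complex.conj_ofReal]
    ring
  have bA : ‖∫ x, (η x : ℂ) ^ 2 * (conj (φ s x) * LopC n U (φ t) x - φ t x *
      conj (LopC n U (φ s) x)) ∂μ‖ ≤ 4 * C * (n * M) := by
    refine (hφ.gibbs.norm_integral_cutoff_LopC_antisymm_le hη hC (hφ.smooth t)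
      (hφ.smooth s)).trans ?_
    have hj : ∀ j ∈ Finset.univ, ∫ x, η x * (‖φ s x‖ * ‖pdC n (φ t) j x‖ +
        ‖φ t x‖ * ‖pdC n (φ s) j x‖) ∂μ ≤ 2 * M := fun j _ => by
      have i1 := hφ.integrable_norm_mul_pd s t j
      have i2 := hφ.integrable_norm_mul_pd t s j
      calc _ ≤ ∫ x, (‖φ s x‖ * ‖pdC n (φ t) j x‖ + ‖φ t x‖ * ‖pdC n (φ s) j x‖) ∂μ := by
            refine integral_mono_of_nonneg (Eventually.of_forall fun x => ?_) (i1.add i2)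
              (Eventually.of_forall fun x => ?_)
            · have := hη.nonneg x
              dsimp only [Pi.zero_apply]
              positivity
            · exact mul_le_of_le_one_left (by positivity) (hη.le_one x)
        _ ≤ 2 * M := by
            rw [integral_add i1 i2]
            linarith [hφ.integral_norm_mul_pd_le hs.mass_le ht.grad_le j,
              hφ.integral_norm_mul_pd_le ht.mass_le hs.grad_le j]
    calc _ ≤ 2 * C * ∑ _j : Fin n, 2 * M := by
          gcongr with j
          exact hj j (Finset.mem_univ j)
      _ = _ := by
          simp
          ring
  have hv := isProfile_id.norm_integral_cutoff_sub_le hφ hη hC hC0 hst hM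
    fun r hr => (hM r hr).grad_le
  have hvc : ∀ r, Continuous fun x => ((‖φ r x‖ ^ 2 : ℝ) : ℂ) := fun r =>
    Complex.continuous_ofReal.comp ((hφ.continuous r).norm.pow 2)
  have iv : ∀ r, Integrable (fun x => (η x : ℂ) ^ 2 * ((‖φ r x‖ ^ 2 : ℝ) : ℂ)) μ := fun r =>
    hη.integrable_sq_mul (hvc r)
  have bB : |(∫ x, (η x : ℂ) ^ 2 * (conj (φ s x) * logNL (φ t x) - φ t x *
      conj (logNL (φ s x))) ∂μ - (∫ x, (η x : ℂ) ^ 2 * ((‖φ t x‖ ^ 2 : ℝ) : ℂ) ∂μ -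
        ∫ x, (η x : ℂ) ^ 2 * ((‖φ s x‖ ^ 2 : ℝ) : ℂ) ∂μ)).re| ≤
      9 * ∫ x, ‖φ t x - φ s x‖ ^ 2 ∂μ := by
    have ivv : Integrable (fun x => (η x : ℂ) ^ 2 * ((‖φ t x‖ ^ 2 : ℝ) : ℂ) -
      (η x : ℂ) ^ 2 * ((‖φ s x‖ ^ 2 : ℝ) : ℂ)) μ := (iv t).sub (iv s)
    have hd := integrable_norm_sub_sq (hφ.continuous t).aestronglyMeasurable
      (hφ.continuous s).aestronglyMeasurable (hφ.mass_int t) (hφ.mass_int s)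
    have iBv : Integrable (fun x => (η x : ℂ) ^ 2 * (conj (φ s x) * logNL (φ t x) - φ t x *
      conj (logNL (φ s x))) - ((η x : ℂ) ^ 2 * ((‖φ t x‖ ^ 2 : ℝ) : ℂ) -
      (η x : ℂ) ^ 2 * ((‖φ s x‖ ^ 2 : ℝ) : ℂ))) μ := iB.sub ivv
    rw [← integral_sub (iv t) (iv s), ← integral_sub iB ivv, re_integral iBv,
      ← integral_const_mul, ← Real.norm_eq_abs]
    refine norm_integral_le_of_norm_le (hd.const_mul 9) (Eventually.of_forall fun x => ?_)
    have e : ((η x : ℂ) ^ 2 * (conj (φ s x) * logNL (φ t x) - φ t x * conj (logNL (φ s x))) -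
        ((η x : ℂ) ^ 2 * ((‖φ t x‖ ^ 2 : ℝ) : ℂ) - (η x : ℂ) ^ 2 * ((‖φ s x‖ ^ 2 : ℝ) : ℂ))).re =
        η x ^ 2 * ((φ t x * conj (φ s x)).re * (Real.log (‖φ t x‖ ^ 2) -
          Real.log (‖φ s x‖ ^ 2)) - (‖φ t x‖ ^ 2 - ‖φ s x‖ ^ 2)) := by
      rw [← re_conj_mul_logNL_sub, ← mul_sub, ← mul_sub, ← Complex.ofReal_pow,
        Complex.re_ofReal_mul, Complex.sub_re, ← Complex.ofReal_sub, Complex.ofReal_re]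
    rw [e, Real.norm_eq_abs, abs_mul, abs_of_nonneg (sq_nonneg _)]
    exact (mul_le_of_le_one_left (abs_nonneg _) (pow_le_one₀ (hη.nonneg x) (hη.le_one x))).trans
      (abs_re_mul_log_sub_le _ _)
  rw [hsplit, Complex.I_mul_im, Complex.sub_re, Complex.re_ofReal_mul]
  rw [Complex.sub_re] at bB
  have b1 := (Complex.abs_re_le_norm _).trans bA
  have b2 := (Complex.abs_re_le_norm _).trans hv
  have b3 := abs_le.1 bB
  have b4 := abs_le.1 b2
  refine (abs_sub _ _).trans ?_
  rw [abs_mul]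
  have b5 : |(∫ x, (η x : ℂ) ^ 2 * (conj (φ s x) * logNL (φ t x) - φ t x *
      conj (logNL (φ s x))) ∂μ).re| ≤ 9 * ∫ x, ‖φ t x - φ s x‖ ^ 2 ∂μ +
        4 * C * (n * M) * (t - s) := by
    rw [abs_le]
    constructor <;> linarith
  have b6 := mul_le_mul_of_nonneg_left b5 (abs_nonneg lam)
  linarith

/-- The squared `L²` increment of the flow over a time step `h`, stopped at time `b`. -/
def stepSq (μ : Measure (EuclideanSpace ℝ (Fin n))) (φ : ℝ → EuclideanSpace ℝ (Fin n) → ℂ)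
    (b h t : ℝ) : ℝ :=
  ∫ x, ‖φ (min (t + h) b) x - φ t x‖ ^ 2 ∂μ

lemma stepSq_nonneg (b h t : ℝ) : 0 ≤ stepSq μ φ b h t :=
  integral_nonneg fun x => by positivity

lemma IsLogFlow.continuousOn_stepSq (hφ : IsLogFlow n U μ lam φ) {M a b h : ℝ}
    (hM : ∀ r ∈ Set.Icc a b, FlowBound n μ φ M r) (h0 : 0 ≤ h) :
    ContinuousOn (stepSq μ φ b h) (Set.Icc a b) := by
  have hmap : Set.MapsTo (fun t => min (t + h) b) (Set.Icc a b) (Set.Icc a b) := fun t ht =>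
    ⟨le_min (by linarith [ht.1]) (ht.1.trans ht.2), min_le_right _ _⟩
  have h1 := hφ.continuousOn_weight_pairing (c := fun _ => 1) (fun r hr => (hM r hr).ent_le)
    (by fun_prop : ContinuousOn (fun t => min (t + h) b) (Set.Icc a b)) hmap
    continuousOn_id (Set.mapsTo_id _) aestronglyMeasurable_const (fun _ => by simp)
  simp only [one_mul, id] at h1
  have h2 : ContinuousOn (fun t => massOf μ (φ a) + massOf μ (φ a) -
      2 * (∫ x, φ (min (t + h) b) x * conj (φ t x) ∂μ).re) (Set.Icc a b) :=
    continuousOn_const.sub (continuousOn_const.mul (Complex.continuous_re.comp_continuousOn h1))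
  refine h2.congr fun t ht => ?_
  have ha : a ∈ Set.Icc a b := ⟨le_rfl, ht.1.trans ht.2⟩
  rw [stepSq, hφ.integral_sub_sq_eq, hφ.massOf_const hM (hmap ht) ha, hφ.massOf_const hM ht ha]

lemma IsLogFlow.im_cutoff_pairing_sub_le (hφ : IsLogFlow n U μ lam φ) (hη : IsCutoff n η)
    {C M a b h σ : ℝ} (hC : ∀ j x, |pdR n η j x| ≤ C) (hC0 : 0 ≤ C) (hσ : |σ| = 1)
    (hM : ∀ r ∈ Set.Icc a b, FlowBound n μ φ M r) (h0 : 0 ≤ h) (hab : a ≤ b - h) :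
    σ * (∫ x, (η x : ℂ) ^ 2 * (φ b x * conj (φ (b - h) x)) ∂μ).im -
      σ * (∫ x, (η x : ℂ) ^ 2 * (φ (a + h) x * conj (φ a x)) ∂μ).im ≤
      4 * C * ((n * M) * (1 + |lam| * h) * (b - h - a)) +
        9 * |lam| * ∫ t in a..(b - h), stepSq μ φ b h t := by
  have := hφ.gibbs.isProbabilityMeasure
  have hsub : Set.Icc a (b - h) ⊆ Set.Icc a b := Set.Icc_subset_Icc_right (by linarith)
  have hw : ContinuousOn (stepSq μ φ b h) (Set.Icc a (b - h)) :=
    (hφ.continuousOn_stepSq hM h0).mono hsub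
  have hmap : Set.MapsTo (fun t => t + h) (Set.Icc a (b - h)) (Set.Icc a b) := fun t ht =>
    ⟨by linarith [ht.1], by linarith [ht.2]⟩
  have hcont := hφ.continuousOn_weight_pairing (c := fun x => (η x : ℂ) ^ 2)
    (fun r hr => (hM r hr).ent_le)
    (by fun_prop : ContinuousOn (fun t => t + h) (Set.Icc a (b - h))) hmap
    continuousOn_id hsub (hη.continuous_ofReal.pow 2).aestronglyMeasurable hη.norm_sq_le_one
  simp only [id] at hcont
  have hshift : ∀ {t}, t ∈ Set.Ioo a (b - h) → t + h ∈ Set.Ioo a b := fun {t} ht =>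
    ⟨by linarith [ht.1], by linarith [ht.2]⟩
  have hmem : ∀ {t}, t ∈ Set.Ioo a (b - h) → t ∈ Set.Ioo a b := fun {t} ht =>
    ⟨ht.1, by linarith [ht.2]⟩
  have hMo : ∀ r ∈ Set.Ioo a b, FlowBound n μ φ M r := fun r hr =>
    hM r (Set.Ioo_subset_Icc_self hr)
  have key := intervalIntegral.sub_le_integral_of_hasDeriv_right_of_le hab
    (g := fun t => σ * (∫ x, (η x : ℂ) ^ 2 * (φ (t + h) x * conj (φ t x)) ∂μ).im)
    (g' := fun t => σ * (∫ x, (η x : ℂ) ^ 2 * (flowVel n U μ lam (φ (t + h)) x * conj (φ t x) +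
        φ (t + h) x * conj (flowVel n U μ lam (φ t) x)) ∂μ).im)
    (φ := fun t => 4 * C * (n * M) * (1 + |lam| * h) + 9 * |lam| * stepSq μ φ b h t)
    (continuousOn_const.mul (Complex.continuous_im.comp_continuousOn hcont))
    (fun t ht => by
      have h1 := hasDerivAt_integral_cutoff_mul (μ := μ) hη (P := fun s => φ (s + h))
        (Q := fun s x => conj (φ s x)) (P' := flowVel n U μ lam (φ (t + h)))
        (Q' := fun x => conj (flowVel n U μ lam (φ t) x)) (t := t)
        (fun s => hφ.continuous _) hφ.continuous_conj (hφ.continuous_vel _)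
        (Complex.continuous_conj.comp (hφ.continuous_vel t))
        (fun x => (hφ.hasDerivAt (t + h) x).comp_add_const t h)
        (fun x => (hφ.hasDerivAt t x).star)
        (hφ.locLip_of_flowBound hη hMo (hshift ht)).shift
        (hφ.locLip_of_flowBound hη hMo (hmem ht)).conj
      have h2 : HasDerivAt (fun s => (∫ x, (η x : ℂ) ^ 2 * (φ (s + h) x * conj (φ s x)) ∂μ).im) _
        t := Complex.imCLM.hasFDerivAt.comp_hasDerivAt t h1
      exact (h2.const_mul σ).hasDerivWithinAt)
    ((continuousOn_const.add (continuousOn_const.mul hw)).integrableOn_Icc)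
    (fun t ht => by
      have ht2 := hshift ht
      have h1 := hφ.abs_im_integral_pairing_deriv_le (s := t) (t := t + h) hη hC hC0
        (fun r hr => hM r ⟨ht.1.le.trans hr.1, hr.2.trans ht2.2.le⟩) (by linarith)
      rw [add_sub_cancel_left] at h1
      rw [stepSq, min_eq_left ht2.2.le]
      refine ((le_abs_self _).trans_eq ?_).trans h1
      rw [abs_mul, hσ, one_mul])
  simp only [sub_add_cancel] at key
  refine key.trans_eq ?_
  have hwi : IntervalIntegrable (stepSq μ φ b h) volume a (b - h) :=
    ContinuousOn.intervalIntegrable_of_Icc hab hw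
  rw [intervalIntegral.integral_add intervalIntegrable_const (hwi.const_mul _),
    intervalIntegral.integral_const, intervalIntegral.integral_const_mul, smul_eq_mul]
  ring

lemma IsLogFlow.abs_im_pairing_sub_le (hφ : IsLogFlow n U μ lam φ) {M a b h : ℝ}
    (hM : ∀ r ∈ Set.Icc a b, FlowBound n μ φ M r) (h0 : 0 ≤ h) (hab : a ≤ b - h) :
    |(∫ x, φ b x * conj (φ (b - h) x) ∂μ).im - (∫ x, φ (a + h) x * conj (φ a x) ∂μ).im| ≤
      9 * |lam| * ∫ t in a..b, stepSq μ φ b h t := by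
  obtain ⟨ηs, C, hs⟩ := exists_isCutoffSeq n
  have hcw := hφ.continuousOn_stepSq hM h0
  have hle : ∫ t in a..(b - h), stepSq μ φ b h t ≤ ∫ t in a..b, stepSq μ φ b h t := by
    refine intervalIntegral.integral_mono_interval le_rfl hab (by linarith)
      (Eventually.of_forall fun t => stepSq_nonneg b h t)
      (ContinuousOn.intervalIntegrable_of_Icc (by linarith) hcw)
  have key : ∀ σ : ℝ, |σ| = 1 → σ * (∫ x, φ b x * conj (φ (b - h) x) ∂μ).im -
      σ * (∫ x, φ (a + h) x * conj (φ a x) ∂μ).im ≤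
      9 * |lam| * ∫ t in a..(b - h), stepSq μ φ b h t := fun σ hσ => by
    have t1 := (Complex.continuous_im.tendsto _).comp
      (hs.tendsto_integral (hφ.integrable_mul_conj b (b - h)))
    have t2 := (Complex.continuous_im.tendsto _).comp
      (hs.tendsto_integral (hφ.integrable_mul_conj (a + h) a))
    exact le_of_tendsto_of_tendsto' ((t1.const_mul σ).sub (t2.const_mul σ))
      (IsCutoffSeq.tendsto_const 4 _ _) fun k => hφ.im_cutoff_pairing_sub_le (hs.isCutoff k)
        (hs.bound k) (hs.div_nonneg k) hσ hM h0 hab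
  have k1 := key 1 (by simp)
  have k2 := key (-1) (by simp)
  have hl : 9 * |lam| * ∫ t in a..(b - h), stepSq μ φ b h t ≤
    9 * |lam| * ∫ t in a..b, stepSq μ φ b h t := by gcongr
  rw [abs_le]
  constructor <;> linarith

lemma IsLogFlow.tendsto_integral_stepSq_div (hφ : IsLogFlow n U μ lam φ) {M a b : ℝ}
    (hab : a ≤ b) (hM : ∀ r ∈ Set.Icc a b, FlowBound n μ φ M r) :
    Tendsto (fun h => ∫ t in a..b, stepSq μ φ b h t / h) (𝓝[>] 0) (𝓝 0) := by
  obtain ⟨D, hD⟩ := hφ.exists_norm_pairing_sub_le hM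
  have hmap : ∀ {h t : ℝ}, 0 < h → t ∈ Set.Icc a b → min (t + h) b ∈ Set.Icc a b :=
    fun h0 ht => ⟨le_min (by linarith [ht.1]) hab, min_le_right _ _⟩
  have habs : ∀ {h t : ℝ}, 0 < h → t ∈ Set.Icc a b → |min (t + h) b - t| ≤ h := fun {h t} h0 ht => by
    rw [abs_of_nonneg (sub_nonneg.2 (le_min (by linarith) ht.2))]
    linarith [min_le_left (t + h) b]
  have hpos : ∀ᶠ h : ℝ in 𝓝[>] 0, 0 < h := self_mem_nhdsWithin
  have huIoc : Set.uIoc a b ⊆ Set.Icc a b := by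
    rw [Set.uIoc_of_le hab]
    exact Set.Ioc_subset_Icc_self
  have key := intervalIntegral.tendsto_integral_filter_of_dominated_convergence
    (μ := volume) (a := a) (b := b) (l := 𝓝[>] (0 : ℝ)) (F := fun h t => stepSq μ φ b h t / h)
    (f := fun _ => (0 : ℝ)) (fun _ => 2 * |D|) ?_ ?_ intervalIntegrable_const ?_
  · simpa using key
  · filter_upwards [hpos] with h h0
    exact (((hφ.continuousOn_stepSq hM h0.le).div_const h).mono huIoc).aestronglyMeasurable
      measurableSet_uIoc
  · filter_upwards [hpos] with h h0
    refine Eventually.of_forall fun t ht => ?_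
    have ht := huIoc ht
    rw [Real.norm_eq_abs, abs_of_nonneg (div_nonneg (stepSq_nonneg b h t) h0.le), div_le_iff₀ h0]
    have h1 := hφ.integral_sub_sq_le_norm hM (hmap h0 ht) ht 0
    have h2 := hD _ (hmap h0 ht) t ht
    rw [Complex.ofReal_zero, mul_zero, add_zero] at h1
    calc _ ≤ 2 * (D * |min (t + h) b - t|) := h1.trans (by linarith)
      _ ≤ 2 * (|D| * h) := by
          gcongr
          · exact le_abs_self D
          · exact habs h0 ht
      _ = _ := by ring
  · refine Eventually.of_forall fun t ht => ?_
    have ht := huIoc ht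
    rw [Metric.tendsto_nhds]
    intro ε hε
    have hev := hφ.eventually_norm_pairing_sub_le hM ht (show 0 < ε / 3 by positivity)
    have htend : Tendsto (fun h => min (t + h) b) (𝓝[>] 0) (𝓝[Set.Icc a b] t) := by
      refine tendsto_nhdsWithin_iff.2 ⟨?_, ?_⟩
      · have hc : Continuous fun h => min (t + h) b := by fun_prop
        have := (hc.tendsto 0).mono_left (nhdsWithin_le_nhds (s := Set.Ioi 0))
        simpa [min_eq_left ht.2] using this
      · filter_upwards [hpos] with h h0 using hmap h0 ht
    filter_upwards [htend.eventually hev, hpos] with h hh h0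
    rw [Real.dist_eq, sub_zero, abs_of_nonneg (div_nonneg (stepSq_nonneg b h t) h0.le),
      div_lt_iff₀ h0]
    have h1 := hφ.integral_sub_sq_le_norm hM (hmap h0 ht) ht
      (energyOf n μ lam (φ t) * (min (t + h) b - t))
    rw [Complex.ofReal_mul, Complex.ofReal_sub, ← mul_assoc] at h1
    have h2 := habs h0 ht
    have h3 : ε / 3 * |min (t + h) b - t| ≤ ε / 3 * h := by gcongr
    rw [stepSq]
    nlinarith

/-- Conservation of energy on time intervals with uniform bounds. -/
theorem IsLogFlow.energyOf_eq (hφ : IsLogFlow n U μ lam φ) {M a b : ℝ} (hab : a ≤ b)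
    (hM : ∀ r ∈ Set.Icc a b, FlowBound n μ φ M r) :
    energyOf n μ lam (φ b) = energyOf n μ lam (φ a) := by
  rcases hab.eq_or_lt with rfl | hlt
  · rfl
  have ha : a ∈ Set.Icc a b := ⟨le_rfl, hab⟩
  have hb : b ∈ Set.Icc a b := ⟨hab, le_rfl⟩
  have hpos : ∀ᶠ h : ℝ in 𝓝[>] 0, 0 < h := self_mem_nhdsWithin
  have hsmall : ∀ᶠ h : ℝ in 𝓝[>] 0, h < b - a :=
    nhdsWithin_le_nhds (Iio_mem_nhds (by linarith))
  have hta : Tendsto (fun h => a + h) (𝓝[>] 0) (𝓝[Set.Icc a b] a) := by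
    refine tendsto_nhdsWithin_iff.2 ⟨?_, ?_⟩
    · have hc : Continuous fun h => a + h := by fun_prop
      simpa using (hc.tendsto 0).mono_left (nhdsWithin_le_nhds (s := Set.Ioi 0))
    · filter_upwards [hpos, hsmall] with h h0 h1
      exact ⟨by linarith, by linarith⟩
  have htb : Tendsto (fun h => b - h) (𝓝[>] 0) (𝓝[Set.Icc a b] b) := by
    refine tendsto_nhdsWithin_iff.2 ⟨?_, ?_⟩
    · have hc : Continuous fun h => b - h := by fun_prop
      simpa using (hc.tendsto 0).mono_left (nhdsWithin_le_nhds (s := Set.Ioi 0))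
    · filter_upwards [hpos, hsmall] with h h0 h1
      exact ⟨by linarith, by linarith⟩
  have hkey : ∀ ε > 0, |energyOf n μ lam (φ b) - energyOf n μ lam (φ a)| ≤ 2 * ε := by
    intro ε hε
    have hlim := ((hφ.tendsto_integral_stepSq_div hab hM).const_mul (9 * |lam|)).const_add (2 * ε)
    rw [mul_zero, add_zero] at hlim
    refine ge_of_tendsto hlim ?_
    filter_upwards [hpos, hsmall, hta.eventually (hφ.eventually_norm_pairing_sub_le hM ha hε),
      htb.eventually (hφ.eventually_norm_pairing_sub_le hM hb hε)] with h h0 h1 h2 h3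
    have h4 := hφ.abs_im_pairing_sub_le hM h0.le (by linarith)
    have hconj : (∫ x, φ b x * conj (φ (b - h) x) ∂μ).im =
        -(∫ x, φ (b - h) x * conj (φ b x) ∂μ).im := by
      rw [← Complex.conj_im, ← integral_conj]
      congr 2
      ext x
      simp [mul_comm]
    have him : ∀ (Z : ℂ) (m E d : ℝ), (Z - m + Complex.I * E * d).im = Z.im + E * d := by
      intro Z m E d
      simp
    have h5 := (Complex.abs_im_le_norm _).trans h2
    have h6 := (Complex.abs_im_le_norm _).trans h3
    rw [← Complex.ofReal_sub, him, add_sub_cancel_left, abs_of_pos h0] at h5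
    rw [← Complex.ofReal_sub, him, sub_sub_cancel_left, abs_neg, abs_of_pos h0] at h6
    rw [hconj] at h4
    rw [intervalIntegral.integral_div, ← mul_div_assoc]
    have h7 := abs_le.1 h4
    have h8 := abs_le.1 h5
    have h9 := abs_le.1 h6
    have h10 : |energyOf n μ lam (φ b) - energyOf n μ lam (φ a)| * h ≤
        2 * ε * h + 9 * |lam| * ∫ t in a..b, stepSq μ φ b h t := by
      rw [← abs_of_pos h0, ← abs_mul, abs_of_pos h0, abs_le]
      constructor <;> nlinarith
    calc _ = |energyOf n μ lam (φ b) - energyOf n μ lam (φ a)| * h / h := by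
          field_simp
      _ ≤ (2 * ε * h + 9 * |lam| * ∫ t in a..b, stepSq μ φ b h t) / h := by gcongr
      _ = _ := by
          field_simp
  have h0 : |energyOf n μ lam (φ b) - energyOf n μ lam (φ a)| ≤ 0 := by
    refine le_of_forall_pos_le_add fun ε hε => ?_
    linarith [hkey (ε / 2) (by positivity)]
  exact sub_eq_zero.1 (abs_nonpos_iff.1 h0)

end EnergyConservation

section Gronwall

lemma le_exp_mul_of_abs_sub_le {g : ℝ → ℝ} {a b κ : ℝ} (hab : a ≤ b)
    (hc : ContinuousOn g (Set.Icc a b))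
    (hl : ∀ s t G, a ≤ s → s ≤ t → t ≤ b → (∀ r ∈ Set.Icc s t, g r ≤ G) →
      g t - g s ≤ κ * G * (t - s)) : g b ≤ Real.exp (κ * (b - a)) * g a := by
  have key := le_gronwallBound_of_liminf_deriv_right_le (f := g) (f' := fun x => κ * g x)
    (δ := g a) (K := κ) (ε := 0) hc ?_ le_rfl (fun x _ => by simp) b ⟨hab, le_rfl⟩
  · rwa [gronwallBound_ε0, mul_comm] at key
  intro x hx r hr
  obtain ⟨ε, hε, hεr⟩ : ∃ ε > 0, κ * (g x + ε) < r := by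
    have ht : Tendsto (fun ε => κ * (g x + ε)) (𝓝[>] 0) (𝓝 (κ * (g x + 0))) :=
      ((by fun_prop : Continuous fun ε => κ * (g x + ε)).tendsto 0).mono_left nhdsWithin_le_nhds
    rw [add_zero] at ht
    obtain ⟨ε, h1, h2⟩ := ((ht.eventually (gt_mem_nhds hr)).and self_mem_nhdsWithin).exists
    exact ⟨ε, h2, h1⟩
  have hev : ∀ᶠ z in 𝓝[Set.Icc a b] x, g z < g x + ε :=
    (hc x ⟨hx.1, hx.2.le⟩).eventually (gt_mem_nhds (by linarith))
  obtain ⟨δ, hδ, hδg⟩ := Metric.mem_nhdsWithin_iff.1 hev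
  refine Eventually.frequently ?_
  filter_upwards [Ioo_mem_nhdsGT (show x < min (x + δ) b from lt_min (by linarith) hx.2)] with z hz
  have hz1 : z < x + δ := hz.2.trans_le (min_le_left _ _)
  have hz2 : z < b := hz.2.trans_le (min_le_right _ _)
  have h1 := hl x z (g x + ε) hx.1 hz.1.le hz2.le fun q hq => le_of_lt <|
    hδg ⟨by rw [Metric.mem_ball, Real.dist_eq, abs_of_nonneg (by linarith [hq.1])]
            linarith [hq.2], hx.1.trans hq.1, hq.2.trans hz2.le⟩
  have hzx : 0 < z - x := sub_pos.2 hz.1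
  rw [inv_mul_lt_iff₀ hzx]
  nlinarith

end Gronwall

section Relation

variable {n : ℕ} {U : EuclideanSpace ℝ (Fin n) → ℝ} {μ : Measure (EuclideanSpace ℝ (Fin n))}
  {lam : ℝ} {φ : ℝ → EuclideanSpace ℝ (Fin n) → ℂ} {η : EuclideanSpace ℝ (Fin n) → ℝ}

/-- Conservation of mass and energy, and two-sided exponential control of the Dirichlet energy,
between the times `s ≤ t`. -/
structure FlowRel (n : ℕ) (μ : Measure (EuclideanSpace ℝ (Fin n))) (lam : ℝ)
    (φ : ℝ → EuclideanSpace ℝ (Fin n) → ℂ) (s t : ℝ) : Prop where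
  mass_eq : massOf μ (φ t) = massOf μ (φ s)
  energy_eq : energyOf n μ lam (φ t) = energyOf n μ lam (φ s)
  grad_le : gradE n μ (φ t) ≤ Real.exp (2 * |lam| * (t - s)) * gradE n μ (φ s)
  grad_ge : gradE n μ (φ s) ≤ Real.exp (2 * |lam| * (t - s)) * gradE n μ (φ t)

lemma FlowRel.refl (t : ℝ) : FlowRel n μ lam φ t t :=
  ⟨rfl, rfl, by simp, by simp⟩

lemma FlowRel.trans {s t u : ℝ} (h₁ : FlowRel n μ lam φ s t) (h₂ : FlowRel n μ lam φ t u) :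
    FlowRel n μ lam φ s u := by
  have he : Real.exp (2 * |lam| * (u - s)) =
      Real.exp (2 * |lam| * (u - t)) * Real.exp (2 * |lam| * (t - s)) := by
    rw [← Real.exp_add]
    ring_nf
  refine ⟨h₂.mass_eq.trans h₁.mass_eq, h₂.energy_eq.trans h₁.energy_eq, ?_, ?_⟩
  · rw [he, mul_assoc]
    exact h₂.grad_le.trans (mul_le_mul_of_nonneg_left h₁.grad_le (Real.exp_nonneg _))
  · rw [he, mul_comm (Real.exp _), mul_assoc]
    exact h₁.grad_ge.trans (mul_le_mul_of_nonneg_left h₂.grad_ge (Real.exp_nonneg _))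

lemma gradE_nonneg (u : EuclideanSpace ℝ (Fin n) → ℂ) : 0 ≤ gradE n μ u :=
  integral_nonneg fun x => Finset.sum_nonneg fun j _ => by positivity

lemma massOf_nonneg (u : EuclideanSpace ℝ (Fin n) → ℂ) : 0 ≤ massOf μ u :=
  integral_nonneg fun x => by positivity

lemma IsLogFlow.abs_gradE_sub_le (hφ : IsLogFlow n U μ lam φ) {M G a b : ℝ} (hab : a ≤ b)
    (hM : ∀ s ∈ Set.Icc a b, FlowBound n μ φ M s)
    (hG : ∀ s ∈ Set.Icc a b, gradE n μ (φ s) ≤ G) :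
    |gradE n μ (φ b) - gradE n μ (φ a)| ≤ 2 * |lam| * G * (b - a) := by
  have hE := hφ.energyOf_eq hab hM
  have hm := hφ.massOf_eq hab hM
  have h := mul_le_mul_of_nonneg_left (hφ.abs_ent0_sub_le hab hM hG) (abs_nonneg lam)
  rw [energyOf, energyOf, hm] at hE
  have e : gradE n μ (φ b) - gradE n μ (φ a) = -(lam * (ent0 μ (φ b) - ent0 μ (φ a))) := by
    linarith
  rw [e, abs_neg, abs_mul]
  linarith

/-- Conservation laws and gradient growth on time intervals with uniform bounds. -/
lemma IsLogFlow.flowRel_of_flowBound (hφ : IsLogFlow n U μ lam φ) {M a b : ℝ} (hab : a ≤ b)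
    (hM : ∀ s ∈ Set.Icc a b, FlowBound n μ φ M s) : FlowRel n μ lam φ a b := by
  have hsub : ∀ {s t : ℝ}, a ≤ s → t ≤ b → ∀ r ∈ Set.Icc s t, FlowBound n μ φ M r :=
    fun hs ht r hr => hM r ⟨hs.trans hr.1, hr.2.trans ht⟩
  have hM0 := (hM a ⟨le_rfl, hab⟩).nonneg
  have hlip : LipschitzOnWith (Real.toNNReal (2 * |lam| * M)) (fun t => gradE n μ (φ t))
      (Set.Icc a b) := by
    refine LipschitzOnWith.of_dist_le_mul fun s hs t ht => ?_
    rw [Real.dist_eq, Real.dist_eq, Real.coe_toNNReal _ (by positivity)]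
    rcases le_total s t with hst | hst
    · rw [abs_sub_comm, abs_sub_comm s, abs_of_nonneg (sub_nonneg.2 hst)]
      exact hφ.abs_gradE_sub_le hst (hsub hs.1 ht.2) fun r hr => (hsub hs.1 ht.2 r hr).grad_le
    · rw [abs_of_nonneg (sub_nonneg.2 hst)]
      exact hφ.abs_gradE_sub_le hst (hsub ht.1 hs.2) fun r hr => (hsub ht.1 hs.2 r hr).grad_le
  refine ⟨hφ.massOf_eq hab hM, hφ.energyOf_eq hab hM, ?_, ?_⟩
  · refine le_exp_mul_of_abs_sub_le (g := fun t => gradE n μ (φ t)) hab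
      hlip.continuousOn fun s t G hs hst ht hG => ?_
    exact (le_abs_self _).trans (hφ.abs_gradE_sub_le hst (hsub hs ht) hG)
  · have h := le_exp_mul_of_abs_sub_le (g := fun t => gradE n μ (φ (-t))) (a := -b) (b := -a)
      (κ := 2 * |lam|) (by linarith)
      (hlip.continuousOn.comp continuousOn_neg fun t ht => ⟨by linarith [ht.2], by linarith [ht.1]⟩)
      fun s t G hs hst ht hG => ?_
    · simpa [neg_add_eq_sub] using h
    · have h1 := hφ.abs_gradE_sub_le (a := -t) (b := -s) (G := G) (by linarith)
        (hsub (by linarith) (by linarith)) fun r hr => by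
          simpa using hG (-r) ⟨by linarith [hr.2], by linarith [hr.1]⟩
      rw [abs_sub_comm] at h1
      refine (le_abs_self _).trans (h1.trans_eq ?_)
      ring

end Relation

section UniformSize

variable {n : ℕ} {U : EuclideanSpace ℝ (Fin n) → ℝ} {μ : Measure (EuclideanSpace ℝ (Fin n))}
  {lam : ℝ} {φ : ℝ → EuclideanSpace ℝ (Fin n) → ℂ}

/-- Uniform bounds on mass, Dirichlet energy and entropy at time `t`. -/
structure FlowSize (n : ℕ) (μ : Measure (EuclideanSpace ℝ (Fin n)))
    (φ : ℝ → EuclideanSpace ℝ (Fin n) → ℂ) (M t : ℝ) : Prop where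
  mass_le : massOf μ (φ t) ≤ M
  grad_le : gradE n μ (φ t) ≤ M
  ent_le : entAbs μ (φ t) ≤ M

lemma FlowSize.mono {M M' t : ℝ} (h : FlowSize n μ φ M t) (hM : M ≤ M') : FlowSize n μ φ M' t :=
  ⟨h.mass_le.trans hM, h.grad_le.trans hM, h.ent_le.trans hM⟩

lemma FlowSize.flowBound {M K t : ℝ} (h : FlowSize n μ φ M t)
    (hK : |Real.log (massOf μ (φ t))| ≤ K) : FlowBound n μ φ (max M K) t :=
  ⟨h.mass_le.trans (le_max_left _ _), h.grad_le.trans (le_max_left _ _),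
    h.ent_le.trans (le_max_left _ _), hK.trans (le_max_right _ _)⟩

lemma IsLogFlow.continuousOn_massOf (hφ : IsLogFlow n U μ lam φ) {M : ℝ} {S : Set ℝ}
    (hM : ∀ s ∈ S, entAbs μ (φ s) ≤ M) : ContinuousOn (fun t => massOf μ (φ t)) S := by
  intro τ hτ
  rw [ContinuousWithinAt, tendsto_iff_norm_sub_tendsto_zero]
  refine squeeze_zero (fun s => norm_nonneg _) (fun s => ?_) (hφ.tendsto_integral_abs_sub hτ hM)
  rw [massOf, massOf, ← integral_sub (hφ.mass_int s) (hφ.mass_int τ)]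
  exact norm_integral_le_integral_norm _

lemma eq_zero_of_massOf_eq_zero [μ.IsOpenPosMeasure] {u : EuclideanSpace ℝ (Fin n) → ℂ}
    (hu : Continuous u) (hi : Integrable (fun x => ‖u x‖ ^ 2) μ) (h : massOf μ u = 0) : u = 0 := by
  rw [massOf, integral_eq_zero_iff_of_nonneg (fun x => by positivity) hi] at h
  have h1 : (fun x => ‖u x‖ ^ 2) = 0 := ((hu.norm.pow 2).ae_eq_iff_eq μ continuous_const).1 h
  ext x
  simpa using congrFun h1 x

lemma IsLogFlow.massOf_eq_iff (hφ : IsLogFlow n U μ lam φ) {M a b c : ℝ} (hab : a ≤ b) (hc : 0 < c)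
    (hM : ∀ s ∈ Set.Icc a b, FlowSize n μ φ M s) :
    massOf μ (φ a) = c ↔ massOf μ (φ b) = c := by
  have hcont := hφ.continuousOn_massOf fun s hs => (hM s hs).ent_le
  refine rel_of_locally (r := fun s t => massOf μ (φ s) = c ↔ massOf μ (φ t) = c) hab
    (fun _ => Iff.rfl) (fun _ _ _ => Iff.trans) fun t ht => ?_
  rcases (massOf_nonneg (μ := μ) (φ t)).eq_or_lt with h0 | h0
  · obtain ⟨δ, hδ, h⟩ := Metric.mem_nhdsWithin_iff.1
      ((hcont t ht).eventually (gt_mem_nhds (h0 ▸ hc : massOf μ (φ t) < c)))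
    have h' : ∀ s, |s - t| < δ → s ∈ Set.Icc a b → massOf μ (φ s) ≠ c := fun s hs hsI =>
      (h ⟨by simpa [Real.dist_eq] using hs, hsI⟩ : massOf μ (φ s) < c).ne
    exact ⟨δ, hδ, fun s u hs hu hsI huI _ => iff_of_false (h' s hs hsI) (h' u hu huI)⟩
  · have hlog : ContinuousWithinAt (fun t => |Real.log (massOf μ (φ t))|) (Set.Icc a b) t :=
      ((hcont t ht).log h0.ne').abs
    obtain ⟨δ, hδ, h⟩ := Metric.mem_nhdsWithin_iff.1
      (hlog.eventually (gt_mem_nhds (lt_add_one _)))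
    refine ⟨δ, hδ, fun s u hs hu hsI huI hsu => ?_⟩
    rw [hφ.massOf_eq hsu fun r hr => (hM r ⟨hsI.1.trans hr.1, hr.2.trans huI.2⟩).flowBound
      (le_of_lt (h ⟨?_, hsI.1.trans hr.1, hr.2.trans huI.2⟩))]
    rw [Metric.mem_ball, Real.dist_eq, abs_lt]
    rw [abs_lt] at hs hu
    exact ⟨by linarith [hr.1], by linarith [hr.2]⟩

/-- Conservation laws and gradient growth on time intervals with uniformly bounded mass, Dirichlet
energy and entropy. -/
lemma IsLogFlow.flowRel_of_flowSize (hφ : IsLogFlow n U μ lam φ) {M a b : ℝ} (hab : a ≤ b)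
    (hM : ∀ s ∈ Set.Icc a b, FlowSize n μ φ M s) : FlowRel n μ lam φ a b := by
  have := hφ.gibbs.isOpenPosMeasure
  rcases (massOf_nonneg (μ := μ) (φ a)).eq_or_lt with h0 | h0
  · have hb : massOf μ (φ b) = 0 := by
      by_contra hb
      have hb' := (massOf_nonneg (μ := μ) (φ b)).lt_of_ne' hb
      exact hb'.ne (h0.trans ((hφ.massOf_eq_iff hab hb' hM).2 rfl))
    have ea := eq_zero_of_massOf_eq_zero (hφ.continuous a) (hφ.mass_int a) h0.symm
    have eb := eq_zero_of_massOf_eq_zero (hφ.continuous b) (hφ.mass_int b) hb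
    have hg : gradE n μ (0 : EuclideanSpace ℝ (Fin n) → ℂ) = 0 := by
      simp [gradE, gradSqC, pdC]
    exact ⟨by rw [ea, eb], by rw [ea, eb], by rw [ea, eb, hg, mul_zero],
      by rw [ea, eb, hg, mul_zero]⟩
  · refine hφ.flowRel_of_flowBound hab fun s hs => (hM s hs).flowBound
      (K := |Real.log (massOf μ (φ a))|) (le_of_eq ?_)
    rw [(hφ.massOf_eq_iff hs.1 h0 fun r hr => hM r ⟨hr.1, hr.2.trans hs.2⟩).1 rfl]

end UniformSize

section LowerSemicontinuity

/-- Fatou's lemma for Bochner integrals with a uniform bound. -/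
lemma integral_le_of_tendsto_of_integral_le {X : Type*} [MeasurableSpace X] {μ : Measure X}
    {F : ℕ → X → ℝ} {f : X → ℝ} {M : ℝ} (hF0 : ∀ i x, 0 ≤ F i x) (hF : ∀ i, Integrable (F i) μ)
    (hf : Integrable f μ) (hlim : ∀ x, Tendsto (fun i => F i x) atTop (𝓝 (f x)))
    (hM : ∀ i, ∫ x, F i x ∂μ ≤ M) : ∫ x, f x ∂μ ≤ M := by
  have hf0 : ∀ x, 0 ≤ f x := fun x => ge_of_tendsto' (hlim x) fun i => hF0 i x
  have hM0 : 0 ≤ M := (integral_nonneg (hF0 0)).trans (hM 0)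
  have h1 : ENNReal.ofReal (∫ x, f x ∂μ) ≤ ENNReal.ofReal M := by
    rw [ofReal_integral_eq_lintegral_ofReal hf (Eventually.of_forall hf0)]
    have e : ∀ x, ENNReal.ofReal (f x) = liminf (fun i => ENNReal.ofReal (F i x)) atTop := fun x =>
      ((ENNReal.continuous_ofReal.tendsto _).comp (hlim x)).liminf_eq.symm
    simp_rw [e]
    refine (lintegral_liminf_le' fun i => (hF i).aemeasurable.ennreal_ofReal).trans ?_
    refine (liminf_le_liminf (v := fun _ => ENNReal.ofReal M)
      (Eventually.of_forall fun i => ?_)).trans (by simp)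
    rw [← ofReal_integral_eq_lintegral_ofReal (hF i) (Eventually.of_forall (hF0 i))]
    exact ENNReal.ofReal_le_ofReal (hM i)
  exact (ENNReal.ofReal_le_ofReal_iff hM0).1 h1

variable {n : ℕ} {U : EuclideanSpace ℝ (Fin n) → ℝ} {μ : Measure (EuclideanSpace ℝ (Fin n))}
  {lam : ℝ} {φ : ℝ → EuclideanSpace ℝ (Fin n) → ℂ} {η : EuclideanSpace ℝ (Fin n) → ℝ}

lemma gradSqC_nonneg (u : EuclideanSpace ℝ (Fin n) → ℂ) (x : EuclideanSpace ℝ (Fin n)) :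
    0 ≤ gradSqC n u x :=
  Finset.sum_nonneg fun _ _ => by positivity

lemma continuous_gradSqC {u : EuclideanSpace ℝ (Fin n) → ℂ} (hu : ContDiff ℝ ∞ u) :
    Continuous (gradSqC n u) :=
  continuous_finsetSum _ fun j _ => ((hu.of_smooth.continuous_pdC j).norm.pow 2)

lemma norm_sum_conj_mul_pdC_le (u v : EuclideanSpace ℝ (Fin n) → ℂ)
    (x : EuclideanSpace ℝ (Fin n)) :
    ‖∑ j, conj (pdC n u j x) * pdC n v j x‖ ≤ 1 / 2 * gradSqC n u x + 1 / 2 * gradSqC n v x := by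
  rw [gradSqC, gradSqC, Finset.mul_sum, Finset.mul_sum, ← Finset.sum_add_distrib]
  refine norm_sum_le_of_le _ fun j _ => ?_
  rw [norm_mul, RCLike.norm_conj]
  nlinarith [sq_nonneg (‖pdC n u j x‖ - ‖pdC n v j x‖)]

lemma IsLogFlow.integral_cutoff_gradSqC_le (hφ : IsLogFlow n U μ lam φ) (hη : IsCutoff n η)
    {M t : ℝ} {S : Set ℝ} (ht : t ∈ S) (hS : ∀ s ∈ S, entAbs μ (φ s) ≤ M)
    (hf : ∃ᶠ s in 𝓝[S] t, gradE n μ (φ s) ≤ M) :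
    ‖∫ x, (η x : ℂ) ^ 2 * (gradSqC n (φ t) x : ℂ) ∂μ‖ ≤ M := by
  have := hφ.gibbs.isProbabilityMeasure
  have hI : Integrable (fun x => (η x : ℂ) ^ 2 * (gradSqC n (φ t) x : ℂ)) μ :=
    hη.integrable_sq_mul (Complex.continuous_ofReal.comp (continuous_gradSqC (hφ.smooth t)))
  have hcp : ∀ s j, Continuous fun x => conj (pdC n (φ t) j x) * pdC n (φ s) j x := fun s j =>
    (Complex.continuous_conj.comp (hφ.continuous_pd t j)).mul (hφ.continuous_pd s j)
  have e : ∀ s, ∑ j, ∫ x, (η x : ℂ) ^ 2 * (conj (pdC n (φ t) j x) * pdC n (φ s) j x) ∂μ =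
      ∫ x, (η x : ℂ) ^ 2 * ∑ j, conj (pdC n (φ t) j x) * pdC n (φ s) j x ∂μ := fun s => by
    rw [← integral_finsetSum _ fun j _ => hη.integrable_sq_mul (hcp s j)]
    simp_rw [Finset.mul_sum]
  have hlim : Tendsto (fun s => ∫ x, (η x : ℂ) ^ 2 *
      ∑ j, conj (pdC n (φ t) j x) * pdC n (φ s) j x ∂μ) (𝓝[S] t)
      (𝓝 (∫ x, (η x : ℂ) ^ 2 * (gradSqC n (φ t) x : ℂ) ∂μ)) := by
    have h := tendsto_finsetSum Finset.univ fun j _ => hφ.tendsto_integral_cutoff_mul_pd hη ht hS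
      (((hφ.smooth t).pdC_smooth j).of_smooth.conj) j
    simp only [e] at h
    convert h using 6 with x
    rw [gradSqC, Complex.ofReal_sum]
    refine Finset.sum_congr rfl fun j _ => ?_
    rw [Complex.conj_mul']
    push_cast
    rfl
  have hre : ‖∫ x, (η x : ℂ) ^ 2 * (gradSqC n (φ t) x : ℂ) ∂μ‖ =
      ∫ x, ‖(η x : ℂ) ^ 2 * (gradSqC n (φ t) x : ℂ)‖ ∂μ := by
    have e1 : ∀ x, (η x : ℂ) ^ 2 * (gradSqC n (φ t) x : ℂ) =
        ((η x ^ 2 * gradSqC n (φ t) x : ℝ) : ℂ) := fun x => by push_cast; rfl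
    have e2 : ∀ x, 0 ≤ η x ^ 2 * gradSqC n (φ t) x := fun x =>
      mul_nonneg (sq_nonneg _) (gradSqC_nonneg _ _)
    simp_rw [e1, Complex.norm_real, Real.norm_eq_abs, abs_of_nonneg (e2 _)]
    rw [integral_complex_ofReal, Complex.norm_real, Real.norm_eq_abs,
      abs_of_nonneg (integral_nonneg e2)]
  have hle : ‖∫ x, (η x : ℂ) ^ 2 * (gradSqC n (φ t) x : ℂ) ∂μ‖ ≤
      1 / 2 * ‖∫ x, (η x : ℂ) ^ 2 * (gradSqC n (φ t) x : ℂ) ∂μ‖ + 1 / 2 * M := by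
    refine le_of_tendsto_of_frequently hlim.norm (hf.mono fun s hs => ?_)
    have hb : Integrable (fun x => 1 / 2 * ‖(η x : ℂ) ^ 2 * (gradSqC n (φ t) x : ℂ)‖ +
        1 / 2 * gradSqC n (φ s) x) μ := (hI.norm.const_mul _).add ((hφ.grad_int s).const_mul _)
    refine (norm_integral_le_of_norm_le hb (Eventually.of_forall fun x => ?_)).trans ?_
    · rw [norm_mul, norm_mul, Complex.norm_real (gradSqC n (φ t) x), Real.norm_eq_abs,
        abs_of_nonneg (gradSqC_nonneg _ _)]
      have h1 := mul_le_mul_of_nonneg_left (norm_sum_conj_mul_pdC_le (φ t) (φ s) x)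
        (norm_nonneg ((η x : ℂ) ^ 2))
      have h2 := mul_le_of_le_one_left (gradSqC_nonneg (φ s) x) (hη.norm_sq_le_one x)
      linarith
    · rw [integral_add (hI.norm.const_mul _) ((hφ.grad_int s).const_mul _), integral_const_mul,
        integral_const_mul, ← hre]
      rw [gradE] at hs
      linarith
  linarith

lemma IsLogFlow.gradE_le_of_frequently (hφ : IsLogFlow n U μ lam φ)
    {M t : ℝ} {S : Set ℝ} (ht : t ∈ S) (hS : ∀ s ∈ S, entAbs μ (φ s) ≤ M)
    (hf : ∃ᶠ s in 𝓝[S] t, gradE n μ (φ s) ≤ M) : gradE n μ (φ t) ≤ M := by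
  obtain ⟨ηs, C, hs⟩ := exists_isCutoffSeq n
  have hI : Integrable (fun x => (gradSqC n (φ t) x : ℂ)) μ := (hφ.grad_int t).ofReal
  have h := le_of_tendsto' (hs.tendsto_integral hI).norm fun k =>
    hφ.integral_cutoff_gradSqC_le (hs.isCutoff k) ht hS hf
  rw [integral_complex_ofReal, Complex.norm_real] at h
  exact (le_abs_self _).trans h

/-- Bounds on mass, Dirichlet energy and entropy pass to limits of times. -/
lemma IsLogFlow.flowSize_of_frequently (hφ : IsLogFlow n U μ lam φ) {M t : ℝ}
    (hf : ∃ᶠ s in 𝓝 t, FlowSize n μ φ M s) : FlowSize n μ φ M t := by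
  obtain ⟨s, hsM, hst⟩ := mem_closure_iff_seq_limit.1 (mem_closure_iff_frequently.2 hf)
  have hlim : ∀ x, Tendsto (fun i => φ (s i) x) atTop (𝓝 (φ t x)) := fun x =>
    (hφ.hasDerivAt t x).continuousAt.tendsto.comp hst
  have hent : entAbs μ (φ t) ≤ M := by
    refine integral_le_of_tendsto_of_integral_le (fun i x => by positivity)
      (fun i => hφ.ent_int (s i)) (hφ.ent_int t) (fun x => ?_) fun i => (hsM i).ent_le
    have hc : Continuous fun v : ℝ => |v * Real.log v| := Real.continuous_mul_log.abs
    have h := (hc.tendsto (‖φ t x‖ ^ 2)).comp ((hlim x).norm.pow 2)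
    simpa [Function.comp_def, abs_mul] using h
  refine ⟨?_, ?_, hent⟩
  · exact integral_le_of_tendsto_of_integral_le (fun i x => by positivity)
      (fun i => hφ.mass_int (s i)) (hφ.mass_int t) (fun x => (hlim x).norm.pow 2)
      fun i => (hsM i).mass_le
  · refine hφ.gradE_le_of_frequently (S := {s | entAbs μ (φ s) ≤ M}) hent (fun _ h => h) ?_
    rw [frequently_nhdsWithin_iff]
    exact hf.mono fun r hr => ⟨hr.grad_le, hr.ent_le⟩

end LowerSemicontinuity

section Globalisation

variable {n : ℕ} {U : EuclideanSpace ℝ (Fin n) → ℝ} {μ : Measure (EuclideanSpace ℝ (Fin n))}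
  {lam : ℝ} {φ : ℝ → EuclideanSpace ℝ (Fin n) → ℂ}

lemma mul_abs_log_le_mul_log_add_two {v : ℝ} (hv : 0 ≤ v) :
    v * |Real.log v| ≤ v * Real.log v + 2 := by
  have h1 : -1 ≤ v * Real.log v := by
    rcases hv.eq_or_lt with rfl | hv
    · simp
    · have h := mul_le_mul_of_nonneg_left (Real.one_sub_inv_le_log_of_pos hv) hv.le
      rw [mul_sub, mul_inv_cancel₀ hv.ne'] at h
      linarith
  rcases le_total 0 (Real.log v) with h | h
  · rw [abs_of_nonneg h]
    linarith
  · rw [abs_of_nonpos h]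
    linarith

lemma IsLogFlow.integrable_mul_log (hφ : IsLogFlow n U μ lam φ) (t : ℝ) :
    Integrable (fun x => ‖φ t x‖ ^ 2 * Real.log (‖φ t x‖ ^ 2)) μ := by
  refine Integrable.mono' (hφ.ent_int t) ((Real.continuous_mul_log.comp
    ((hφ.continuous t).norm.pow 2)).aestronglyMeasurable) (Eventually.of_forall fun x => ?_)
  simp [abs_mul]

lemma IsLogFlow.entAbs_le (hφ : IsLogFlow n U μ lam φ) (t : ℝ) :
    entAbs μ (φ t) ≤ ent0 μ (φ t) + 2 := by
  have := hφ.gibbs.isProbabilityMeasure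
  refine (integral_mono (hφ.ent_int t) ((hφ.integrable_mul_log t).add (integrable_const 2))
    fun x => mul_abs_log_le_mul_log_add_two (sq_nonneg _)).trans_eq ?_
  rw [integral_add' (hφ.integrable_mul_log t) (integrable_const 2)]
  simp [ent0]

lemma IsLogFlow.abs_ent0_le (hφ : IsLogFlow n U μ lam φ) (t : ℝ) :
    |ent0 μ (φ t)| ≤ entAbs μ (φ t) := by
  rw [ent0, entAbs, ← Real.norm_eq_abs]
  exact norm_integral_le_of_norm_le (hφ.ent_int t)
    (Eventually.of_forall fun x => by simp [abs_mul])

lemma IsLogFlow.exists_flowSize (hφ : IsLogFlow n U μ lam φ) (hlam : lam ≠ 0) (k : ℝ) :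
    ∃ k', k ≤ k' ∧ ∀ s t, |t - s| ≤ 1 → (FlowRel n μ lam φ s t ∨ FlowRel n μ lam φ t s) →
      FlowSize n μ φ k s → FlowSize n μ φ k' t := by
  refine ⟨max k (max (Real.exp (2 * |lam|) * k)
    (k + (k + Real.exp (2 * |lam|) * k) / |lam| + 2)), le_max_left _ _, fun s t hst hrel hs => ?_⟩
  have hk : 0 ≤ k := (massOf_nonneg _).trans hs.mass_le
  have hmass : massOf μ (φ t) = massOf μ (φ s) := hrel.elim (·.mass_eq) (·.mass_eq.symm)
  have henergy : energyOf n μ lam (φ t) = energyOf n μ lam (φ s) :=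
    hrel.elim (·.energy_eq) (·.energy_eq.symm)
  have hgrad : gradE n μ (φ t) ≤ Real.exp (2 * |lam|) * k := by
    have hexp : ∀ r, r ≤ 1 → Real.exp (2 * |lam| * r) * gradE n μ (φ s) ≤
        Real.exp (2 * |lam|) * k := fun r hr =>
      mul_le_mul (Real.exp_le_exp.2 (mul_le_of_le_one_right (by positivity) hr)) hs.grad_le
        (gradE_nonneg _) (Real.exp_nonneg _)
    rw [abs_le] at hst
    exact hrel.elim (fun h => h.grad_le.trans (hexp _ hst.2))
      fun h => h.grad_ge.trans (hexp _ (by linarith [hst.1]))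
  refine ⟨?_, ?_, ?_⟩
  · exact hmass.le.trans (hs.mass_le.trans (le_max_left _ _))
  · exact hgrad.trans ((le_max_left _ _).trans (le_max_right _ _))
  · refine (hφ.entAbs_le t).trans (le_trans ?_ ((le_max_right _ _).trans (le_max_right _ _)))
    rw [energyOf, energyOf, hmass] at henergy
    have e : ent0 μ (φ t) - ent0 μ (φ s) = (gradE n μ (φ s) - gradE n μ (φ t)) / lam := by
      rw [eq_div_iff hlam]
      linarith
    have h1 : ent0 μ (φ t) - ent0 μ (φ s) ≤ (k + Real.exp (2 * |lam|) * k) / |lam| := by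
      rw [e]
      refine (le_abs_self _).trans ?_
      rw [abs_div]
      gcongr
      rw [abs_le]
      have := hs.grad_le
      have := gradE_nonneg (μ := μ) (φ s)
      have := gradE_nonneg (μ := μ) (φ t)
      constructor <;> linarith
    have h2 := (le_abs_self _).trans ((hφ.abs_ent0_le s).trans hs.ent_le)
    linarith

lemma exists_flowSize_nat (n : ℕ) (μ : Measure (EuclideanSpace ℝ (Fin n)))
    (φ : ℝ → EuclideanSpace ℝ (Fin n) → ℂ) (t : ℝ) : ∃ k : ℕ, FlowSize n μ φ k t := by
  obtain ⟨k, hk⟩ := exists_nat_ge (max (massOf μ (φ t)) (max (gradE n μ (φ t)) (entAbs μ (φ t))))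
  simp only [max_le_iff] at hk
  exact ⟨k, hk.1, hk.2.1, hk.2.2⟩

/-- The times near which the conservation laws hold. -/
def flowRegular (n : ℕ) (μ : Measure (EuclideanSpace ℝ (Fin n))) (lam : ℝ)
    (φ : ℝ → EuclideanSpace ℝ (Fin n) → ℂ) : Set ℝ :=
  {t | ∃ δ > 0, ∀ s u, |s - t| < δ → |u - t| < δ → s ≤ u → FlowRel n μ lam φ s u}

lemma isOpen_flowRegular : IsOpen (flowRegular n μ lam φ) := by
  rw [Metric.isOpen_iff]
  rintro t ⟨δ, hδ, h⟩
  refine ⟨δ / 2, by positivity, fun t' ht' => ⟨δ / 2, by positivity, fun s u hs hu => h s u ?_ ?_⟩⟩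
  all_goals
    rw [Metric.mem_ball, Real.dist_eq, abs_lt] at ht'
    rw [abs_lt] at hs hu ⊢
    constructor <;> linarith [ht'.1, ht'.2, hs.1, hs.2, hu.1, hu.2]

lemma flowRel_of_subset_flowRegular {a b : ℝ} (hab : a ≤ b)
    (h : Set.Icc a b ⊆ flowRegular n μ lam φ) : FlowRel n μ lam φ a b := by
  refine rel_of_locally hab FlowRel.refl (fun _ _ _ => FlowRel.trans) fun t ht => ?_
  obtain ⟨δ, hδ, hr⟩ := h ht
  exact ⟨δ, hδ, fun s u hs hu _ _ => hr s u hs hu⟩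

lemma IsLogFlow.flowRel_of_Ioc_subset (hφ : IsLogFlow n U μ lam φ) (hlam : lam ≠ 0) {a t : ℝ}
    (hat : a ≤ t) (hat1 : t - a ≤ 1) (h : Set.Ioc a t ⊆ flowRegular n μ lam φ) :
    FlowRel n μ lam φ a t := by
  obtain ⟨k, hk⟩ := exists_flowSize_nat n μ φ t
  obtain ⟨l, hl⟩ := exists_flowSize_nat n μ φ a
  obtain ⟨k', -, hk'⟩ := hφ.exists_flowSize hlam k
  refine hφ.flowRel_of_flowSize (M := max k' l) hat fun r hr => ?_
  rcases hr.1.eq_or_lt with rfl | har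
  · exact hl.mono (le_max_right _ _)
  · refine (hk' t r ?_ (Or.inr (flowRel_of_subset_flowRegular hr.2 fun q hq =>
      h ⟨har.trans_le hq.1, hq.2⟩)) hk).mono (le_max_left _ _)
    rw [abs_le]
    exact ⟨by linarith [hr.1], by linarith [hr.2]⟩

lemma IsLogFlow.flowRel_of_Ico_subset (hφ : IsLogFlow n U μ lam φ) (hlam : lam ≠ 0) {a t : ℝ}
    (hat : t ≤ a) (hat1 : a - t ≤ 1) (h : Set.Ico t a ⊆ flowRegular n μ lam φ) :
    FlowRel n μ lam φ t a := by
  obtain ⟨k, hk⟩ := exists_flowSize_nat n μ φ t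
  obtain ⟨l, hl⟩ := exists_flowSize_nat n μ φ a
  obtain ⟨k', -, hk'⟩ := hφ.exists_flowSize hlam k
  refine hφ.flowRel_of_flowSize (M := max k' l) hat fun r hr => ?_
  rcases hr.2.eq_or_lt with rfl | har
  · exact hl.mono (le_max_right _ _)
  · refine (hk' t r ?_ (Or.inl (flowRel_of_subset_flowRegular hr.1 fun q hq =>
      h ⟨hq.1, hq.2.trans_lt har⟩)) hk).mono (le_max_left _ _)
    rw [abs_le]
    exact ⟨by linarith [hr.1], by linarith [hr.2]⟩

lemma IsLogFlow.flowRegular_eq_univ (hφ : IsLogFlow n U μ lam φ) (hlam : lam ≠ 0) :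
    flowRegular n μ lam φ = Set.univ := by
  set F := (flowRegular n μ lam φ)ᶜ with hF
  have hcl : IsClosed F := isOpen_flowRegular.isClosed_compl
  by_contra hne
  have hFne : F.Nonempty := Set.nonempty_compl.2 hne
  obtain ⟨k, p, hp, δ₀, hδ₀, hA⟩ := hcl.isLocallyClosed.exists_portion_subset hFne
    (A := fun k : ℕ => {t | FlowSize n μ φ k t})
    (fun k t _ hf => hφ.flowSize_of_frequently (hf.mono fun _ hs => hs.2))
    (fun t _ => exists_flowSize_nat n μ φ t)
  obtain ⟨k', hkk', hk'⟩ := hφ.exists_flowSize hlam k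
  have hsize : ∀ t, |t - p| < min δ₀ 1 → FlowSize n μ φ k' t := fun t ht => by
    have ht1 := ht.trans_le (min_le_right _ _)
    have ht2 := ht.trans_le (min_le_left _ _)
    rw [abs_lt] at ht1 ht2
    rcases le_total p t with hpt | hpt
    · obtain ⟨a, ⟨haF, ha⟩, hmax⟩ := (isCompact_Icc.inter_left hcl).exists_isGreatest
        ⟨p, hp, le_rfl, hpt⟩
      refine hk' a t (by rw [abs_le]; constructor <;> linarith [ha.1, ha.2])
        (Or.inl (hφ.flowRel_of_Ioc_subset hlam ha.2 (by linarith [ha.1]) fun q hq => ?_))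
        (hA a haF (by rw [abs_lt]; constructor <;> linarith [ha.1, ha.2]))
      by_contra hqF
      exact hq.1.not_ge (hmax ⟨hqF, ha.1.trans hq.1.le, hq.2⟩)
    · obtain ⟨a, ⟨haF, ha⟩, hmin⟩ := (isCompact_Icc.inter_left hcl).exists_isLeast
        ⟨p, hp, hpt, le_rfl⟩
      refine hk' a t (by rw [abs_le]; constructor <;> linarith [ha.1, ha.2])
        (Or.inr (hφ.flowRel_of_Ico_subset hlam ha.1 (by linarith [ha.2]) fun q hq => ?_))
        (hA a haF (by rw [abs_lt]; constructor <;> linarith [ha.1, ha.2]))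
      by_contra hqF
      exact hq.2.not_ge (hmin ⟨hqF, hq.1, hq.2.le.trans ha.2⟩)
  refine hp ⟨min δ₀ 1, lt_min hδ₀ one_pos, fun s u hs hu hsu =>
    hφ.flowRel_of_flowSize hsu fun r hr => hsize r ?_⟩
  rw [abs_lt] at hs hu ⊢
  exact ⟨by linarith [hr.1], by linarith [hr.2]⟩

/-- Conservation of mass and energy and gradient growth between arbitrary times. -/
theorem IsLogFlow.flowRel (hφ : IsLogFlow n U μ lam φ) (hlam : lam ≠ 0) {s t : ℝ} (hst : s ≤ t) :
    FlowRel n μ lam φ s t :=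
  flowRel_of_subset_flowRegular hst (by simp [hφ.flowRegular_eq_univ hlam])

/-- Entropy growth. -/
lemma FlowRel.ent0_sub_le (hlam : lam ≠ 0) {s t : ℝ} (h : FlowRel n μ lam φ s t) :
    ent0 μ (φ t) - ent0 μ (φ s) ≤
      1 / |lam| * (Real.exp (2 * |lam| * (t - s)) - 1) * gradE n μ (φ s) := by
  have hE := h.energy_eq
  rw [energyOf, energyOf, h.mass_eq] at hE
  have e : lam * (ent0 μ (φ t) - ent0 μ (φ s)) = gradE n μ (φ s) - gradE n μ (φ t) := by linarith
  have hlam' := abs_pos.2 hlam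
  rw [one_div, mul_assoc, le_inv_mul_iff₀ hlam']
  set E := Real.exp (2 * |lam| * (t - s)) with hEdef
  have hE0 : 0 < E := Real.exp_pos _
  have hle := h.grad_le
  have hge := h.grad_ge
  have hg := gradE_nonneg (μ := μ) (φ s)
  rcases lt_or_gt_of_ne hlam with hl | hl
  · rw [abs_of_neg hl]
    linarith
  · rw [abs_of_pos hl, e]
    have h1 : E⁻¹ * gradE n μ (φ s) ≤ gradE n μ (φ t) := by
      rwa [inv_mul_le_iff₀ hE0]
    have h2 : 1 - E⁻¹ ≤ E - 1 := by
      have h3 : 0 ≤ (E - 1) ^ 2 * E⁻¹ := by positivity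
      have h4 : (E - 1) ^ 2 * E⁻¹ = E - 2 + E⁻¹ := by
        field_simp
        ring
      linarith
    have h5 := mul_le_mul_of_nonneg_right h2 hg
    linarith

end Globalisation

section NormalisedEntropy

variable {n : ℕ} {U : EuclideanSpace ℝ (Fin n) → ℝ} {μ : Measure (EuclideanSpace ℝ (Fin n))}
  {lam : ℝ} {φ : ℝ → EuclideanSpace ℝ (Fin n) → ℂ}

lemma mul_log_div_massOf [μ.IsOpenPosMeasure] {u : EuclideanSpace ℝ (Fin n) → ℂ}
    (hu : Continuous u) (hi : Integrable (fun x => ‖u x‖ ^ 2) μ) (x : EuclideanSpace ℝ (Fin n)) :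
    u x * (Real.log (‖u x‖ ^ 2 / massOf μ u) : ℂ) =
      logNL (u x) - (Real.log (massOf μ u) : ℂ) * u x := by
  by_cases hx : u x = 0
  · simp [hx, logNL]
  · have hm : massOf μ u ≠ 0 := fun hm =>
      hx (by rw [eq_zero_of_massOf_eq_zero hu hi hm, Pi.zero_apply])
    rw [Real.log_div (by simpa using hx) hm, logNL, Complex.ofReal_sub]
    ring

lemma sq_mul_log_div_massOf [μ.IsOpenPosMeasure] {u : EuclideanSpace ℝ (Fin n) → ℂ}
    (hu : Continuous u) (hi : Integrable (fun x => ‖u x‖ ^ 2) μ) (x : EuclideanSpace ℝ (Fin n)) :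
    ‖u x‖ ^ 2 * Real.log (‖u x‖ ^ 2 / massOf μ u) =
      ‖u x‖ ^ 2 * Real.log (‖u x‖ ^ 2) - Real.log (massOf μ u) * ‖u x‖ ^ 2 := by
  by_cases hx : u x = 0
  · simp [hx]
  · have hm : massOf μ u ≠ 0 := fun hm =>
      hx (by rw [eq_zero_of_massOf_eq_zero hu hi hm, Pi.zero_apply])
    rw [Real.log_div (by simpa using hx) hm]
    ring

lemma isLogFlow_of_equation (hg : IsGibbsMeasure n U μ) (hsmooth : ∀ t, ContDiff ℝ ∞ (φ t))
    (htdiff : ∀ x t, DifferentiableAt ℝ (fun s => φ s x) t)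
    (hmass : ∀ t, Integrable (fun x => ‖φ t x‖ ^ 2) μ)
    (hPDE : ∀ t x, Complex.I * deriv (fun s => φ s x) t
      = -(LopC n U (φ t) x) +
        (lam : ℂ) * φ t x * (Real.log (‖φ t x‖ ^ 2 / massOf μ (φ t)) : ℂ))
    (hgrad : ∀ t, Integrable (fun x => gradSqC n (φ t) x) μ)
    (hent : ∀ t, Integrable
      (fun x => ‖φ t x‖ ^ 2 * Real.log (‖φ t x‖ ^ 2 / massOf μ (φ t))) μ) :
    IsLogFlow n U μ lam φ where
  gibbs := hg
  smooth := hsmooth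
  hasDerivAt t x := by
    have := hg.isOpenPosMeasure
    have h := hPDE t x
    rw [mul_assoc, mul_log_div_massOf (hsmooth t).continuous (hmass t)] at h
    have e : deriv (fun s => φ s x) t = flowVel n U μ lam (φ t) x := by
      refine mul_left_cancel₀ Complex.I_ne_zero (h.trans ?_)
      rw [flowVel, ← mul_assoc, Complex.I_mul_I]
      ring
    rw [← e]
    exact (htdiff x t).hasDerivAt
  mass_int := hmass
  grad_int := hgrad
  ent_int t := by
    have := hg.isOpenPosMeasure
    have h := ((hent t).add ((hmass t).const_mul (Real.log (massOf μ (φ t))))).abs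
    refine h.congr (Eventually.of_forall fun x => ?_)
    simp only [Pi.add_apply]
    rw [sq_mul_log_div_massOf (hsmooth t).continuous (hmass t), sub_add_cancel, abs_mul,
      abs_of_nonneg (sq_nonneg ‖φ t x‖)]

lemma IsLogFlow.integral_mul_log_div (hφ : IsLogFlow n U μ lam φ) (t : ℝ) :
    ∫ x, ‖φ t x‖ ^ 2 * Real.log (‖φ t x‖ ^ 2 / massOf μ (φ t)) ∂μ =
      ent0 μ (φ t) - Real.log (massOf μ (φ t)) * massOf μ (φ t) := by
  have := hφ.gibbs.isOpenPosMeasure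
  simp_rw [sq_mul_log_div_massOf (hφ.continuous t) (hφ.mass_int t)]
  rw [integral_sub (hφ.integrable_mul_log t) ((hφ.mass_int t).const_mul _), integral_const_mul]
  rfl

end NormalisedEntropy

/-- Entropy growth bound for the logarithmic Schrödinger equation:
`Ent_μ(|φ(t)|²) ≤ Ent_μ(|f|²) + (1/|λ|)(e^{2|λ|t} − 1)·μ|∇f|²`. -/
theorem lse_entropy_bound (n : ℕ) (U : EuclideanSpace ℝ (Fin n) → ℝ)
    (hU : ContDiff ℝ (⊤ : ℕ∞) U) (hIntU : Integrable (fun x => Real.exp (-U x)))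
    (μ : Measure (EuclideanSpace ℝ (Fin n))) [IsProbabilityMeasure μ]
    (hμ : μ = (ENNReal.ofReal (∫ x, Real.exp (-U x)))⁻¹ •
      MeasureTheory.volume.withDensity (fun x => ENNReal.ofReal (Real.exp (-U x))))
    (lam : ℝ) (hlam : lam ≠ 0) (φ : ℝ → EuclideanSpace ℝ (Fin n) → ℂ)
    (f : EuclideanSpace ℝ (Fin n) → ℂ) (hf0 : φ 0 = f)
    (hsmooth : ∀ t, ContDiff ℝ (⊤ : ℕ∞) (φ t))
    (htdiff : ∀ x t, DifferentiableAt ℝ (fun s => φ s x) t)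
    (hmass : ∀ t, Integrable (fun x => ‖φ t x‖ ^ 2) μ)
    (hPDE : ∀ t x, Complex.I * deriv (fun s => φ s x) t
      = -(LopC n U (φ t) x) +
        (lam : ℂ) * φ t x * (Real.log (‖φ t x‖ ^ 2 / ∫ y, ‖φ t y‖ ^ 2 ∂μ) : ℂ))
    (hgradInt : ∀ t, Integrable (fun x => gradSqC n (φ t) x) μ)
    (hentInt : ∀ t, Integrable
      (fun x => ‖φ t x‖ ^ 2 * Real.log (‖φ t x‖ ^ 2 / ∫ y, ‖φ t y‖ ^ 2 ∂μ)) μ)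
 :
    ∀ t : ℝ, 0 ≤ t →
      ∫ x, ‖φ t x‖ ^ 2 * Real.log (‖φ t x‖ ^ 2 / ∫ y, ‖φ t y‖ ^ 2 ∂μ) ∂μ
        ≤ (∫ x, ‖f x‖ ^ 2 * Real.log (‖f x‖ ^ 2 / ∫ y, ‖f y‖ ^ 2 ∂μ) ∂μ)
          + (1 / |lam|) * (Real.exp (2 * |lam| * t) - 1) * ∫ x, gradSqC n f x ∂μ := by
  intro t ht
  subst hf0
  have hφ : IsLogFlow n U μ lam φ := isLogFlow_of_equation (isGibbsMeasure_of_eq hU hμ) hsmooth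
    htdiff hmass hPDE hgradInt hentInt
  have hrel := hφ.flowRel hlam ht
  have h := hrel.ent0_sub_le hlam
  have h0 := hφ.integral_mul_log_div 0
  have h1 := hφ.integral_mul_log_div t
  rw [hrel.mass_eq] at h1
  rw [sub_zero, gradE] at h
  change ∫ x, ‖φ t x‖ ^ 2 * Real.log (‖φ t x‖ ^ 2 / massOf μ (φ t)) ∂μ ≤
    (∫ x, ‖φ 0 x‖ ^ 2 * Real.log (‖φ 0 x‖ ^ 2 / massOf μ (φ 0)) ∂μ) + _
  rw [hrel.mass_eq, h0, h1]
  linarith
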